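/- Let A be an AW*-algebra, let n be a positive integer, and let X ⊆ M_n(A) be a set of pairwise commuting normal elements. Then there is a unitary u ∈ M_n(A) such that u a u* is a diagonal matrix for every a ∈ X. -/

import Mathlib

universe u

section Defs

variable {R : Type u} [Ring R] [StarRing R]

/-- An element is a projection if it is self-adjoint and idempotent. -/
def IsProjection (p : R) : Prop := star p = p ∧ p * p = p

/-- Order on projections: `e ≤ f` iff `e = ef`. -/
def ProjLE (e f : R) : Prop := e * f = e

/-- Murray–von Neumann equivalence of projections. -/
def ProjEquiv (e f : R) : Prop := ∃ v : R, star v * v = e ∧ v * star v = f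

/-- `e ≼ f` : `e` is equivalent to a subprojection of `f`. -/
def ProjSubEquiv (e f : R) : Prop :=
  ∃ e' : R, IsProjection e' ∧ ProjLE e' f ∧ ProjEquiv e e'

/-- `e ≺ f` : `e ≼ f` but `e` is not equivalent to `f` (with the convention `0 ≺ 0`). -/
def ProjLT (e f : R) : Prop :=
  (ProjSubEquiv e f ∧ ¬ ProjEquiv e f) ∨ (e = 0 ∧ f = 0)

/-- A central projection. -/
def IsCentralProj (z : R) : Prop := IsProjection z ∧ ∀ a : R, z * a = a * z

/-- `c` is the central cover of `e`: the least central projection above `e`. -/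
def IsCentralCover (e c : R) : Prop :=
  IsCentralProj c ∧ ProjLE e c ∧
    ∀ z : R, IsCentralProj z → ProjLE e z → ProjLE c z

/-- A projection `e` is finite if `e ∼ f ≤ e` implies `f = e`. -/
def ProjFinite (e : R) : Prop :=
  ∀ f : R, IsProjection f → ProjEquiv e f → ProjLE f e → f = e

/-- A nonzero projection is properly infinite if `ze` is infinite
for every central projection `z` with `ze ≠ 0`. -/
def ProperlyInfinite (e : R) : Prop :=
  IsProjection e ∧ e ≠ 0 ∧
    ∀ z : R, IsCentralProj z → z * e ≠ 0 → ¬ ProjFinite (z * e)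

/-- A pairwise orthogonal family of elements. -/
def PairwiseOrthogonal {ι : Type*} (p : ι → R) : Prop :=
  ∀ i j, i ≠ j → p i * p j = 0

/-- `s` is the supremum of the family `p` in the projection order. For an
orthogonal family, this is the sum `Σ pᵢ`. -/
def IsSupProj {ι : Type*} (p : ι → R) (s : R) : Prop :=
  IsProjection s ∧ (∀ i, ProjLE (p i) s) ∧
    ∀ t : R, IsProjection t → (∀ i, ProjLE (p i) t) → ProjLE s t

/-- The family `p` belongs to `Γ(e)`: an orthogonal family of projections,
each equivalent to `e`, with sum (supremum) `e`. -/
def InGamma (e : R) {ι : Type u} (p : ι → R) : Prop :=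
  (∀ i, IsProjection (p i)) ∧ PairwiseOrthogonal p ∧
    (∀ i, ProjEquiv (p i) e) ∧ IsSupProj p e

open Classical in
/-- The dimension `d(e)` of a properly infinite projection: the least cardinal
strictly greater than the cardinality of the index set of every family in
`Γ(e)`, with the convention `d(0) = 0`. -/
noncomputable def projDim (e : R) : Cardinal.{u} :=
  if e = 0 then 0
  else sSup {c : Cardinal.{u} |
    ∃ (ι : Type u) (p : ι → R), InGamma e p ∧ c = Order.succ (Cardinal.mk ι)}

/-- A properly infinite projection `e` is equidimensional if `d(ze) = d(e)`
for every central projection `z` with `ze ≠ 0` (equivalently, for every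
nonzero central projection `z ≤ c(e)`). -/
def Equidimensional (e : R) : Prop :=
  ProperlyInfinite e ∧
    ∀ z : R, IsCentralProj z → z * e ≠ 0 → projDim (z * e) = projDim e

/-- An abelian projection: the corner `eRe` is commutative. -/
def IsAbelianProj (e : R) : Prop :=
  IsProjection e ∧ ∀ a b : R, (e * a * e) * (e * b * e) = (e * b * e) * (e * a * e)

/-- `j` is the join `e ∨ f` in the projection lattice. -/
def IsJoinProj (e f j : R) : Prop :=
  IsProjection j ∧ ProjLE e j ∧ ProjLE f j ∧
    ∀ t : R, IsProjection t → ProjLE e t → ProjLE f t → ProjLE j t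

end Defs

/-- The AW*-condition: the right annihilator of any subset is generated by a
projection: `{a | ∀ s ∈ S, s a = 0} = pR`. -/
def IsAWStarRing (R : Type*) [Ring R] [StarRing R] : Prop :=
  ∀ S : Set R, ∃ p : R, IsProjection p ∧
    {a : R | ∀ s ∈ S, s * a = 0} = {a : R | ∃ b : R, a = p * b}

/-- A maximal abelian (*-sub)algebra. -/
def IsMaximalAbelian {A : Type*} [Ring A] [StarRing A] [Algebra ℂ A] [StarModule ℂ A]
    (M : StarSubalgebra ℂ A) : Prop :=
  (∀ x ∈ M, ∀ y ∈ M, x * y = y * x) ∧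
    ∀ N : StarSubalgebra ℂ A, (∀ x ∈ N, ∀ y ∈ N, x * y = y * x) → M ≤ N → M = N

set_option linter.all false
namespace AW
theorem ma {S : Type*} [Semigroup S] (a b c : S) : a * b * c = a * (b * c) := mul_assoc a b c
variable {R : Type u} [CStarAlgebra R]
class AWStar (R : Type*) [CStarAlgebra R] : Prop where
  ann : IsAWStarRing R
abbrev Pj (p : R) : Prop := IsProjection p
theorem Pj.fl {e f : R} (he : Pj e) (hf : Pj f) (h : f * e = e) : e * f = e := by
  have := congrArg star h
  rwa [star_mul, he.1, hf.1] at this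
theorem Pj.fl0 {e f : R} (he : Pj e) (hf : Pj f) (h : e * f = 0) : f * e = 0 := by
  have := congrArg star h
  rwa [star_mul, he.1, hf.1, star_zero] at this
theorem pj_zero : Pj (0 : R) := ⟨star_zero _, by simp⟩
theorem pj_one : Pj (1 : R) := ⟨star_one _, by simp⟩
theorem Pj.add {e f : R} (he : Pj e) (hf : Pj f) (h : e * f = 0) : Pj (e + f) := by
  refine ⟨by rw [star_add, he.1, hf.1], ?_⟩
  have := he.fl0 hf h
  simp [mul_add, add_mul, he.2, hf.2, h, this]
theorem Pj.sub {e f : R} (he : Pj e) (hf : Pj f) (h : f * e = e) : Pj (f - e) := by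
  refine ⟨by rw [star_sub, he.1, hf.1], ?_⟩
  have := he.fl hf h
  simp [mul_sub, sub_mul, he.2, hf.2, h, this]
theorem Pj.mul {e f : R} (he : Pj e) (hf : Pj f) (h : e * f = f * e) : Pj (e * f) := by
  refine ⟨by rw [star_mul, he.1, hf.1, h], ?_⟩
  rw [ma, ← ma f, ← h, ma e f f, hf.2, ← ma, he.2]
theorem Pj.compl {e : R} (he : Pj e) : Pj (1 - e) := he.sub pj_one (by simp)
theorem sq0 {x : R} (h : star x * x = 0) : x = 0 := CStarRing.star_mul_self_eq_zero_iff x |>.1 h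
theorem sq0' {x : R} (h : x * star x = 0) : x = 0 := CStarRing.mul_star_self_eq_zero_iff x |>.1 h
theorem pi_mul {v e : R} (he : Pj e) (h : star v * v = e) : v * e = v := by
  have : v * e - v = 0 := by
    apply sq0
    have h2 := he.2
    simp only [star_sub, star_mul, he.1, mul_sub, sub_mul]
    have h3 : ∀ a b : R, a * star v * (v * b) = a * e * b := by
      intro a b; rw [← h]; simp only [ma]
    have h4 : ∀ b : R, star v * (v * b) = e * b := by
      intro b; rw [← h]; simp only [ma]
    simp [h3, h4, ma, h, h2]
  exact sub_eq_zero.1 this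
theorem pi_mul' {v f : R} (hf : Pj f) (h : v * star v = f) : f * v = v := by
  have := pi_mul (v := star v) hf (by simpa using h)
  have := congrArg star this
  simpa [hf.1] using this
variable [AWStar R]
theorem exists_lsup (S : Set R) : ∃ p : R, Pj p ∧ (∀ s ∈ S, p * s = s) ∧
    ∀ a : R, (∀ s ∈ S, a * s = 0) → a * p = 0 := by
  obtain ⟨q, hq, h⟩ := AWStar.ann (R := R) (star '' S)
  refine ⟨1 - q, Pj.compl hq, ?_, ?_⟩
  · intro s hs
    have : q ∈ {a : R | ∀ s ∈ star '' S, s * a = 0} := by rw [h]; exact ⟨q, hq.2.symm⟩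
    have := this (star s) ⟨s, hs, rfl⟩
    have := congrArg star this
    simp [hq.1] at this
    simp [sub_mul, this]
  · intro a ha
    have : star a ∈ {a : R | ∀ s ∈ star '' S, s * a = 0} := by
      rintro _ ⟨s, hs, rfl⟩
      rw [← star_mul, ha s hs, star_zero]
    rw [h] at this
    obtain ⟨b, hb⟩ := this
    have : star a = q * star a := by rw [hb, ← ma, hq.2]
    have := congrArg star this
    simp [hq.1] at this
    rw [mul_sub, ← this]; simp
noncomputable def psup (S : Set R) : R := (exists_lsup S).choose
theorem pj_psup (S : Set R) : Pj (psup S) := (exists_lsup S).choose_spec.1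
theorem psup_mul {S : Set R} {s : R} (h : s ∈ S) : psup S * s = s :=
  (exists_lsup S).choose_spec.2.1 s h
theorem psup_ann {S : Set R} {a : R} (h : ∀ s ∈ S, a * s = 0) : a * psup S = 0 :=
  (exists_lsup S).choose_spec.2.2 a h
theorem psup_ann' {S : Set R} {a : R} (h : ∀ s ∈ S, star s * a = 0) : psup S * a = 0 := by
  have : star a * psup S = 0 := psup_ann (fun s hs => by
    have := congrArg star (h s hs); simpa using this)
  have := congrArg star this
  simpa [(pj_psup S).1] using this
theorem psup_eq {S : Set R} {a b : R} (h : ∀ s ∈ S, a * s = b * s) : a * psup S = b * psup S := by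
  have := psup_ann (S := S) (a := a - b) (fun s hs => by rw [sub_mul, h s hs, sub_self])
  rwa [sub_mul, sub_eq_zero] at this
theorem psup_le {S : Set R} {f : R} (h : ∀ s ∈ S, f * s = s) : f * psup S = psup S := by
  have := psup_eq (S := S) (a := f) (b := 1) (fun s hs => by rw [h s hs, one_mul])
  rwa [one_mul] at this
theorem psup_comm {S : Set R} {a : R} (h : ∀ s ∈ S, a * s = s * a) (h' : ∀ s ∈ S, star a * s = s * star a) :
    a * psup S = psup S * a := by
  have key : ∀ b : R, (∀ s ∈ S, b * s = s * b) → b * psup S = psup S * b * psup S := by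
    intro b hb
    have : (b - psup S * b) * psup S = 0 := psup_ann (fun s hs => by
      rw [sub_mul, ma, hb s hs, ← ma, psup_mul hs, sub_self])
    rw [sub_mul, sub_eq_zero] at this; exact this
  have h1 := key a h
  have h2 := congrArg star (key (star a) h')
  simp only [star_mul, star_star, (pj_psup S).1] at h2
  rw [h1, h2, ma, ma, (pj_psup S).2]
theorem psup_inter {S : Set R} {a : R} (h : ∀ s ∈ S, psup S * (a * s) = a * s)
    (h' : ∀ s ∈ S, psup S * (star a * s) = star a * s) :
    a * psup S = psup S * a := by
  have key : ∀ b : R, (∀ s ∈ S, psup S * (b * s) = b * s) → b * psup S = psup S * b * psup S := by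
    intro b hb
    have : (b - psup S * b) * psup S = 0 := psup_ann (fun s hs => by
      rw [sub_mul, ma, hb s hs, sub_self])
    rw [sub_mul, sub_eq_zero] at this; exact this
  have h1 := key a h
  have h2 := congrArg star (key (star a) h')
  simp only [star_mul, star_star, (pj_psup S).1] at h2
  rw [h1, h2, ma, ma, (pj_psup S).2]
noncomputable abbrev LP (x : R) : R := psup {x}
noncomputable abbrev fsup {ι : Type*} (e : ι → R) : R := psup (Set.range e)
theorem fsup_mul {ι : Type*} (e : ι → R) (i : ι) : fsup e * e i = e i := psup_mul ⟨i, rfl⟩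
theorem mul_fsup {ι : Type*} {e : ι → R} (he : ∀ i, Pj (e i)) (i : ι) : e i * fsup e = e i :=
  (he i).fl (pj_psup _) (fsup_mul e i)
theorem fsup_ann {ι : Type*} {e : ι → R} {a : R} (h : ∀ i, a * e i = 0) : a * fsup e = 0 :=
  psup_ann (by rintro _ ⟨i, rfl⟩; exact h i)
theorem fsup_eq {ι : Type*} {e : ι → R} {a b : R} (h : ∀ i, a * e i = b * e i) : a * fsup e = b * fsup e :=
  psup_eq (by rintro _ ⟨i, rfl⟩; exact h i)
theorem fsup_le {ι : Type*} {e : ι → R} {f : R} (h : ∀ i, f * e i = e i) : f * fsup e = fsup e :=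
  psup_le (by rintro _ ⟨i, rfl⟩; exact h i)
theorem LP_mul (x : R) : LP x * x = x := psup_mul rfl
theorem LP_ann {x a : R} (h : a * x = 0) : a * LP x = 0 := psup_ann (by rintro _ rfl; exact h)
theorem LP_le {x f : R} (h : f * x = x) : f * LP x = LP x := psup_le (by rintro _ rfl; exact h)
theorem LP_ne {x : R} (h : x ≠ 0) : LP x ≠ 0 := fun h0 => h (by rw [← LP_mul x, h0, zero_mul])
structure Cn (z : R) : Prop where
  pj : Pj z
  cm : ∀ a : R, z * a = a * z
theorem cn_zero : Cn (0 : R) := ⟨pj_zero, by simp⟩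
theorem cn_one : Cn (1 : R) := ⟨pj_one, by simp⟩
theorem Cn.compl {z : R} (h : Cn z) : Cn (1 - z) :=
  ⟨h.pj.compl, fun a => by rw [sub_mul, mul_sub, h.cm]; simp⟩
theorem Cn.mul {z y : R} (h : Cn z) (hy : Cn y) : Cn (z * y) :=
  ⟨h.pj.mul hy.pj (h.cm y), fun a => by rw [ma, hy.cm, ← ma, h.cm, ma]⟩
theorem Cn.sub {z y : R} (h : Cn z) (hy : Cn y) (hl : y * z = z) : Cn (y - z) :=
  ⟨h.pj.sub hy.pj hl, fun a => by rw [sub_mul, mul_sub, h.cm, hy.cm]⟩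
theorem Cn.psup {S : Set R} (h : ∀ s ∈ S, Cn s) : Cn (psup S) :=
  ⟨pj_psup S, fun a => (psup_comm (fun s hs => ((h s hs).cm a).symm) (fun s hs => ((h s hs).cm _).symm)).symm⟩
theorem Cn.pmul {z e : R} (h : Cn z) (he : Pj e) : Pj (z * e) := h.pj.mul he (h.cm e)
theorem Cn.fsup {ι : Type*} {e : ι → R} (h : ∀ i, Cn (e i)) : Cn (fsup e) :=
  Cn.psup (by rintro _ ⟨i, rfl⟩; exact h i)
noncomputable def cc (e : R) : R := psup (Set.range fun a : R => a * e)
theorem cc_mul (e : R) : cc e * e = e := by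
  have : e ∈ Set.range fun a : R => a * e := ⟨1, one_mul e⟩
  exact psup_mul this
theorem cn_cc (e : R) : Cn (cc e) := by
  refine ⟨pj_psup _, fun a => (psup_inter ?_ ?_).symm⟩ <;>
  · rintro _ ⟨b, rfl⟩
    exact psup_mul ⟨_, ma _ _ _⟩
theorem cc_le {e z : R} (hz : Cn z) (h : z * e = e) : z * cc e = cc e :=
  psup_le (by rintro _ ⟨b, rfl⟩; show z * (b * e) = b * e; rw [← ma, hz.cm, ma, h])
theorem cc_ann {e f : R} (h : ∀ a : R, f * a * e = 0) : f * cc e = 0 :=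
  psup_ann (by rintro _ ⟨b, rfl⟩; show f * (b * e) = 0; rw [← ma, h])
theorem cc_zmul {e z : R} (hz : Cn z) (he : Pj e) : cc (z * e) = z * cc e := by
  have h1 : z * cc e * cc (z * e) = cc (z * e) := cc_le (hz.mul (cn_cc e)) (by
    have := cc_mul e; have := hz.cm (cc e); have := hz.cm e; have := hz.pj.2; grind)
  have h2 : cc (z * e) * (z * cc e) = z * cc e := by
    have hz' := cn_cc (z * e)
    have := cc_ann (e := e) (f := z - cc (z*e) * z) (by
      intro a
      have h3 := cc_mul (z * e)
      have : z * a * e = cc (z*e) * z * a * e := by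
        rw [ma (cc (z*e)), hz.cm a, ← ma, hz'.cm a, ma a, ma a, ma a, ma _ z, h3]
      rw [sub_mul, sub_mul, this, sub_self])
    rw [sub_mul, sub_eq_zero] at this
    rw [← ma, ← this]
  rw [← h1, ← (cn_cc (z*e)).cm, h2]
end AW
namespace AW
variable {R : Type u} [CStarAlgebra R]
abbrev Ev (e f : R) : Prop := ProjEquiv e f
def Sb (e f : R) : Prop := ∃ v : R, star v * v = e ∧ f * v = v
theorem pj_final {v : R} (h : Pj (star v * v)) : Pj (v * star v) := by
  refine ⟨by simp, ?_⟩
  have := pi_mul h rfl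
  rw [ma, ← ma (star v), ← ma, this]
theorem Ev.refl {e : R} (he : Pj e) : Ev e e := ⟨e, by rw [he.1, he.2], by rw [he.1, he.2]⟩
theorem Ev.symm {e f : R} (h : Ev e f) : Ev f e := by
  obtain ⟨v, h1, h2⟩ := h; exact ⟨star v, by simpa using h2, by simpa using h1⟩
theorem Ev.pj {e f : R} (h : Ev e f) (he : Pj e) : Pj f := by
  obtain ⟨v, h1, h2⟩ := h; rw [← h2]; exact pj_final (h1 ▸ he)
theorem Ev.trans {e f g : R} (he : Pj e) (h : Ev e f) (h' : Ev f g) : Ev e g := by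
  have hf := h.pj he
  have hg := h'.pj hf
  obtain ⟨v, h1, h2⟩ := h; obtain ⟨w, h3, h4⟩ := h'
  have h5 := pi_mul he h1
  have h6 := pi_mul' hf h2
  have h7 := pi_mul hf h3
  refine ⟨w * v, ?_, ?_⟩
  · rw [star_mul, ma, ← ma (star w), h3, h6, h1]
  · rw [star_mul, ma, ← ma v, h2, ← ma, h7, h4]
theorem Ev.sb {e f : R} (he : Pj e) (h : Ev e f) : Sb e f := by
  have hf := h.pj he
  obtain ⟨v, h1, h2⟩ := h
  exact ⟨v, h1, pi_mul' hf h2⟩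
theorem Sb.ex {e f : R} (he : Pj e) (h : Sb e f) : ∃ g, Pj g ∧ f * g = g ∧ Ev e g := by
  obtain ⟨v, h1, h2⟩ := h
  exact ⟨v * star v, pj_final (h1 ▸ he), by rw [← ma, h2], v, h1, rfl⟩
theorem Sb.of_le {e f : R} (he : Pj e) (h : f * e = e) : Sb e f := ⟨e, by rw [he.1, he.2], h⟩
theorem Sb.trans {e f g : R} (hf : Pj f) (h : Sb e f) (h' : Sb f g) : Sb e g := by
  obtain ⟨v, h1, h2⟩ := h; obtain ⟨w, h3, h4⟩ := h'
  exact ⟨w * v, by rw [star_mul, ma, ← ma (star w), h3, h2, h1], by rw [← ma, h4]⟩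
theorem Sb.le {e f g : R} (h : Sb e f) (h' : g * f = f) : Sb e g := by
  obtain ⟨v, h1, h2⟩ := h
  exact ⟨v, h1, by rw [← h2, ← ma, h']⟩
theorem Sb.sub {e f d : R} (hd : Pj d) (h : Sb e f) (h' : e * d = d) : Sb d f := by
  obtain ⟨v, h1, h2⟩ := h
  exact ⟨v * d, by rw [star_mul, ma, ← ma (star v), h1, h', hd.1, hd.2], by rw [← ma, h2]⟩
theorem Ev.zero {e : R} (h : Ev e 0) : e = 0 := by
  obtain ⟨v, h1, h2⟩ := h; rw [← h1, sq0' h2]; simp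
theorem Sb.zero {e : R} (h : Sb e 0) : e = 0 := by
  obtain ⟨v, h1, h2⟩ := h; rw [zero_mul] at h2; rw [← h1, ← h2]; simp
theorem Sb.bot (f : R) : Sb 0 f := ⟨0, by simp, by simp⟩
theorem Ev.add {e f e' f' : R} (he : Pj e) (he' : Pj e') (h : Ev e f) (h' : Ev e' f') (ho : e * e' = 0)
    (ho' : f * f' = 0) : Ev (e + e') (f + f') := by
  have hf := h.pj he
  have hf' := h'.pj he'
  obtain ⟨v, h1, h2⟩ := h; obtain ⟨w, h3, h4⟩ := h'
  have a1 := pi_mul he h1; have a2 := pi_mul' hf h2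
  have a3 := pi_mul he' h3; have a4 := pi_mul' hf' h4
  have b1 : v * star w = 0 := by
    rw [← a1, ← a3, star_mul, he'.1, ma, ← ma e, ho]; simp
  have b2 : star v * w = 0 := by
    rw [← a2, ← a4, star_mul, hf.1, ma, ← ma f, ho']; simp
  have b3 : w * star v = 0 := by have := congrArg star b1; simpa using this
  have b4 : star w * v = 0 := by have := congrArg star b2; simpa using this
  exact ⟨v + w, by simp [mul_add, add_mul, b2, b4, h1, h3], by simp [mul_add, add_mul, b1, b3, h2, h4]⟩
theorem Sb.add {e f e' f' : R} (he : Pj e) (he' : Pj e') (hf : Pj f) (hf' : Pj f') (h : Sb e f) (h' : Sb e' f')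
    (ho : e * e' = 0) (ho' : f * f' = 0) : Sb (e + e') (f + f') := by
  obtain ⟨g, hg, hl, hv⟩ := h.ex he
  obtain ⟨g', hg', hl', hv'⟩ := h'.ex he'
  have o : g * g' = 0 := by
    rw [← hg.fl hf hl, ← hl', ma, ← ma f, ho']; simp
  have o1 : f * g' = 0 := by rw [← hl', ← ma, ho', zero_mul]
  have o2 : f' * g = 0 := by rw [← hl, ← ma, hf.fl0 hf' ho', zero_mul]
  exact ((Ev.add he he' hv hv' ho o).sb (he.add he' ho)).le (by simp [mul_add, add_mul, hl, hl', o1, o2])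
theorem Ev.cut {e f g : R} (he : Pj e) (h : Ev e f) (hg : Pj g) (hl : e * g = g) :
    ∃ k, Pj k ∧ f * k = k ∧ Ev g k ∧ Ev (e - g) (f - k) := by
  have hf := h.pj he
  obtain ⟨v, h1, h2⟩ := h
  have a1 := pi_mul he h1; have a2 := pi_mul' hf h2
  have hl' := hg.fl he hl
  have c1 : star (v * g) * (v * g) = g := by
    rw [star_mul, ma, ← ma (star v), h1, hl, hg.1, hg.2]
  have c2 : v * g * star (v * g) = v * g * star v := by
    rw [star_mul, hg.1, ← ma, ma v, hg.2]
  refine ⟨v * g * star (v * g), pj_final (by rw [c1]; exact hg), ?_, ⟨v * g, c1, rfl⟩, v * (e - g), ?_, ?_⟩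
  · rw [← ma, ← ma, a2]
  · have := hg.sub he hl
    rw [star_mul, ma, ← ma (star v), h1, this.1]
    simp [mul_sub, sub_mul, he.2, hl, hl', hg.2]
  · rw [star_mul, c2, (hg.sub he hl).1, mul_sub, a1]
    simp only [sub_mul, mul_sub]
    have : v * g * (e * star v) = v * g * star v := by rw [← ma, ma v, hl']
    have h3 : v * g * (g * star v) = v * g * star v := by rw [← ma, ma v, hg.2]
    have h4 : v * (e * star v) = f := by rw [← ma, a1, h2]
    rw [this, h3, h4, ← ma]
    abel
variable [AWStar R]
theorem Ev.zmul {e f z : R} (hz : Cn z) (h : Ev e f) : Ev (z * e) (z * f) := by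
  obtain ⟨v, h1, h2⟩ := h
  refine ⟨z * v, ?_, ?_⟩
  · rw [star_mul, hz.pj.1, ← h1, ma, ← ma z z, hz.pj.2, ← ma, ← hz.cm (star v), ma]
  · rw [star_mul, hz.pj.1, ← h2, ← hz.cm, ← ma, ma z v z, ← hz.cm v, ← ma, hz.pj.2, ma]
theorem Sb.zmul {e f z : R} (hz : Cn z) (he : Pj e) (h : Sb e f) : Sb (z * e) (z * f) := by
  obtain ⟨g, hg, hl, hv⟩ := h.ex he
  refine ((hv.zmul hz).sb (hz.pmul he)).le ?_
  rw [hz.cm f, ma, ← ma z, hz.pj.2, ← ma, ← hz.cm, ma, hl]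
theorem Sb.cn {e f z : R} (hz : Cn z) (h : Sb e f) (hf : z * f = f) : z * e = e := by
  obtain ⟨v, h1, h2⟩ := h
  rw [← h1, ← ma, hz.cm, ma]
  have : z * v = v := by rw [← h2, ← ma, hf]
  rw [this]
theorem Ev.cn {e f z : R} (hz : Cn z) (he : Pj e) (h : Ev e f) (hf : z * f = f) : z * e = e := (h.sb he).cn hz hf
theorem Ev.zz {e f z : R} (hz : Cn z) (he : Pj e) (h : Ev e f) (hf : z * f = 0) : z * e = 0 := by
  have := h.zmul hz; rw [hf] at this; exact this.zero
structure Orth {ι : Type*} (e : ι → R) : Prop where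
  pj : ∀ i, Pj (e i)
  or : ∀ i j, i ≠ j → e i * e j = 0
theorem Sb.cc {e f : R} (h : Sb e f) : AW.cc f * e = e := h.cn (cn_cc f) (cc_mul f)
theorem Sb.cc_le {e f : R} (h : Sb e f) : AW.cc f * AW.cc e = AW.cc e := AW.cc_le (cn_cc f) h.cc
theorem OA {ι : Type*} {e f w : ι → R} (he : Orth e) (hf : Orth f) (hef : ∀ i j, e i * f j = 0)
    (h1 : ∀ i, star (w i) * w i = e i) (h2 : ∀ i, w i * star (w i) = f i) :
    ∃ v, star v * v = fsup e ∧ v * star v = fsup f ∧ (∀ i, v * e i = w i) := by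
  have we : ∀ i, w i * e i = w i := fun i => pi_mul (he.pj i) (h1 i)
  have fw : ∀ i, f i * w i = w i := fun i => pi_mul' (hf.pj i) (h2 i)
  have hfe : ∀ i j, f i * e j = 0 := fun i j => (he.pj j).fl0 (hf.pj i) (hef j i)
  have ew : ∀ i, e i * star (w i) = star (w i) := fun i => by
    have := congrArg star (we i); simpa [(he.pj i).1] using this
  have wf : ∀ i, star (w i) * f i = star (w i) := fun i => by
    have := congrArg star (fw i); simpa [(hf.pj i).1] using this
  have wfz : ∀ i j, w i * f j = 0 := fun i j => by rw [← we i, ma, hef, mul_zero]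
  have wez : ∀ i j, i ≠ j → w i * e j = 0 := fun i j h => by rw [← we i, ma, he.or i j h, mul_zero]
  have sez : ∀ i j, star (w i) * e j = 0 := fun i j => by rw [← wf i, ma, hfe, mul_zero]
  have sfz : ∀ i j, i ≠ j → star (w i) * f j = 0 := fun i j h => by rw [← wf i, ma, hf.or i j h, mul_zero]
  have ewz : ∀ i j, e i * w j = 0 := fun i j => by rw [← fw j, ← ma, hef, zero_mul]
  have fwz : ∀ i j, i ≠ j → f i * w j = 0 := fun i j h => by rw [← fw j, ← ma, hf.or i j h, zero_mul]
  have esz : ∀ i j, i ≠ j → e i * star (w j) = 0 := fun i j h => by rw [← ew j, ← ma, he.or i j h, zero_mul]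
  have fsz : ∀ i j, f i * star (w j) = 0 := fun i j => by rw [← ew j, ← ma, hfe, zero_mul]
  have ww : ∀ i j, w i * w j = 0 := fun i j => by rw [← we i, ma, ewz, mul_zero]
  have ss : ∀ i j, star (w i) * star (w j) = 0 := fun i j => by rw [← star_mul, ww, star_zero]
  have wsz : ∀ i j, i ≠ j → w i * star (w j) = 0 := fun i j h => by rw [← we i, ma, esz i j h, mul_zero]
  have swz : ∀ i j, i ≠ j → star (w i) * w j = 0 := fun i j h => by rw [← wf i, ma, fwz i j h, mul_zero]
  set g : ι → R := fun i => (1/2 : ℂ) • (e i + f i + w i + star (w i)) with hg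
  have gg : ∀ i, g i * g i = g i := fun i => by
    simp only [hg, smul_mul_smul_comm, mul_add, add_mul, (he.pj i).2, (hf.pj i).2, hef, hfe, we, fw, ew, wf, wfz, sez, ewz, fsz, ww, ss, h1, h2]
    rw [show (1/2 : ℂ) * (1/2) = (1/4 : ℂ) by norm_num]
    module
  have gj : ∀ i, Pj (g i) := fun i => ⟨by
    simp only [hg, star_smul, star_add, star_star, (he.pj i).1, (hf.pj i).1]
    rw [show star (1/2 : ℂ) = (1/2 : ℂ) by simp]
    module, gg i⟩
  have gz : ∀ i j, i ≠ j → g i * g j = 0 := fun i j h => by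
    simp only [hg, smul_mul_smul_comm, mul_add, add_mul, he.or i j h, hf.or i j h, hef, hfe, wez i j h, sfz i j h, fwz i j h, esz i j h, wsz i j h, swz i j h, wfz, sez, ewz, fsz, ww, ss]
    simp
  have ege : ∀ i j, i ≠ j → e i * g j = 0 := fun i j h => by
    simp only [hg, mul_smul_comm, mul_add, he.or i j h, hef, ewz, esz i j h]; simp
  have fgf : ∀ i j, i ≠ j → f i * g j = 0 := fun i j h => by
    simp only [hg, mul_smul_comm, mul_add, hf.or i j h, hfe, fsz, fwz i j h]; simp
  set G := fsup g
  have eG : ∀ i, e i * G = e i * g i := fun i => by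
    have : (e i - e i * g i) * G = 0 := fsup_ann (fun j => by
      by_cases h : i = j
      · subst h; rw [sub_mul, ma, gg, sub_self]
      · rw [sub_mul, ma, gz i j h, ege i j h]; simp)
    rw [sub_mul, sub_eq_zero, ma, mul_fsup gj] at this; exact this
  have fG : ∀ i, f i * G = f i * g i := fun i => by
    have : (f i - f i * g i) * G = 0 := fsup_ann (fun j => by
      by_cases h : i = j
      · subst h; rw [sub_mul, ma, gg, sub_self]
      · rw [sub_mul, ma, gz i j h, fgf i j h]; simp)
    rw [sub_mul, sub_eq_zero, ma, mul_fsup gj] at this; exact this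
  have hG : Pj G := pj_psup _
  have hE : Pj (fsup e) := pj_psup _
  have hF : Pj (fsup f) := pj_psup _
  have Ge : ∀ i, G * e i = g i * e i := fun i => by
    have := congrArg star (eG i); simpa [(he.pj i).1, hG.1, (gj i).1] using this
  have Gf : ∀ i, G * f i = g i * f i := fun i => by
    have := congrArg star (fG i); simpa [(hf.pj i).1, hG.1, (gj i).1] using this
  have Fe : ∀ i, fsup f * e i = 0 := fun i => by
    exact (he.pj i).fl0 hF (fsup_ann (hef i))
  have Ef : ∀ i, fsup e * f i = 0 := fun i => by
    exact (hf.pj i).fl0 hE (fsup_ann (hfe i))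
  have Fw : ∀ i, fsup f * w i = w i := fun i => by rw [← fw i, ← ma, fsup_mul]
  have Es : ∀ i, fsup e * star (w i) = star (w i) := fun i => by rw [← ew i, ← ma, fsup_mul]
  have c1 : ∀ i, (2 : ℂ) • (fsup f * G * fsup e) * e i = w i := fun i => by
    rw [smul_mul_assoc, ma, fsup_mul, ma, Ge]
    simp only [hg, smul_mul_assoc, mul_smul_comm, mul_add, add_mul, (he.pj i).2, hfe, we, sez, Fe, Fw]
    simp
  have c2 : ∀ i, star ((2 : ℂ) • (fsup f * G * fsup e)) * f i = star (w i) := fun i => by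
    simp only [star_smul, star_mul, hE.1, hF.1, hG.1, smul_mul_assoc, ma]
    rw [fsup_mul, Gf]
    simp only [hg, smul_mul_assoc, mul_smul_comm, mul_add, add_mul, (hf.pj i).2, hef, wfz, wf, Ef, Es]
    simp
  generalize hv : (2 : ℂ) • (fsup f * G * fsup e) = v at c1 c2
  have vE : v * fsup e = v := by rw [← hv, smul_mul_assoc, ma, hE.2]
  have vF : star v * fsup f = star v := by
    rw [← hv, star_smul, star_mul, star_mul, hF.1, smul_mul_assoc, ma, ma, hF.2]
  refine ⟨v, ?_, ?_, c1⟩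
  · have : star v * v * fsup e = 1 * fsup e := fsup_eq (fun i => by
      rw [ma, c1, ← fw i, ← ma, c2, h1, one_mul])
    rwa [ma, vE, one_mul] at this
  · have : v * star v * fsup f = 1 * fsup f := fsup_eq (fun i => by
      rw [ma, c2, ← ew i, ← ma, c1, h2, one_mul])
    rwa [ma, vF, one_mul] at this
end AW
namespace AW
variable {R : Type u} [CStarAlgebra R]
theorem zorn_pw {α : Type*} (P : α → Prop) (r : α → α → Prop) (hr : ∀ a b, r a b → r b a) :
    ∃ S : Set α, (∀ a ∈ S, P a) ∧ S.Pairwise r ∧ ∀ a, P a → (∀ s ∈ S, r a s) → a ∈ S := by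
  obtain ⟨S, hS⟩ := zorn_subset {S : Set α | (∀ a ∈ S, P a) ∧ S.Pairwise r} (by
    intro c hc hch
    refine ⟨⋃₀ c, ⟨?_, ?_⟩, fun s hs => Set.subset_sUnion_of_mem hs⟩
    · rintro a ⟨s, hs, ha⟩; exact (hc hs).1 a ha
    · exact (Set.pairwise_sUnion hch.directedOn).2 (fun s hs => (hc hs).2))
  refine ⟨S, hS.prop.1, hS.prop.2, fun a ha h => ?_⟩
  have : insert a S ∈ {S : Set α | (∀ a ∈ S, P a) ∧ S.Pairwise r} := by
    refine ⟨?_, ?_⟩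
    · rintro b (rfl | hb)
      · exact ha
      · exact hS.prop.1 b hb
    · exact hS.prop.2.insert (fun b hb _ => ⟨h b hb, hr _ _ (h b hb)⟩)
  exact hS.le_of_ge this (Set.subset_insert a S) (Set.mem_insert a S)
theorem comm_star {a h : R} (hs : star h = h) (c : a * h = h * a) : star a * h = h * star a := by
  have := congrArg star c
  simp only [star_mul, hs] at this
  exact this.symm
variable [AWStar R]
theorem LP_comm {a h : R} (hs : star h = h) (c : a * h = h * a) : a * LP h = LP h * a :=
  psup_comm (by rintro _ rfl; exact c) (by rintro _ rfl; exact comm_star hs c)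
theorem T1 {h : R} (hs : star h = h) (hp : ∀ t ∈ spectrum ℝ h, 0 ≤ t) (h0 : h ≠ 0) :
    ∃ e b : R, Pj e ∧ e ≠ 0 ∧ star b = b ∧ b * h * b = e ∧ h * b * b = e ∧ b * e = b ∧ e * b = b ∧
      (∀ a : R, a * h = h * a → a * e = e * a) ∧ (∀ a : R, a * h = h * a → a * b = b * a) := by
  have hsa : IsSelfAdjoint h := hs
  set ε : ℝ := ‖h‖ / 2
  have hε : 0 < ε := by have := norm_pos_iff.2 h0; positivity
  let g : ℝ → ℝ := fun t => max (t - ε) 0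
  let c : ℝ → ℝ := fun t => (Real.sqrt (max t ε))⁻¹
  have hg : Continuous g := by fun_prop
  have hc : Continuous c := by
    apply Continuous.inv₀ (by fun_prop)
    intro t; have : 0 < max t ε := lt_max_of_lt_right hε
    positivity
  have hg0 : cfc g h ≠ 0 := by
    intro H
    have : h = cfc (fun t => t) h := (cfc_id' ℝ h hsa).symm
    have h2 : cfc (fun t => t - g t) h = h := by
      rw [cfc_sub (fun t => t) g h continuousOn_id hg.continuousOn, H, sub_zero, ← this]
    have h3 : ‖h‖ ≤ ε := by
      rw [← h2]
      apply norm_cfc_le hε.le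
      intro t ht
      have := hp t ht
      simp only [g, Real.norm_eq_abs]
      rw [abs_le]
      constructor <;> rcases le_total (t - ε) 0 with h | h <;> simp [h] <;> linarith
    have := norm_pos_iff.2 h0
    simp only [ε] at h3; linarith
  have cg : cfc (fun t => t * (c t * c t) * g t) h = cfc g h := by
    apply cfc_congr
    intro t ht
    have := hp t ht
    simp only [g]
    rcases le_total (t - ε) 0 with h | h
    · simp [h]
    · have h1 : max t ε = t := max_eq_left (by linarith)
      have h2 : 0 < t := by linarith
      have h3 := Real.mul_self_sqrt h2.le
      have h4 : Real.sqrt t ≠ 0 := by positivity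
      have h5 : t * ((Real.sqrt t)⁻¹ * (Real.sqrt t)⁻¹) = 1 := by
        rw [← mul_inv, h3, mul_inv_cancel₀ h2.ne']
      simp only [c, h1, h5, one_mul]
  have cg2 : h * (cfc c h * cfc c h) * cfc g h = cfc g h := by
    rw [cfc_mul _ g h (by fun_prop) hg.continuousOn, cfc_mul (fun t => t) _ h (by fun_prop) (by fun_prop), cfc_mul c c h (by fun_prop) (by fun_prop), cfc_id' ℝ h hsa] at cg
    exact cg
  have cb : ∀ a : R, a * h = h * a → a * cfc c h = cfc c h * a := fun a ha =>
    ((show Commute h a from ha.symm).cfc_real c).symm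
  have cgg : ∀ a : R, a * h = h * a → a * cfc g h = cfc g h * a := fun a ha =>
    ((show Commute h a from ha.symm).cfc_real g).symm
  have gs : star (cfc g h) = cfc g h := (cfc_predicate g h : IsSelfAdjoint _)
  have cs : star (cfc c h) = cfc c h := (cfc_predicate c h : IsSelfAdjoint _)
  have ce : ∀ a : R, a * h = h * a → a * LP (cfc g h) = LP (cfc g h) * a := fun a ha => LP_comm gs (cgg a ha)
  generalize cfc c h = B at *
  have key : h * (B * B) * LP (cfc g h) = 1 * LP (cfc g h) := psup_eq (by rintro _ rfl; rw [cg2, one_mul])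
  rw [one_mul] at key
  have hE : Pj (LP (cfc g h)) := pj_psup _
  have hE0 := LP_ne hg0
  generalize LP (cfc g h) = e at *
  have eh := ce h rfl
  have hB := cb h rfl
  have eB := ce B (by rw [hB])
  have x1 : h * (B * e) * (B * e) = e := by
    calc h * (B * e) * (B * e) = h * (B * ((e * B) * e)) := by simp only [ma]
      _ = h * (B * B) * e := by rw [← eB, ma B, hE.2]; simp only [ma]
      _ = e := key
  refine ⟨e, B * e, hE, hE0, by rw [star_mul, cs, hE.1, eB], ?_, x1, by rw [ma, hE.2], by rw [← ma, ← eB, ma, hE.2], ce, ?_⟩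
  · rw [ma B, ← eh, ← ma B, ← hB, ma h B e, x1]
  · intro a ha; rw [← ma, cb a ha, ma, ce a ha, ma]
theorem T1x {x : R} (h0 : x ≠ 0) :
    ∃ e w d : R, Pj e ∧ e ≠ 0 ∧ star w * w = e ∧ w * d = x * e ∧ (∃ k, w = x * k) ∧ (∃ k, e = star x * k) := by
  have hs : star (star x * x) = star x * x := by simp
  obtain ⟨e, b, he, he0, bs, h1, h2, h3, h4, h5, h6⟩ := T1 hs (fun t ht => spectrum_star_mul_self_nonneg t ht)
    (fun h => h0 (sq0 h))
  exact ⟨e, x * b, star x * x * b, he, he0, by rw [star_mul, bs, ← h1]; simp only [ma],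
    by rw [← h1]; simp only [ma], ⟨b, rfl⟩, ⟨x * b * b, by rw [← h2]; simp only [ma]⟩⟩
theorem corner {e f a : R} (he : Pj e) (hf : Pj f) (h0 : f * a * e ≠ 0) :
    ∃ v : R, star v * v ≠ 0 ∧ Pj (star v * v) ∧ e * (star v * v) = star v * v ∧ f * v = v := by
  obtain ⟨q, w, d, hq, hq0, h1, h2, ⟨k, h3⟩, ⟨k', h4⟩⟩ := T1x h0
  refine ⟨w, h1 ▸ hq0, h1 ▸ hq, ?_, by rw [h3]; simp only [← ma, hf.2]⟩
  rw [h1, h4]; simp only [star_mul, ← ma, he.1, he.2]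
theorem T2u {e f : R} (he : Pj e) (hf : Pj f) : ∃ c u : R, Pj c ∧ c * e = e * c ∧ c * f = f * c ∧
    star u = u ∧ u * u = c ∧ u * e = f * u ∧ (∀ a : R, a * (e + f - 1) = (e + f - 1) * a → a * u = u * a) ∧
    e * (1 - c) = (1 - f) * (1 - c) := by
  set s := e + f - 1 with hs
  have ss : star s = s := by simp [hs, he.1, hf.1]
  have hsa : IsSelfAdjoint s := ss
  have se : s * e = f * s := by simp [hs, mul_add, add_mul, mul_sub, sub_mul, he.2, hf.2]
  have es : e * s = s * f := by simp [hs, mul_add, add_mul, mul_sub, sub_mul, he.2, hf.2]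
  have s2e : e * (s * s) = (s * s) * e := by rw [← ma, es, ma, ← se, ma]
  have s2f : f * (s * s) = (s * s) * f := by rw [← ma, ← se, ma, es, ma]
  let P := cfc (fun t : ℝ => max t 0) s
  let N := cfc (fun t : ℝ => max (-t) 0) s
  have PN : P * N = 0 := by
    simp only [P, N]
    rw [← cfc_mul _ _ s (by fun_prop) (by fun_prop)]
    rw [← cfc_const_zero ℝ s]
    apply cfc_congr; intro t _
    rcases le_total t 0 with h | h <;> simp [h]
  have Psub : P - N = s := by
    simp only [P, N]
    rw [← cfc_sub _ _ s (by fun_prop) (by fun_prop)]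
    conv_rhs => rw [← cfc_id' ℝ s hsa]
    apply cfc_congr; intro t _
    rcases le_total t 0 with h | h <;> simp [h]
  have Pst : star P = P := (cfc_predicate _ s : IsSelfAdjoint _)
  have Nst : star N = N := (cfc_predicate _ s : IsSelfAdjoint _)
  have NP : N * P = 0 := by have := congrArg star PN; simpa [Pst, Nst] using this
  have abs : P + N = cfc Real.sqrt (s * s) := by
    simp only [P, N]
    rw [← cfc_add (a := s) _ _ (by fun_prop) (by fun_prop)]
    have : s * s = cfc (fun t : ℝ => t * t) s := by
      rw [cfc_mul (fun t : ℝ => t) (fun t : ℝ => t) s (by fun_prop) (by fun_prop), cfc_id' ℝ s hsa]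
    rw [this, ← cfc_comp' Real.sqrt (fun t : ℝ => t * t) s (by fun_prop) (by fun_prop)]
    apply cfc_congr; intro t _
    simp only [Real.sqrt_mul_self_eq_abs]
    rcases le_total t 0 with h | h <;> simp [h, abs_of_nonpos, abs_of_nonneg]
  have ae : e * (P + N) = (P + N) * e := by
    rw [abs]; exact ((show Commute (s*s) e from s2e.symm).cfc_real Real.sqrt).symm
  have af : f * (P + N) = (P + N) * f := by
    rw [abs]; exact ((show Commute (s*s) f from s2f.symm).cfc_real Real.sqrt).symm
  have ast : star (P + N) = P + N := by rw [star_add, Pst, Nst]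
  set c := LP (P + N) with hc
  have ce : e * c = c * e := LP_comm ast ae
  have cf : f * c = c * f := LP_comm ast af
  have hcp : Pj c := pj_psup _
  have hp : Pj (LP P) := pj_psup _
  have hn : Pj (LP N) := pj_psup _
  have pN : LP P * N = 0 := psup_ann' (by rintro _ rfl; rw [Pst, PN])
  have nP : LP N * P = 0 := psup_ann' (by rintro _ rfl; rw [Nst, NP])
  have pn : LP P * LP N = 0 := LP_ann pN
  have np : LP N * LP P = 0 := LP_ann nP
  set u := LP P - LP N with hu
  have us : star u = u := by rw [hu, star_sub, hp.1, hn.1]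
  have ua : u * (P + N) = s := by
    rw [hu, mul_add, sub_mul, sub_mul, LP_mul, LP_mul, pN, nP, ← Psub]; simp [sub_eq_add_neg]
  have uu : u * u = LP P + LP N := by simp [hu, mul_sub, sub_mul, hp.2, hn.2, pn, np]
  have sq : ∀ y : R, y * (P + N) = 0 → y * P = 0 ∧ y * N = 0 := by
    intro y hy
    have h1 : y * P * P = 0 := by
      have : (P + N) * P = P * P := by rw [add_mul, NP, add_zero]
      rw [ma, ← this, ← ma, hy, zero_mul]
    have h2 : y * N * N = 0 := by
      have : (P + N) * N = N * N := by rw [add_mul, PN, zero_add]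
      rw [ma, ← this, ← ma, hy, zero_mul]
    constructor <;> apply sq0'
    · rw [star_mul, Pst, ← ma, h1, zero_mul]
    · rw [star_mul, Nst, ← ma, h2, zero_mul]
  have ccov : (1 - c) * (P + N) = 0 := by rw [sub_mul, hc, LP_mul, one_mul, sub_self]
  have cuu : c = LP P + LP N := by
    have h1 := LP_ann (sq _ ccov).1
    have h2 := LP_ann (sq _ ccov).2
    rw [sub_mul, one_mul, sub_eq_zero] at h1 h2
    have h3 : (LP P + LP N) * c = c := LP_le (by rw [mul_add, add_mul, add_mul, LP_mul, LP_mul, nP, pN]; simp)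
    rw [← hcp.fl (hp.add hn pn) h3, mul_add, ← h1, ← h2]
  rw [← cuu] at uu
  have uc : u * c = u := by
    rw [cuu, hu, mul_add, sub_mul, sub_mul, hp.2, hn.2, pn, np]; simp [sub_eq_add_neg]
  have cu : c * u = u := by
    have := congrArg star uc; simpa [us, hcp.1] using this
  have ue : u * e = f * u := by
    have : (u * e - f * u) * c = 0 := LP_ann (by
      rw [sub_mul, ma, ae, ← ma, ua, ma, ua, se, sub_self])
    rw [sub_mul, sub_eq_zero, ma, ce, ← ma, uc, ma, uc] at this
    exact this
  have eu : e * u = u * f := by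
    have := congrArg star ue; simpa [us, he.1, hf.1] using this
  have sc : s * (1 - c) = 0 := by
    have : s * c = s := by
      have h1 : (P + N) * c = P + N := by
        have := congrArg star (LP_mul (P + N)); rwa [star_mul, ast, ← hc, hcp.1] at this
      rw [← ua, ma, h1]
    rw [mul_sub, mul_one, this, sub_self]
  refine ⟨c, u, hcp, ce.symm, cf.symm, us, uu, ue, fun a ha => ?_, ?_⟩
  · have h1 : a * P = P * a := ((show Commute s a from ha.symm).cfc_real _).symm
    have h2 : a * N = N * a := ((show Commute s a from ha.symm).cfc_real _).symm
    rw [hu, mul_sub, sub_mul, LP_comm Pst h1, LP_comm Nst h2]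
  · have : e * (1 - c) - (1 - f) * (1 - c) = s * (1 - c) := by rw [hs]; noncomm_ring
    rw [sc] at this; exact sub_eq_zero.1 this
theorem T2 {e f : R} (he : Pj e) (hf : Pj f) : ∃ c : R, Pj c ∧ c * e = e * c ∧ c * f = f * c ∧
    Ev (e * c) (f * c) ∧ e * (1 - c) = (1 - f) * (1 - c) := by
  obtain ⟨c, u, hcp, ce, cf, us, uu, ue, _, h⟩ := T2u he hf
  have eu : e * u = u * f := by
    have := congrArg star ue; simpa [us, he.1, hf.1] using this
  refine ⟨c, hcp, ce, cf, ⟨u * e, ?_, ?_⟩, h⟩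
  · rw [star_mul, he.1, us, ma, ← ma u, uu, ← ma, ← ce, ma, he.2]
  · rw [star_mul, he.1, us, ue, eu, ma, ← ma u u, uu, cf, ← ma, hf.2]
end AW
namespace AW
variable {R : Type u} [CStarAlgebra R]
theorem Pj.norm_le {p : R} (h : Pj p) : ‖p‖ ≤ 1 := by
  have h1 : ‖p‖ * ‖p‖ = ‖p‖ := by
    have := CStarRing.norm_star_mul_self (x := p)
    rw [h.1, h.2] at this; exact this.symm
  nlinarith [norm_nonneg p]
section ord
attribute [local instance] CStarAlgebra.spectralOrder CStarAlgebra.spectralOrderedRing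
theorem bin1 [AWStar R] {h : R} (h0 : 0 ≤ h) (h1 : h ≤ 1) : ∃ p : R, Pj p ∧ 0 ≤ 2 * h - p ∧ 2 * h - p ≤ 1 ∧
    ∀ a : R, a * h = h * a → a * p = p * a := by
  have hsa : IsSelfAdjoint h := IsSelfAdjoint.of_nonneg h0
  let P := cfc (fun t : ℝ => max (2 * t - 1) 0) h
  let N := cfc (fun t : ℝ => max (1 - 2 * t) 0) h
  have PN : P * N = 0 := by
    simp only [P, N]
    rw [← cfc_mul _ _ h (by fun_prop) (by fun_prop)]
    rw [← cfc_const_zero ℝ h]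
    apply cfc_congr; intro t _
    rcases le_total (2 * t) 1 with h | h <;> simp [h]
  have Psub : P - N = 2 * h - 1 := by
    simp only [P, N]
    rw [← cfc_sub _ _ h (by fun_prop) (by fun_prop)]
    have : cfc (fun t : ℝ => 2 * t - 1) h = 2 * h - 1 := by
      rw [cfc_sub _ _ h (by fun_prop) (by fun_prop), cfc_const_mul 2 _ h (by fun_prop), cfc_id' ℝ h hsa, cfc_const_one ℝ h]
      simp [two_mul, two_smul]
    rw [← this]
    apply cfc_congr; intro t _
    rcases le_total (2 * t) 1 with h | h <;> simp [h]
  have Pp : 0 ≤ P := cfc_nonneg (fun t _ => le_max_right _ _)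
  have Np : 0 ≤ N := cfc_nonneg (fun t _ => le_max_right _ _)
  have Pst : star P = P := (cfc_predicate _ h : IsSelfAdjoint _)
  have Nst : star N = N := (cfc_predicate _ h : IsSelfAdjoint _)
  have comm : ∀ a : R, a * h = h * a → a * LP P = LP P * a := fun a ha =>
    LP_comm Pst ((show Commute h a from ha.symm).cfc_real _).symm
  have hp : Pj (LP P) := pj_psup _
  have pP : LP P * P = P := LP_mul P
  have pN : LP P * N = 0 := psup_ann' (by rintro _ rfl; rw [Pst, PN])
  generalize LP P = p at *
  have Pp' : P * p = P := by have := congrArg star pP; simpa [Pst, hp.1] using this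
  have Np' : N * p = 0 := by have := congrArg star pN; simpa [Nst, hp.1] using this
  have h2 : 2 * h = P - N + 1 := by rw [Psub]; simp
  refine ⟨p, hp, ?_, ?_, comm⟩
  · have e1 : 2 * h - p = P + (star (1 - p) * (2 * h) * (1 - p)) := by
      rw [hp.compl.1, h2]
      simp only [mul_add, add_mul, mul_sub, sub_mul, one_mul, mul_one, pP, pN, Pp', Np', hp.2, zero_mul]
      abel
    rw [e1]
    exact add_nonneg Pp (star_left_conjugate_nonneg (by rw [two_mul]; exact add_nonneg h0 h0) _)
  · rw [← sub_nonneg]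
    have e1 : 1 - (2 * h - p) = N + (star p * (2 * (1 - h)) * p) := by
      rw [hp.1, show (2 : R) * (1 - h) = 2 - 2 * h by rw [mul_sub, mul_one], h2]
      rw [show (2 : R) = 1 + 1 by norm_num]
      simp only [mul_add, add_mul, mul_sub, sub_mul, one_mul, mul_one, pP, pN, Pp', Np', hp.2, zero_mul]
      abel
    rw [e1]
    have := sub_nonneg.2 h1
    exact add_nonneg Np (star_left_conjugate_nonneg (by rw [two_mul]; exact add_nonneg this this) _)
theorem bin [AWStar R] {h : R} (h0 : 0 ≤ h) (h1 : h ≤ 1) : ∃ p : ℕ → R, (∀ m, Pj (p m)) ∧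
    (∀ m, ∀ a : R, a * h = h * a → a * p m = p m * a) ∧
    HasSum (fun m => ((1/2 : ℝ)^(m+1)) • p m) h := by
  let T := {h : R // 0 ≤ h ∧ h ≤ 1}
  choose q hq1 hq2 hq3 hq4 using fun t : T => bin1 t.2.1 t.2.2
  let nx : T → T := fun t => ⟨2 * t.1 - q t, hq2 t, hq3 t⟩
  let s : ℕ → T := fun m => nx^[m] ⟨h, h0, h1⟩
  have ssucc : ∀ m, s (m+1) = nx (s m) := fun m => Function.iterate_succ_apply' _ _ _
  have comm : ∀ m, ∀ a : R, a * h = h * a → a * (s m).1 = (s m).1 * a := by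
    intro m a ha
    induction m with
    | zero => exact ha
    | succ m ih =>
      rw [ssucc]
      show a * (2 * (s m).1 - q (s m)) = (2 * (s m).1 - q (s m)) * a
      rw [mul_sub, sub_mul, hq4 _ a ih, two_mul, mul_add, add_mul, ih]
  have part : ∀ M, ∑ m ∈ Finset.range M, ((1/2 : ℝ)^(m+1)) • q (s m) = h - ((1/2 : ℝ)^M) • (s M).1 := by
    intro M
    induction M with
    | zero => simp [s]
    | succ M ih =>
      rw [Finset.sum_range_succ, ih, ssucc]
      show _ = h - ((1/2 : ℝ)^(M+1)) • (2 * (s M).1 - q (s M))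
      rw [smul_sub, two_mul, pow_succ]
      module
  have nrm : ∀ M, ‖(s M).1‖ ≤ 1 := fun M => (CStarAlgebra.norm_le_one_iff_of_nonneg _ (s M).2.1).2 (s M).2.2
  have hg := summable_geometric_of_lt_one (r := (1/2 : ℝ)) (by norm_num) (by norm_num)
  have sm : Summable (fun m => ((1/2 : ℝ)^(m+1)) • q (s m)) := by
    refine Summable.of_norm_bounded hg (fun m => ?_)
    rw [norm_smul]
    have := (hq1 (s m)).norm_le
    have h2 : (0:ℝ) < (1/2)^m := by positivity
    rw [Real.norm_of_nonneg (by positivity), pow_succ]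
    nlinarith [norm_nonneg (q (s m))]
  refine ⟨fun m => q (s m), fun m => hq1 _, fun m a ha => hq4 _ a (comm m a ha), ?_⟩
  rw [sm.hasSum_iff_tendsto_nat]
  simp only [part]
  have : Filter.Tendsto (fun M => ((1/2 : ℝ)^M) • (s M).1) Filter.atTop (nhds 0) := by
    apply squeeze_zero_norm (a := fun M => (1/2 : ℝ)^M)
    · intro M
      rw [norm_smul, Real.norm_of_nonneg (by positivity)]
      have h2 : (0:ℝ) < (1/2)^M := by positivity
      nlinarith [nrm M]
    · exact tendsto_pow_atTop_nhds_zero_of_lt_one (by norm_num) (by norm_num)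
  simpa using tendsto_const_nhds.sub this
theorem sa_half {a : R} (ha : star a = a) (hn : ‖a‖ ≤ 1) :
    0 ≤ (1/2 : ℝ) • (a + 1) ∧ (1/2 : ℝ) • (a + 1) ≤ 1 := by
  have hsa : IsSelfAdjoint a := ha
  have h1 := hsa.neg_algebraMap_norm_le_self
  have h2 := hsa.le_algebraMap_norm_self
  have h3 : algebraMap ℝ R ‖a‖ ≤ 1 := by
    rw [← map_one (algebraMap ℝ R)]; rw [← sub_nonneg, ← map_sub]; rw [Algebra.algebraMap_eq_smul_one]; exact smul_nonneg (sub_nonneg.2 hn) zero_le_one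
  have h4 : 0 ≤ a + 1 := by
    have : - (1 : R) ≤ a := le_trans (neg_le_neg h3) h1
    have := sub_nonneg.2 this
    simpa using this
  have h5 : 0 ≤ 1 - a := sub_nonneg.2 (h2.trans h3)
  refine ⟨smul_nonneg (by norm_num) h4, ?_⟩
  rw [← sub_nonneg]
  have : 1 - (1/2 : ℝ) • (a + 1) = (1/2 : ℝ) • (1 - a) := by module
  rw [this]
  exact smul_nonneg (by norm_num) h5
theorem spec_nonneg {h : R} (h0 : 0 ≤ h) : ∀ t ∈ spectrum ℝ h, 0 ≤ t := fun t ht => spectrum_nonneg_of_nonneg h0 ht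
theorem T1s [AWStar R] {m : Type*} [Fintype m] {x : m → R} (h0 : ∃ k, x k ≠ 0) :
    ∃ e b : R, Pj e ∧ e ≠ 0 ∧ star b = b ∧ b * (∑ k, star (x k) * x k) * b = e ∧
     (∑ k, star (x k) * x k) * b * b = e ∧ b * e = b ∧ e * b = b ∧
      (∀ a : R, a * (∑ k, star (x k) * x k) = (∑ k, star (x k) * x k) * a → a * e = e * a) ∧
      (∀ a : R, a * (∑ k, star (x k) * x k) = (∑ k, star (x k) * x k) * a → a * b = b * a) := by
  have hn : ∀ k ∈ Finset.univ, 0 ≤ star (x k) * x k := fun k _ => star_mul_self_nonneg _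
  refine T1 (by simp [star_sum]) (spec_nonneg (Finset.sum_nonneg hn)) ?_
  intro h
  rw [Finset.sum_eq_zero_iff_of_nonneg hn] at h
  obtain ⟨k, hk⟩ := h0
  exact hk (sq0 (h k (Finset.mem_univ _)))
theorem sumsq0 {m : Type*} [Fintype m] {x : m → R} (h : ∑ k, star (x k) * x k = 0) (k : m) : x k = 0 := by
  have hn : ∀ k ∈ Finset.univ, 0 ≤ star (x k) * x k := fun k _ => star_mul_self_nonneg _
  rw [Finset.sum_eq_zero_iff_of_nonneg hn] at h
  exact sq0 (h k (Finset.mem_univ _))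
end ord
variable [AWStar R]
theorem spanP {h q a : R} (hs : star h = h)
    (H : ∀ p, Pj p → (∀ b, b * h = h * b → b * p = p * b) → a * (q * p) = q * p * a)
    : a * (q * h) = q * h * a := by
  by_cases h0 : h = 0
  · simp [h0]
  have hn := norm_pos_iff.2 h0
  set k := (‖h‖⁻¹ : ℝ) • h with hk
  have ks : star k = k := by simp [hk, hs]
  have kn : ‖k‖ ≤ 1 := by rw [hk, norm_smul, norm_inv, norm_norm, inv_mul_cancel₀ hn.ne']
  obtain ⟨k0, k1⟩ := sa_half ks kn
  obtain ⟨p, p1, p2, p3⟩ := bin k0 k1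
  have e1 := H 1 pj_one (by simp)
  simp only [mul_one] at e1
  have hp : ∀ m, a * (q * p m) = q * p m * a := fun m => H _ (p1 m) (fun b hb => p2 m b (by
    simp only [hk, mul_smul_comm, smul_mul_assoc, mul_add, add_mul, hb, mul_one, one_mul]))
  have s1 := (p3.mul_left q).mul_left a
  have s2 := (p3.mul_left q).mul_right a
  have : (fun m => a * (q * ((1/2 : ℝ)^(m+1)) • p m)) = (fun m => q * ((1/2 : ℝ)^(m+1)) • p m * a) := by
    funext m; simp only [mul_smul_comm, smul_mul_assoc, hp]
  rw [this] at s1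
  have s3 := s1.unique s2
  simp only [mul_smul_comm, smul_mul_assoc, mul_add, add_mul, mul_one, e1, hk] at s3
  have s4 := smul_right_injective R (show (1/2 : ℝ) ≠ 0 by norm_num) s3
  have s5 := add_right_cancel s4
  exact smul_right_injective R (inv_ne_zero hn.ne') s5
theorem CGsa {ι : Type*} {z : ι → R} (hz : ∀ i, Cn (z i)) (ho : ∀ i j, i ≠ j → z i * z j = 0)
    {x : ι → R} (hs : ∀ i, star (x i) = x i) (hn : ∀ i, ‖x i‖ ≤ 1) : ∃ y : R, ∀ i, z i * y = z i * x i := by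
  choose p p1 p2 p3 using fun i => bin (sa_half (hs i) (hn i)).1 (sa_half (hs i) (hn i)).2
  let Q : ℕ → R := fun m => fsup (fun i => z i * p i m)
  have hQ : ∀ m, Pj (Q m) := fun m => pj_psup _
  have zQ : ∀ i m, z i * Q m = z i * p i m := fun i m => by
    have h1 : z i * Q m = z i * p i m * Q m := fsup_eq (fun j => by
      by_cases h : i = j
      · subst h; rw [← ma, (hz i).pj.2, ((hz i).pmul (p1 i m)).2]
      · rw [← ma, ho i j h, (hz i).cm, ma, ← ma (z i), ho i j h]; simp)
    rw [h1]; exact mul_fsup (e := fun i => z i * p i m) (fun i => (hz i).pmul (p1 i m)) i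
  have hg := summable_geometric_of_lt_one (r := (1/2 : ℝ)) (by norm_num) (by norm_num)
  have sm : Summable (fun m => ((1/2 : ℝ)^(m+1)) • Q m) := by
    refine Summable.of_norm_bounded hg (fun m => ?_)
    rw [norm_smul]
    have := (hQ m).norm_le
    have h2 : (0:ℝ) < (1/2)^m := by positivity
    rw [Real.norm_of_nonneg (by positivity), pow_succ]
    nlinarith [norm_nonneg (Q m)]
  obtain ⟨Y, hY⟩ := sm
  refine ⟨(2 : ℝ) • Y - 1, fun i => ?_⟩
  have s1 := hY.mul_left (z i)
  have s2 := (p3 i).mul_left (z i)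
  simp only [mul_smul_comm, zQ] at s1 s2
  have s3 := s1.unique s2
  rw [mul_sub, mul_smul_comm, s3, mul_add]
  module
theorem CG {ι : Type*} {z : ι → R} (hz : ∀ i, Cn (z i)) (ho : ∀ i j, i ≠ j → z i * z j = 0)
    {x : ι → R} (hx : ∀ i, z i * x i = x i) (hn : ∀ i, ‖x i‖ ≤ 1) :
    ∃ y : R, (∀ i, z i * y = x i) ∧ fsup z * y = y := by
  obtain ⟨y1, h1⟩ := CGsa hz ho (x := fun i => (1/2 : ℝ) • (x i + star (x i))) (fun i => by simp [add_comm]) (fun i => by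
    rw [norm_smul]; have := norm_add_le (x i) (star (x i)); rw [norm_star] at this
    rw [Real.norm_of_nonneg (by norm_num)]; linarith [hn i])
  obtain ⟨y2, h2⟩ := CGsa hz ho (x := fun i => (-Complex.I/2) • (x i - star (x i))) (fun i => by
    simp only [star_smul, star_sub, star_star]
    rw [show star (-Complex.I/2) = -(-Complex.I/2) by simp; ring]
    module) (fun i => by
    rw [norm_smul]; have := norm_sub_le (x i) (star (x i)); rw [norm_star] at this
    rw [show ‖-Complex.I/2‖ = 1/2 by simp]; linarith [hn i])
  refine ⟨fsup z * (y1 + Complex.I • y2), fun i => ?_, by rw [← ma, (pj_psup _).2]⟩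
  rw [← ma, mul_fsup (fun i => (hz i).pj), mul_add, mul_smul_comm, h1, h2]
  rw [mul_smul_comm, mul_smul_comm, mul_add, mul_sub, hx, smul_smul]
  rw [show Complex.I * (-Complex.I/2) = (1/2 : ℂ) by
    rw [mul_div_assoc', mul_neg, Complex.I_mul_I]; norm_num]
  rw [show ((1/2 : ℝ) • (x i + z i * star (x i)) : R) = (1/2 : ℂ) • (x i + z i * star (x i)) by
    rw [← Complex.coe_smul]; norm_num]
  module
end AW
namespace AW
variable {R : Type u} [CStarAlgebra R] [AWStar R]
theorem Cn.le_mul {z e : R} (hz : Cn z) (he : Pj e) : e * (z * e) = z * e := by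
  rw [← ma, ← hz.cm, ma, he.2]
theorem Cn.le_mul2 {z e : R} (hz : Cn z) : z * (z * e) = z * e := by
  rw [← ma, hz.pj.2]
theorem Cn.mono {z e f : R} (hz : Cn z) (h : f * e = e) : (z * f) * (z * e) = z * e := by
  rw [hz.cm f, ma, ← ma z, hz.pj.2, ← ma, ← hz.cm, ma, h]
theorem Cn.split {z : R} (hz : Cn z) (e : R) : e = z * e + (1 - z) * e := by rw [sub_mul]; simp
theorem Cn.orth {z e f : R} (hz : Cn z) : (z * e) * ((1 - z) * f) = 0 := by
  rw [hz.cm e, ma, ← ma z, mul_sub, hz.pj.2]; simp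
theorem Cn.ort {z e f : R} (hz : Cn z) (h : e * f = 0) : (z * e) * (z * f) = 0 := by
  rw [ma, ← ma e, ← hz.cm, ma, h]; simp
theorem Ev.join {z e f : R} (hz : Cn z) (he : Pj e) (h1 : Ev (z * e) (z * f))
    (h2 : Ev ((1 - z) * e) ((1 - z) * f)) : Ev e f := by
  rw [hz.split e, hz.split f]
  exact h1.add (hz.pmul he) (hz.compl.pmul he) h2 hz.orth hz.orth
theorem GCo {e f : R} (he : Pj e) (hf : Pj f) (hef : e * f = 0) :
    ∃ z : R, Cn z ∧ Sb (z * e) (z * f) ∧ Sb ((1 - z) * f) ((1 - z) * e) := by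
  obtain ⟨S, hS1, hS2, hS3⟩ := zorn_pw (fun v : R => star v * v ≠ 0 ∧ Pj (star v * v) ∧ e * (star v * v) = star v * v ∧ f * v = v)
    (fun v w => star v * w = 0 ∧ v * star w = 0) (fun v w h => ⟨by
      have := congrArg star h.1; simpa using this, by have := congrArg star h.2; simpa using this⟩)
  let E : S → R := fun s => star s.1 * s.1
  let F : S → R := fun s => s.1 * star s.1
  have oE : Orth E := ⟨fun s => (hS1 s s.2).2.1, fun s t h => by
    have := (hS2 s.2 t.2 (fun h' => h (Subtype.ext h'))).2
    show star s.1 * s.1 * (star t.1 * t.1) = 0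
    rw [ma, ← ma s.1, this]; simp⟩
  have oF : Orth F := ⟨fun s => pj_final (hS1 s s.2).2.1, fun s t h => by
    have := (hS2 s.2 t.2 (fun h' => h (Subtype.ext h'))).1
    show s.1 * star s.1 * (t.1 * star t.1) = 0
    rw [ma, ← ma (star s.1), this]; simp⟩
  have eE : ∀ s, e * E s = E s := fun s => (hS1 s s.2).2.2.1
  have fF : ∀ s, f * F s = F s := fun s => by
    show f * (s.1 * star s.1) = _; rw [← ma, (hS1 s s.2).2.2.2]
  have oEF : ∀ s t, E s * F t = 0 := fun s t => by
    rw [← (oE.pj s).fl he (eE s), ← fF t, ma, ← ma e, hef]; simp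
  obtain ⟨v, hv1, hv2, -⟩ := OA oE oF oEF (w := fun s => s.1) (fun s => rfl) (fun s => rfl)
  have pE : Pj (fsup E) := pj_psup _
  have pF : Pj (fsup F) := pj_psup _
  have leE : e * fsup E = fsup E := fsup_le eE
  have leF : f * fsup F = fsup F := fsup_le fF
  have ev : Ev (fsup E) (fsup F) := ⟨v, hv1, hv2⟩
  have pe1 := pE.sub he leE
  have pf1 := pF.sub hf leF
  have zero : ∀ a : R, (f - fsup F) * a * (e - fsup E) = 0 := by
    intro a
    by_contra h0
    obtain ⟨w, w0, w1, w2, w3⟩ := corner pe1 pf1 h0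
    have fF1 : ∀ s, F s * (f - fsup F) = 0 := fun s => by
      rw [mul_sub, mul_fsup oF.pj, (oF.pj s).fl hf (fF s), sub_self]
    have eE1 : ∀ s, (e - fsup E) * E s = 0 := fun s => by
      rw [sub_mul, fsup_mul, eE, sub_self]
    have we : w * (e - fsup E) = w := by
      have h1 := pi_mul w1 rfl
      rw [← h1, ma, w1.fl pe1 w2]
    have := hS3 w ⟨w0, w1, by
        rw [← w2, ← ma, mul_sub, he.2, leE], by rw [← w3, ← ma, mul_sub, hf.2, leF]⟩
      (fun s hs => by
        have h1 : star s * (s * star s) = star s := by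
          have := pi_mul (oE.pj ⟨s, hs⟩) rfl
          have := congrArg star this; rw [← ma]; simpa [E] using this
        have h2 : (star s * s) * star s = star s := by rw [ma, h1]
        have a1 : star w * s = 0 := by
          have : star s * w = 0 := by
            rw [← w3, ← h1]; simp only [ma]
            have := fF1 ⟨s, hs⟩
            simp only [F, ma] at this
            rw [← ma (star s) (f - fsup F), ← ma s, this]; simp
          have := congrArg star this; simpa using this
        have a2 : w * star s = 0 := by
          rw [← we, ← h2, ma, ← ma _ (star s * s)]
          rw [show (e - fsup E) * (star s * s) = 0 from eE1 ⟨s, hs⟩]; simp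
        exact ⟨a1, a2⟩)
    apply w0
    have h1 := fsup_mul E ⟨w, this⟩
    have h2 : fsup E * (e - fsup E) = 0 := by rw [mul_sub, pE.fl he leE, pE.2, sub_self]
    show star w * w = 0
    change fsup E * (star w * w) = star w * w at h1
    rw [← h1, ← w2, ← ma, h2, zero_mul]
  have h1 := cc_ann zero
  have hz := cn_cc (e - fsup E)
  refine ⟨1 - cc (e - fsup E), hz.compl, ?_, ?_⟩
  · have : (1 - cc (e - fsup E)) * e = (1 - cc (e - fsup E)) * fsup E := by
      have := cc_mul (e - fsup E)
      rw [mul_sub] at this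
      simp only [sub_mul, one_mul]
      have h3 : cc (e - fsup E) * e = cc (e - fsup E) * fsup E + (e - fsup E) := by rw [add_comm]; exact sub_eq_iff_eq_add.1 this
      rw [h3]; abel
    rw [this]
    exact ((ev.zmul hz.compl).sb (hz.compl.pmul pE)).le (hz.compl.mono leF)
  · rw [sub_sub_cancel]
    have : cc (e - fsup E) * f = cc (e - fsup E) * fsup F := by
      rw [← hz.cm, mul_sub] at h1; exact sub_eq_zero.1 h1
    rw [this]
    exact ((ev.symm.zmul hz).sb (hz.pmul pF)).le (hz.mono leE)
theorem GC {e f : R} (he : Pj e) (hf : Pj f) :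
    ∃ z : R, Cn z ∧ Sb (z * e) (z * f) ∧ Sb ((1 - z) * f) ((1 - z) * e) := by
  obtain ⟨c, hc, ce, cf, ev, h⟩ := T2 he hf
  have pe : Pj (e * c) := he.mul hc ce.symm
  have pf : Pj (f * c) := hf.mul hc cf.symm
  have ce' : (1 - c) * e = e * (1 - c) := by rw [sub_mul, mul_sub, ce]; simp
  have cf' : (1 - c) * f = f * (1 - c) := by rw [sub_mul, mul_sub, cf]; simp
  have pe' : Pj (e * (1 - c)) := he.mul hc.compl ce'.symm
  have pf' : Pj (f * (1 - c)) := hf.mul hc.compl cf'.symm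
  have oe : (e * c) * (e * (1 - c)) = 0 := by
    rw [← ce', ← ma, ma e, mul_sub, hc.2]; simp
  have of : (f * c) * (f * (1 - c)) = 0 := by
    rw [← cf', ← ma, ma f, mul_sub, hc.2]; simp
  have o2 : (e * (1 - c)) * (f * (1 - c)) = 0 := by
    rw [h, ← cf', ma, ← ma (1-c), hc.compl.2, cf', ← ma, sub_mul, hf.2]; simp
  have se : e = e * c + e * (1 - c) := by rw [mul_sub]; simp
  have sf : f = f * c + f * (1 - c) := by rw [mul_sub]; simp
  obtain ⟨z, hz, h1, h2⟩ := GCo pe' pf' o2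
  refine ⟨z, hz, ?_, ?_⟩
  · rw [se, sf, mul_add, mul_add]
    exact ((ev.zmul hz).sb (hz.pmul pe)).add (hz.pmul pe) (hz.pmul pe') (hz.pmul pf) (hz.pmul pf') h1 (hz.ort oe) (hz.ort of)
  · rw [se, sf, mul_add, mul_add]
    have hz := hz.compl
    exact ((ev.symm.zmul hz).sb (hz.pmul pf)).add (hz.pmul pf) (hz.pmul pf') (hz.pmul pe) (hz.pmul pe') h2 (hz.ort of) (hz.ort oe)
theorem conj_pj {v p e : R} (hp : Pj p) (hv : star v * v = e) (h : e * p = p) : Pj (v * p * star v) := by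
  refine ⟨by simp [ma, hp.1], ?_⟩
  calc v * p * star v * (v * p * star v) = v * p * ((star v * v) * p) * star v := by simp only [ma]
    _ = v * p * star v := by rw [hv, h, ma v, hp.2]
theorem conj_ev {v p e : R} (hp : Pj p) (hv : star v * v = e) (h : e * p = p) : Ev p (v * p * star v) :=
  ⟨v * p, by rw [star_mul, ma, ← ma (star v), hv, h, hp.1, hp.2], by
    rw [star_mul, hp.1, ma, ← ma p, hp.2, ma]⟩
theorem conj_mono {v p q e : R} (hv : star v * v = e) (h : e * p = p) (hpq : q * p = p) :
    (v * q * star v) * (v * p * star v) = v * p * star v := by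
  calc v * q * star v * (v * p * star v) = v * (q * ((star v * v) * p)) * star v := by simp only [ma]
    _ = v * p * star v := by rw [hv, h, hpq]
theorem compl_mono {p q f : R} (hp : Pj p) (hf : Pj f) (hq : f * q = q) (hpf : f * p = p) (hpq : q * p = p) (hq' : Pj q) :
    (f - p) * (f - q) = f - q := by
  have := hp.fl hf hpf
  have := hp.fl hq' hpq
  simp [mul_sub, sub_mul, hf.2, *]
theorem SB {e f : R} (he : Pj e) (hf : Pj f) (h : Sb e f) (h' : Sb f e) : Ev e f := by
  obtain ⟨v, hv, hv'⟩ := h; obtain ⟨w, hw, hw'⟩ := h'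
  let ps : R → R := fun p => v * p * star v
  let ch : R → R := fun p => w * p * star w
  let φ : R → R := fun p => e - ch (f - ps p)
  have fps : ∀ p, f * ps p = ps p := fun p => by simp only [ps, ← ma, hv']
  have ech : ∀ p, e * ch p = ch p := fun p => by simp only [ch, ← ma, hw']
  have pps : ∀ p, Pj p → e * p = p → Pj (ps p) := fun p hp h => conj_pj hp hv h
  have pfs : ∀ p, Pj p → e * p = p → Pj (f - ps p) := fun p hp h => (pps p hp h).sub hf (fps p)
  have lfs : ∀ p, f * (f - ps p) = f - ps p := fun p => by rw [mul_sub, hf.2, fps]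
  have pch : ∀ p, Pj p → e * p = p → Pj (ch (f - ps p)) := fun p hp h => conj_pj (pfs p hp h) hw (lfs p)
  have pφ : ∀ p, Pj p → e * p = p → Pj (φ p) := fun p hp h => (pch p hp h).sub he (ech _)
  have lφ : ∀ p, e * φ p = φ p := fun p => by simp only [φ, mul_sub, he.2, ech]
  have mφ : ∀ p q, Pj p → Pj q → e * p = p → e * q = q → q * p = p → φ q * φ p = φ p := by
    intro p q hp hq hep heq hqp
    have a1 : ps q * ps p = ps p := conj_mono hv hep hqp
    have a2 : (f - ps p) * (f - ps q) = f - ps q :=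
      compl_mono (pps p hp hep) hf (fps q) (fps p) a1 (pps q hq heq)
    have a3 : ch (f - ps p) * ch (f - ps q) = ch (f - ps q) := conj_mono hw (lfs q) a2
    exact compl_mono (pch q hq heq) he (ech _) (ech _) a3 (pch p hp hep)
  let S : Set R := {p | Pj p ∧ e * p = p ∧ φ p * p = p}
  have hP : Pj (psup S) := pj_psup S
  have leP : e * psup S = psup S := psup_le (fun s hs => hs.2.1)
  have k1 : φ (psup S) * psup S = psup S := psup_le (fun s hs => by
    have := mφ s _ hs.1 hP hs.2.1 leP (psup_mul hs)
    rw [← hs.2.2, ← ma, this])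
  have k2 : psup S * φ (psup S) = φ (psup S) :=
    psup_mul ⟨pφ _ hP leP, lφ _, mφ _ _ hP (pφ _ hP leP) leP (lφ _) k1⟩
  have k3 : φ (psup S) = psup S := by rw [← k2]; exact hP.fl (pφ _ hP leP) k1
  have k4 : e - psup S = ch (f - ps (psup S)) := by
    have : e - ch (f - ps (psup S)) = psup S := k3
    have := sub_eq_iff_eq_add.1 this
    rw [sub_eq_iff_eq_add, add_comm]; exact this
  have e1 : Ev (psup S) (ps (psup S)) := conj_ev hP hv leP
  have e2 : Ev (f - ps (psup S)) (e - psup S) := by rw [k4]; exact conj_ev (pfs _ hP leP) hw (lfs _)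
  have e3 := e1.add hP (hP.sub he leP) e2.symm (by rw [mul_sub, hP.fl he leP, hP.2, sub_self])
    (by rw [mul_sub, (pps _ hP leP).fl hf (fps _), (pps _ hP leP).2, sub_self])
  simpa using e3
theorem pi_norm {v : R} (h : Pj (star v * v)) : ‖v‖ ≤ 1 := by
  have h1 := CStarRing.norm_star_mul_self (x := v)
  have := h.norm_le
  nlinarith [norm_nonneg v]
theorem fsup_eqz {ι : Type*} {z : ι → R} (hz : ∀ i, Cn (z i)) {a b : R} (h : ∀ i, z i * a = z i * b) :
    fsup z * a = fsup z * b := by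
  rw [(Cn.fsup hz).cm, (Cn.fsup hz).cm]
  exact fsup_eq (fun i => by rw [← (hz i).cm, ← (hz i).cm, h])
theorem Cn.sq {z v w : R} (hz : Cn z) : z * (v * w) = (z * v) * (z * w) := by
  rw [hz.cm v, ma v z, ← ma z z, hz.pj.2, ← ma v, ← hz.cm, ma]
theorem glueEv {ι : Type*} {z : ι → R} (hz : ∀ i, Cn (z i)) (ho : ∀ i j, i ≠ j → z i * z j = 0)
    {e f : R} (he : Pj e) (h : ∀ i, Ev (z i * e) (z i * f)) : Ev (fsup z * e) (fsup z * f) := by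
  choose v h1 h2 using h
  have hp : ∀ i, Pj (z i * e) := fun i => (hz i).pmul he
  have zv : ∀ i, z i * v i = v i := fun i => by
    have := pi_mul (hp i) (h1 i)
    rw [(hz i).cm]
    conv_lhs => rw [← this]
    rw [ma, ← (hz i).cm, ← ma, ← ma, ma (v i), (hz i).pj.2, ma, this]
  obtain ⟨y, y1, y2⟩ := CG hz ho zv (fun i => pi_norm (h1 i ▸ hp i))
  have zs : ∀ i, z i * star y = star (v i) := fun i => by
    rw [(hz i).cm, ← (hz i).pj.1, ← star_mul, y1]
  have hZ := Cn.fsup hz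
  have zs2 : fsup z * star y = star y := by
    rw [hZ.cm, ← hZ.pj.1, ← star_mul, y2]
  refine ⟨y, ?_, ?_⟩
  · have : fsup z * (star y * y) = fsup z * e := fsup_eqz hz (fun i => by
      rw [(hz i).sq, zs, y1, h1])
    rwa [← ma, zs2] at this
  · have : fsup z * (y * star y) = fsup z * f := fsup_eqz hz (fun i => by
      rw [(hz i).sq, zs, y1, h2])
    rwa [← ma, y2] at this
theorem exh (P : R → Prop) {z0 : R} (hz0 : Cn z0)
    (H : ∀ y, Cn y → z0 * y = y → y ≠ 0 → ∃ y', Cn y' ∧ y * y' = y' ∧ y' ≠ 0 ∧ P y') :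
    ∃ S : Set R, (∀ s ∈ S, Cn s ∧ z0 * s = s ∧ s ≠ 0 ∧ P s) ∧ (∀ s t : S, s ≠ t → s.1 * t.1 = 0) ∧
      fsup (fun s : S => s.1) = z0 := by
  obtain ⟨S, h1, h2, h3⟩ := zorn_pw (fun s : R => Cn s ∧ z0 * s = s ∧ s ≠ 0 ∧ P s) (fun s t => s * t = 0 ∧ t * s = 0)
    (fun s t h => h.symm)
  refine ⟨S, h1, fun s t h => (h2 s.2 t.2 (fun h' => h (Subtype.ext h'))).1, ?_⟩
  set Z := fsup (fun s : S => s.1)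
  have hZ : Cn Z := Cn.fsup (fun s : S => (h1 s s.2).1)
  have le : z0 * Z = Z := fsup_le (fun s : S => (h1 s s.2).2.1)
  by_contra hne
  have hy := hZ.sub hz0 le
  obtain ⟨y', c1, c2, c3, c4⟩ := H (z0 - Z) hy (by rw [mul_sub, hz0.pj.2, le]) (fun h => hne (sub_eq_zero.1 h).symm)
  have Zy : Z * y' = 0 := by
    rw [← c2, ← ma, mul_sub, hZ.cm z0, le, hZ.pj.2]; simp
  have : y' ∈ S := h3 y' ⟨c1, by rw [← c2, ← ma, mul_sub, hz0.pj.2, le], c3, c4⟩ (fun s hs => by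
    have : s * y' = 0 := by
      have h5 := mul_fsup (e := fun s : S => s.1) (fun s => (h1 s s.2).1.pj) ⟨s, hs⟩
      change s * Z = s at h5
      rw [← h5, ma, Zy, mul_zero]
    exact ⟨by rw [c1.cm, this], this⟩)
  apply c3
  have h5 := fsup_mul (fun s : S => s.1) ⟨y', this⟩
  change Z * y' = y' at h5
  rw [← h5, Zy]
end AW
namespace AW
variable {R : Type u} [CStarAlgebra R] [AWStar R]
theorem Pj.d0 {e f : R} (he : Pj e) (hf : Pj f) (h : f * e = e) : e * (f - e) = 0 := by
  rw [mul_sub, he.fl hf h, he.2, sub_self]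
theorem Pj.d0' {e f : R} (he : Pj e) (h : f * e = e) : (f - e) * e = 0 := by
  rw [sub_mul, h, he.2, sub_self]
theorem Pj.dl {e f : R} (hf : Pj f) (h : f * e = e) : f * (f - e) = f - e := by
  rw [mul_sub, h, hf.2]
theorem lt {a b c : R} (h : a * b = b) (h' : b * c = c) : a * c = c := by rw [← h', ← ma, h]
theorem ol {e f e' f' : R} (he : Pj e) (he' : Pj e') (ho : e * f = 0) (h1 : e * e' = e') (h2 : f * f' = f') : e' * f' = 0 := by
  rw [← he'.fl he h1, ← h2, ma, ← ma e, ho]; simp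
theorem LP_pj (x : R) : Pj (LP x) := pj_psup _
theorem fsup_pj {ι : Type*} (e : ι → R) : Pj (fsup e) := pj_psup _
def Fn (t : R) : Prop := ∀ v : R, star v * v = t → t * v = v → v * star v = t
theorem Fn.eq {t s : R} (h : Fn t) (ht : Pj t) (hs : t * s = s) (hs' : Pj s) (hv : Sb t s) : s = t := by
  obtain ⟨v, h1, h2⟩ := hv
  have := h v h1 (lt hs h2)
  have h3 : s * t = t := by rw [← this, ← ma, h2]
  rw [← hs'.fl ht hs, h3]
theorem Fn.le {t g : R} (h : Fn t) (ht : Pj t) (hg : Pj g) (hl : t * g = g) : Fn g := by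
  intro v h1 h2
  have hk : Pj (v * star v) := pj_final (h1 ▸ hg)
  have gk : g * (v * star v) = v * star v := by rw [← ma, h2]
  have e1 : Ev g (v * star v) := ⟨v, h1, rfl⟩
  have e2 := e1.add hg (hg.sub ht hl) (Ev.refl (hg.sub ht hl)) (hg.d0 ht hl)
    (ol hg hk (hg.d0 ht hl) gk (hg.sub ht hl).2)
  rw [add_sub_cancel] at e2
  have hp := e2.pj ht
  have := h.eq ht (by rw [mul_add, lt hl gk, ht.dl hl]) hp (e2.sb ht |> fun h => h)
  have h3 : v * star v = t - (t - g) := by rw [eq_sub_iff_add_eq]; exact this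
  rw [h3]; abel
theorem Fn.ev {t s : R} (h : Fn t) (ht : Pj t) (hv : Ev t s) : Fn s := by
  intro w h1 h2
  have hs := hv.pj ht
  have e1 : Ev s (w * star w) := ⟨w, h1, rfl⟩
  have hw := e1.pj hs
  obtain ⟨k, k1, k2, k3, k4⟩ := hv.symm.cut hs hw (by rw [← ma, h2])
  have : k = t := h.eq ht k2 k1 (((hv.trans ht e1).trans ht k3).sb ht)
  rw [this, sub_self] at k4
  have := k4.zero
  exact (sub_eq_zero.1 this).symm
theorem Fn.sb {t s : R} (h : Fn t) (ht : Pj t) (hs : Pj s) (hv : Sb s t) : Fn s := by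
  obtain ⟨g, g1, g2, g3⟩ := hv.ex hs
  exact (h.le ht g1 g2).ev g1 g3.symm
theorem Fn.zmul {t z : R} (h : Fn t) (ht : Pj t) (hz : Cn z) : Fn (z * t) :=
  h.le ht (hz.pmul ht) (hz.le_mul ht)
theorem fn_zero : Fn (0 : R) := fun v h1 h2 => by rw [← h2]; simp
theorem FC0 {t x y : R} (h : Fn t) (ht : Pj t) (hx : Pj x) (hy : Pj y) (tx : t * x = x) (ty : t * y = y)
    (hv : Ev x y) (hs : Sb (t - x) (t - y)) : Ev (t - x) (t - y) := by
  obtain ⟨k, k1, k2, k3⟩ := hs.ex (hx.sub ht tx)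
  have yk : y * k = 0 := ol hy hy (hy.d0 ht ty) hy.2 k2
  have e := hv.add hx (hx.sub ht tx) k3 (hx.d0 ht tx) yk
  rw [add_sub_cancel] at e
  have := h.eq ht (by rw [mul_add, ty, lt (ht.dl ty) k2]) (hy.add k1 yk) (e.sb ht)
  rw [← eq_sub_iff_add_eq'] at this
  rwa [← this]
theorem FC {t x y : R} (h : Fn t) (ht : Pj t) (hx : Pj x) (hy : Pj y) (tx : t * x = x) (ty : t * y = y)
    (hv : Ev x y) : Ev (t - x) (t - y) := by
  obtain ⟨z, hz, h1, h2⟩ := GC (hx.sub ht tx) (hy.sub ht ty)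
  refine Ev.join hz (hx.sub ht tx) ?_ ?_
  · rw [mul_sub, mul_sub] at h1 ⊢
    exact FC0 (h.zmul ht hz) (hz.pmul ht) (hz.pmul hx) (hz.pmul hy) (hz.mono tx) (hz.mono ty) (hv.zmul hz) h1
  · have hz := hz.compl
    rw [mul_sub _ t, mul_sub _ t] at h2 ⊢
    exact (FC0 (h.zmul ht hz) (hz.pmul ht) (hz.pmul hy) (hz.pmul hx) (hz.mono ty) (hz.mono tx) (hv.symm.zmul hz) h2).symm
theorem FC2 {a b p q : R} (h : Fn (a + b)) (ha : Pj a) (hb : Pj b) (hp : Pj p) (hq : Pj q) (hab : a * b = 0)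
    (hpq : p * q = 0) (hv : Ev p a) (hs : Sb (p + q) (a + b)) : Sb q b := by
  obtain ⟨k, k1, k2, k3⟩ := hs.ex (hp.add hq hpq)
  have ht := ha.add hb hab
  obtain ⟨p', p1, p2, p3, p4⟩ := k3.cut (hp.add hq hpq) hp (by rw [add_mul, hp.2, hp.fl0 hq hpq, add_zero])
  have tp := lt k2 p2
  have e := FC h ht p1 ha tp (by rw [add_mul, ha.2, ha.fl0 hb hab, add_zero]) (p3.symm.trans p1 hv)
  rw [add_sub_cancel_left] at e p4
  refine ((p4.sb hq).le (g := a + b - p') ?_).trans (p1.sub ht tp) (e.sb (p1.sub ht tp))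
  rw [sub_mul, mul_sub, k2, tp, p1.d0 k1 p2, sub_zero]
theorem Orth.inj {ι κ : Type*} {e : ι → R} (h : Orth e) {φ : κ → ι} (hφ : Function.Injective φ) : Orth (e ∘ φ) :=
  ⟨fun i => h.pj _, fun i j hij => h.or _ _ (fun h' => hij (hφ h'))⟩
theorem Orth.sumr {ι : Type*} {e : ι → R} (h : Orth e) (I : Finset ι) (x : R) (hx : ∀ i ∈ I, e i * x = 0) :
    (∑ i ∈ I, e i) * x = 0 := by
  rw [Finset.sum_mul]; exact Finset.sum_eq_zero hx
theorem Orth.sum {ι : Type*} {e : ι → R} (h : Orth e) (I : Finset ι) : Pj (∑ i ∈ I, e i) := by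
  classical
  induction I using Finset.induction_on with
  | empty => simpa using pj_zero
  | insert a s ha ih =>
    rw [Finset.sum_insert ha]
    refine (h.pj a).add ih ?_
    rw [Finset.mul_sum]
    exact Finset.sum_eq_zero fun i hi => h.or _ _ (fun h' => ha (h' ▸ hi))
theorem EvSum {ι : Type*} {e f : ι → R} (he : Orth e) (hf : Orth f) (h : ∀ i, Ev (e i) (f i)) (I : Finset ι) :
    Ev (∑ i ∈ I, e i) (∑ i ∈ I, f i) := by
  classical
  induction I using Finset.induction_on with
  | empty => simpa using Ev.refl pj_zero
  | insert a s ha ih =>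
    rw [Finset.sum_insert ha, Finset.sum_insert ha]
    refine (h a).add (he.pj a) (he.sum s) ih ?_ ?_
    · rw [Finset.mul_sum]
      exact Finset.sum_eq_zero fun i hi => he.or _ _ (fun h' => ha (h' ▸ hi))
    · rw [Finset.mul_sum]
      exact Finset.sum_eq_zero fun i hi => hf.or _ _ (fun h' => ha (h' ▸ hi))
theorem Orth.sum_mul {ι : Type*} {e : ι → R} (h : Orth e) (I : Finset ι) (i : ι) (hi : i ∈ I) : (∑ i ∈ I, e i) * e i = e i := by
  classical
  rw [Finset.sum_mul, Finset.sum_eq_single i]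
  · exact (h.pj i).2
  · intro j _ hj; exact h.or _ _ hj
  · intro h; exact absurd hi h
theorem Orth.fsum {ι : Type*} {e : ι → R} (h : Orth e) (I : Finset ι) (h0 : ∀ i, i ∉ I → e i = 0) :
    fsup e = ∑ i ∈ I, e i := by
  have h1 : (∑ i ∈ I, e i) * fsup e = fsup e := fsup_le fun i => by
    by_cases hi : i ∈ I
    · exact h.sum_mul I i hi
    · rw [h0 i hi, mul_zero]
  have h2 : fsup e * (∑ i ∈ I, e i) = ∑ i ∈ I, e i := by
    rw [Finset.mul_sum]; exact Finset.sum_congr rfl fun i _ => fsup_mul e i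
  rw [← h2, (fsup_pj e).fl (h.sum I) h1]
theorem OEv {ι : Type*} {e f : ι → R} (he : Orth e) (hf : Orth f) (hef : ∀ i j, e i * f j = 0)
    (h : ∀ i, Ev (e i) (f i)) : Ev (fsup e) (fsup f) := by
  choose w h1 h2 using h
  obtain ⟨v, v1, v2, -⟩ := OA he hf hef h1 h2
  exact ⟨v, v1, v2⟩
theorem IC {t g : R} {e : ℕ → R} (h : Fn t) (ht : Pj t) (hg : Pj g) (he : Orth e) (hl : ∀ n, t * e n = e n)
    (hv : ∀ n, Ev (e n) g) : g = 0 := by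
  have a0 : Function.Injective (fun n : ℕ => 2 * n) := fun a b h => by simpa using h
  have a1 : Function.Injective (fun n : ℕ => 2 * n + 1) := fun a b h => by simpa using h
  have a3 : Function.Injective (fun n : ℕ => 2 * n + 3) := fun a b h => by simpa using h
  have e1 : Ev (fsup (e ∘ fun n : ℕ => 2 * n)) (fsup (e ∘ fun n : ℕ => 2 * n + 1)) :=
    OEv (he.inj a0) (he.inj a1) (fun i j => he.or (2*i) (2*j+1) (by omega)) (fun i => (hv _).trans (he.pj _) (hv _).symm)
  have e3 : Ev (fsup (e ∘ fun n : ℕ => 2 * n)) (fsup (e ∘ fun n : ℕ => 2 * n + 3)) :=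
    OEv (he.inj a0) (he.inj a3) (fun i j => he.or (2*i) (2*j+3) (by omega)) (fun i => (hv _).trans (he.pj _) (hv _).symm)
  have le : fsup (e ∘ fun n : ℕ => 2 * n + 1) * fsup (e ∘ fun n : ℕ => 2 * n + 3) = fsup (e ∘ fun n : ℕ => 2 * n + 3) :=
    fsup_le (fun i => by
      have := fsup_mul (e ∘ fun n : ℕ => 2 * n + 1) (i + 1)
      simpa [mul_add] using this)
  have := (h.le ht (fsup_pj (e ∘ fun n : ℕ => 2 * n + 1)) (fsup_le fun i => hl _)).eq (fsup_pj _) le (fsup_pj _)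
    ((e1.symm.trans (fsup_pj _) e3).sb (fsup_pj _))
  have h1 := fsup_mul (e ∘ fun n : ℕ => 2 * n + 1) 0
  rw [← this] at h1
  have h2 : fsup (e ∘ fun n : ℕ => 2 * n + 3) * e 1 = 0 := by
    refine (he.pj 1).fl0 (fsup_pj _) (fsup_ann fun i => he.or 1 (2*i+3) (by omega))
  have h3 : e 1 = 0 := by rw [← h2]; exact h1.symm
  have := hv 1
  rw [h3] at this
  exact this.symm.zero
theorem Bound {t s : R} (h : Fn t) (ht : Pj t) (hs : Pj s) (s0 : s ≠ 0) :
    ∃ (y : R) (N : ℕ), Cn y ∧ y * s ≠ 0 ∧ ∀ (z : R) (d : Fin N → R), Cn z → y * z = z → Orth d → (∀ i, t * d i = d i) →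
      (∀ i, Sb (z * s) (d i)) → z * s = 0 := by
  obtain ⟨S, S1, S2, S3⟩ := zorn_pw (fun p : R => Pj p ∧ t * p = p ∧ Ev s p) (fun p q => p * q = 0 ∧ q * p = 0) (fun _ _ h => h.symm)
  have oS : Orth (fun p : S => p.1) := ⟨fun p => (S1 p p.2).1, fun p q h => (S2 p.2 q.2 (fun h' => h (Subtype.ext h'))).1⟩
  have fS : S.Finite := by
    by_contra hi
    have hi : S.Infinite := hi
    have := hi.to_subtype
    let φ := Infinite.natEmbedding S
    exact s0 (IC h ht hs (oS.inj φ.injective) (fun n => (S1 _ (φ n).2).2.1) (fun n => (S1 _ (φ n).2).2.2.symm))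
  have := fS.fintype
  let k := Fintype.card S
  let ψ : Fin k ≃ S := (Fintype.equivFin S).symm
  let a : Fin k → R := fun i => (ψ i).1
  have oa : Orth a := oS.inj ψ.injective
  let A := ∑ i, a i
  have pA : Pj A := oa.sum _
  have tA : t * A = A := by
    rw [Finset.mul_sum]; exact Finset.sum_congr rfl fun i _ => (S1 _ (ψ i).2).2.1
  have pr := pA.sub ht tA
  obtain ⟨w, hw, w1, w2⟩ := GC hs pr
  refine ⟨1 - w, k + 2, hw.compl, ?_, ?_⟩
  · intro h0
    have : w * s = s := by rw [sub_mul, one_mul, sub_eq_zero] at h0; exact h0.symm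
    rw [this] at w1
    have w1 := w1.le (hw.le_mul pr)
    obtain ⟨g, g1, g2, g3⟩ := w1.ex hs
    have Ag : ∀ i, a i * g = 0 := fun i => by
      have : A * g = 0 := ol pA pA (pA.d0 ht tA) pA.2 g2
      have h1 : a i * A = a i := (oa.pj i).fl pA (oa.sum_mul _ i (Finset.mem_univ _))
      rw [← h1, ma, this, mul_zero]
    have gS : g ∈ S := S3 g ⟨g1, lt (ht.dl tA) g2, g3⟩ (fun p hp => by
      have := Ag (ψ.symm ⟨p, hp⟩)
      simp only [a, Equiv.apply_symm_apply] at this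
      exact ⟨(S1 p hp).1.fl0 g1 this, this⟩)
    have := Ag (ψ.symm ⟨g, gS⟩)
    simp only [a, Equiv.apply_symm_apply] at this
    rw [g1.2] at this
    rw [this] at g3
    exact s0 g3.zero
  · intro z d hz yz od td hd
    have hd' : ∀ i, ∃ v, star v * v = z * s ∧ d i * v = v := hd
    choose x x1 x2 x3 using fun i => (hd i).ex (hz.pmul hs)
    have ox : Orth x := ⟨x1, fun i j h => ol (od.pj i) (x1 i) (od.or i j h) (x2 i) (x2 j)⟩
    have ozx : ∀ i, Ev (z * s) (x i) := x3
    have zt : Pj (z * t) := hz.pmul ht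
    have oza : Orth (fun i => z * a i) := ⟨fun i => hz.pmul (oa.pj i), fun i j h => hz.ort (oa.or i j h)⟩
    let p := ∑ i : Fin k, x (Fin.castAdd 2 i)
    let q := x (Fin.natAdd k 0) + x (Fin.natAdd k 1)
    have q01 : x (Fin.natAdd k 0) * x (Fin.natAdd k 1) = 0 := ox.or _ _ (by simp [Fin.ext_iff])
    have ocx : Orth (fun i : Fin k => x (Fin.castAdd 2 i)) := ox.inj (Fin.castAdd_injective k 2)
    have e1 : Ev p (∑ i, z * a i) := EvSum ocx oza (fun i => ((x3 _).symm.trans (x1 _) ((S1 _ (ψ i).2).2.2.zmul hz))) _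
    have pq : p * q = 0 := ocx.sumr _ _ (fun i _ => by
      rw [mul_add, ox.or _ _ (by simp [Fin.ext_iff]; omega), ox.or _ _ (by simp [Fin.ext_iff]; omega), add_zero])
    have hp : Pj p := ocx.sum _
    have hq : Pj q := (x1 _).add (x1 _) q01
    have zx : ∀ i, z * x i = x i := fun i => (x3 i).symm.cn hz (x1 i) hz.le_mul2
    have ztx : ∀ i, z * t * x i = x i := fun i => by rw [ma, lt (td i) (x2 i), zx]
    have sm : ∑ i, z * a i = z * A := by rw [Finset.mul_sum]
    rw [sm] at e1
    have sz : z * A + z * (t - A) = z * t := by rw [← mul_add]; congr 1; abel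
    have := FC2 (a := z * A) (b := z * (t - A)) (p := p) (q := q) (by rw [sz]; exact h.zmul ht hz) (hz.pmul pA) (hz.pmul pr)
      hp hq (hz.ort (pA.d0 ht tA)) pq e1 (by
        rw [sz]
        refine Sb.of_le (hp.add hq pq) ?_
        rw [mul_add, Finset.mul_sum, mul_add, ztx, ztx]
        congr 1
        exact Finset.sum_congr rfl fun i _ => ztx _)
    have w3 := w2.zmul hz (hw.compl.pmul pr)
    rw [← ma, ← ma, hz.cm, yz] at w3
    have h5 : Sb q (x (Fin.natAdd k 1)) := (this.trans (hz.pmul pr) w3).trans (hz.pmul hs) ((x3 _).sb (hz.pmul hs))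
    have fq : Fn q := (h.le ht hq (by rw [mul_add, lt (td _) (x2 _), lt (td _) (x2 _)]))
    have h6 := fq.eq hq (by rw [add_mul, (x1 _).2, q01, zero_add]) (x1 _) h5
    have h7 : x (Fin.natAdd k 0) = 0 := by
      have : x (Fin.natAdd k 0) + x (Fin.natAdd k 1) = x (Fin.natAdd k 1) := h6.symm
      simpa using this
    have := x3 (Fin.natAdd k 0)
    rw [h7] at this
    exact this.zero
end AW
namespace AW
variable {R : Type u} [CStarAlgebra R] [AWStar R]
def PAb (a : R) : Prop := ∀ p, Pj p → a * p = p → ∀ x, (a - p) * x * p = 0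
theorem PAb.eq {a p : R} (h : PAb a) (hp : Pj p) (hl : a * p = p) : cc p * a = p := by
  have := cc_ann (h p hp hl)
  rw [sub_mul, sub_eq_zero, ← (cn_cc p).cm, ← (cn_cc p).cm, cc_mul] at this
  exact this
theorem PAb.le {a q : R} (h : PAb a) (ha : Pj a) (hq : Pj q) (hl : a * q = q) : PAb q := fun p hp hqp x => by
  have : q - p = q * (a - p) := by rw [mul_sub, hq.fl ha hl, hqp]
  rw [this, ma, ma, ← ma (a - p), h p hp (lt hl hqp), mul_zero]
theorem PAb.fn {a : R} (h : PAb a) (ha : Pj a) : Fn a := fun v h1 h2 => by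
  have hf : Pj (v * star v) := pj_final (h1 ▸ ha)
  rw [← h.eq hf (by rw [← ma, h2])]
  have hc := cn_cc (v * star v)
  have : cc (v * star v) * v = v := by
    conv_rhs => rw [← pi_mul' hf rfl, ← cc_mul (v * star v), ma, pi_mul' hf rfl]
  conv_lhs => rw [← h1, ← ma, hc.cm, ma, this, h1]
theorem PAb.evcc {a b : R} (h : PAb a) (ha : Pj a) (h' : PAb b) (hb : Pj b) (hc : cc a = cc b) : Ev a b := by
  have key : ∀ {a b z : R}, PAb b → Pj a → Pj b → cc a = cc b → Cn z → Sb (z * a) (z * b) → Ev (z * a) (z * b) := by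
    intro a b z h' ha hb hc hz hs
    obtain ⟨g, g1, g2, g3⟩ := hs.ex (hz.pmul ha)
    have e1 := h'.eq g1 (lt (hz.le_mul hb) g2)
    have e2 : cc g = cc (z * a) := by
      have l1 := (g3.sb (hz.pmul ha)).cc_le
      have l2 := (g3.symm.sb g1).cc_le
      rw [← l2, (cn_cc (z * a)).cm, l1]
    rw [e2, cc_zmul hz ha, hc, ma, cc_mul] at e1
    rwa [e1]
  obtain ⟨z, hz, h1, h2⟩ := GC ha hb
  exact Ev.join hz ha (key h' ha hb hc hz h1) (key h hb ha hc.symm hz.compl h2).symm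
theorem fsup_orth {ι κ : Type*} {e : ι → R} {f : κ → R} (he : ∀ i, Pj (e i)) (hf : ∀ i, Pj (f i)) (h : ∀ i j, e i * f j = 0) :
    fsup e * fsup f = 0 :=
  fsup_ann fun j => (hf j).fl0 (fsup_pj e) (fsup_ann fun i => (he i).fl0 (hf j) (h i j))
theorem halv {e : R} (he : Pj e) : ∃ b b' a : R, Pj b ∧ Pj b' ∧ Pj a ∧ b * b' = 0 ∧ b * a = 0 ∧ b' * a = 0 ∧ e = b + b' + a ∧
    Ev b b' ∧ PAb a := by
  obtain ⟨S, S1, S2, S3⟩ := zorn_pw (fun v : R => star v * v ≠ 0 ∧ Pj (star v * v) ∧ e * (star v * v) = star v * v ∧ e * v = v ∧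
      v * v = 0)
    (fun v w => star v * w = 0 ∧ v * star w = 0 ∧ v * w = 0 ∧ w * v = 0) (fun v w h => ⟨by
      have := congrArg star h.1; simpa using this, by have := congrArg star h.2.1; simpa using this, h.2.2.2, h.2.2.1⟩)
  let E : S → R := fun s => star s.1 * s.1
  let F : S → R := fun s => s.1 * star s.1
  have oE : Orth E := ⟨fun s => (S1 s s.2).2.1, fun s t h => by
    have := (S2 s.2 t.2 (fun h' => h (Subtype.ext h'))).2.1
    show star s.1 * s.1 * (star t.1 * t.1) = 0
    rw [ma, ← ma s.1, this]; simp⟩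
  have oF : Orth F := ⟨fun s => pj_final (S1 s s.2).2.1, fun s t h => by
    have := (S2 s.2 t.2 (fun h' => h (Subtype.ext h'))).1
    show s.1 * star s.1 * (t.1 * star t.1) = 0
    rw [ma, ← ma (star s.1), this]; simp⟩
  have eE : ∀ s, e * E s = E s := fun s => (S1 s s.2).2.2.1
  have eF : ∀ s, e * F s = F s := fun s => by
    show e * (s.1 * star s.1) = _; rw [← ma, (S1 s s.2).2.2.2.1]
  have oEF : ∀ s t, E s * F t = 0 := fun s t => by
    have : s.1 * t.1 = 0 := by
      by_cases h : s = t
      · rw [h]; exact (S1 t t.2).2.2.2.2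
      · exact (S2 s.2 t.2 (fun h' => h (Subtype.ext h'))).2.2.1
    show star s.1 * s.1 * (t.1 * star t.1) = 0
    rw [ma, ← ma s.1, this]; simp
  have ev := OEv oE oF oEF (fun s => ⟨s.1, rfl, rfl⟩)
  have pE := fsup_pj E
  have pF := fsup_pj F
  have EF : fsup E * fsup F = 0 := fsup_orth oE.pj oF.pj oEF
  have pB := pE.add pF EF
  have eB : e * (fsup E + fsup F) = fsup E + fsup F := by rw [mul_add, fsup_le eE, fsup_le eF]
  set a := e - (fsup E + fsup F) with ha
  have pa : Pj a := pB.sub he eB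
  have ea : e * a = a := he.dl eB
  have Ba : (fsup E + fsup F) * a = 0 := pB.d0 he eB
  have Ea : fsup E * a = 0 := ol pB pE Ba (by rw [add_mul, pE.2, pE.fl0 pF EF, add_zero]) pa.2
  have Fa : fsup F * a = 0 := ol pB pF Ba (by rw [add_mul, pF.2, EF, zero_add]) pa.2
  refine ⟨fsup E, fsup F, a, pE, pF, pa, EF, Ea, Fa, by rw [ha]; abel, ev, ?_⟩
  intro p hp hl x
  by_contra h0
  have pap := hp.sub pa hl
  obtain ⟨v, v0, v1, v2, v3⟩ := corner hp pap h0
  have av : a * v = v := lt (pa.dl hl) v3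
  have vp : v * p = v := by
    have h1 := pi_mul v1 rfl
    rw [← h1, ma, v1.fl hp v2]
  have va : v * a = v := by rw [← vp, ma, hp.fl pa hl]
  have asv : a * star v = star v := by have := congrArg star va; simpa [pa.1] using this
  have sva : star v * a = star v := by have := congrArg star av; simpa [pa.1] using this
  have key : v ∈ S := S3 v ⟨v0, v1, by rw [← ma, ← asv, ← ma, ea], lt ea av, by
      calc v * v = (v * p) * ((a - p) * v) := by rw [vp, v3]
        _ = v * (p * (a - p)) * v := by simp only [ma]
        _ = 0 := by rw [hp.d0 pa hl]; simp⟩ (fun s hs => by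
    have as : a * s = 0 := by
      have h1 : s * star s * s = s := by rw [ma]; exact pi_mul (S1 s hs).2.1 rfl
      have h2 : fsup F * (s * star s) = s * star s := fsup_mul F ⟨s, hs⟩
      rw [← h1, ← h2, ma, ← ma, pF.fl0 pa Fa]; simp
    have sa : s * a = 0 := by
      have h1 : s * (star s * s) = s := pi_mul (S1 s hs).2.1 rfl
      have h2 : star s * s * fsup E = star s * s := mul_fsup oE.pj ⟨s, hs⟩
      rw [← h1, ← h2, ma, ma, Ea]; simp
    have ass : a * star s = 0 := by have := congrArg star sa; simpa [pa.1] using this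
    refine ⟨?_, ?_, ?_, ?_⟩
    · rw [← sva, ma, as, mul_zero]
    · rw [← va, ma, ass, mul_zero]
    · rw [← va, ma, as, mul_zero]
    · rw [← av, ← ma, sa, zero_mul])
  apply v0
  have h1 : fsup E * (star v * v) = star v * v := fsup_mul E ⟨v, key⟩
  rw [← h1, ← asv, ← ma, ← ma, Ea]; simp
theorem fsup_zmul {ι : Type*} {e : ι → R} {z : R} (hz : Cn z) (he : ∀ i, Pj (e i)) : fsup (fun i => z * e i) = z * fsup e := by
  have h1 : (z * fsup e) * fsup (fun i => z * e i) = fsup (fun i => z * e i) := fsup_le fun i => hz.mono (fsup_mul e i)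
  have h2 : fsup (fun i => z * e i) * (z * fsup e) = z * fsup e := by
    rw [← ma]
    refine fsup_eq fun i => ?_
    rw [ma]; exact fsup_mul (fun i => z * e i) i
  rw [← h2, (fsup_pj _).fl (hz.pmul (fsup_pj _)) h1]
theorem fsup_add {ι : Type*} {e x y : ι → R} (he : ∀ i, e i = x i + y i) (hx : Orth x) (hy : Orth y) (hxy : ∀ i j, x i * y j = 0) :
    fsup e = fsup x + fsup y ∧ fsup x * fsup y = 0 := by
  have o := fsup_orth hx.pj hy.pj hxy
  refine ⟨?_, o⟩
  have hyx : ∀ i j, y i * x j = 0 := fun i j => (hx.pj j).fl0 (hy.pj i) (hxy j i)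
  have p := (fsup_pj x).add (fsup_pj y) o
  have h1 : (fsup x + fsup y) * fsup e = fsup e := fsup_le fun i => by
    have a1 : fsup x * y i = 0 := by
      rw [← fsup_mul y i, ← ma, o, zero_mul]
    have a2 : fsup y * x i = 0 := by
      rw [← fsup_mul x i, ← ma, (fsup_pj x).fl0 (fsup_pj y) o, zero_mul]
    rw [he, mul_add, add_mul, add_mul, a1, a2, fsup_mul, fsup_mul]; simp
  have h2 : fsup e * (fsup x + fsup y) = fsup x + fsup y := by
    rw [mul_add]
    congr 1
    · refine fsup_le fun i => ?_
      have : x i = e i * x i := by rw [he, add_mul, (hx.pj i).2, hyx, add_zero]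
      rw [this, ← ma, fsup_mul]
    · refine fsup_le fun i => ?_
      have : y i = e i * y i := by rw [he, add_mul, (hy.pj i).2, hxy, zero_add]
      rw [this, ← ma, fsup_mul]
  rw [← h2, (fsup_pj _).fl p h1]
theorem conj_fsup {ι : Type*} {e : ι → R} {v : R} (he : ∀ i, Pj (e i)) (hv : star v * v = fsup e) :
    fsup (fun i => v * e i * star v) = v * star v := by
  have hp : Pj (v * star v) := pj_final (hv ▸ fsup_pj e)
  have vv := pi_mul (fsup_pj e) hv
  have a1 := pi_mul' hp rfl
  have h1 : (v * star v) * fsup (fun i => v * e i * star v) = fsup (fun i => v * e i * star v) := fsup_le fun i => by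
    rw [← ma, ← ma, a1]
  have h2 : fsup (fun i => v * e i * star v) * (v * star v) = v * star v := by
    suffices h4 : fsup (fun i => v * e i * star v) * v * fsup e = v * fsup e by
      rw [ma, vv] at h4
      rw [← ma, h4]
    refine fsup_eq fun i => ?_
    have h3 : v * e i = (v * e i * star v) * v := by rw [ma, hv, ma, mul_fsup he]
    rw [ma, h3, ← ma]
    conv_lhs => rw [fsup_mul (fun i => v * e i * star v) i]
  rw [← h2, (fsup_pj _).fl hp h1]
theorem AddO {ι : Type*} {e f : ι → R} {q : R} (he : Orth e) (hf : Orth f) (h : ∀ i, Ev (e i) (f i)) (hq : Pj q)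
    (hs : Sb (fsup e) q) (h0 : q * fsup f = 0) : Ev (fsup e) (fsup f) := by
  obtain ⟨v, h1, h2⟩ := hs
  have le : ∀ i, fsup e * e i = e i := fsup_mul e
  have oG : Orth (fun i => v * e i * star v) := ⟨fun i => conj_pj (he.pj i) h1 (le i), fun i j hij => by
    calc v * e i * star v * (v * e j * star v) = v * (e i * ((star v * v) * e j)) * star v := by simp only [ma]
      _ = 0 := by rw [h1, le, he.or i j hij]; simp⟩
  have e1 : Ev (fsup e) (fsup (fun i => v * e i * star v)) := by
    rw [conj_fsup he.pj h1]; exact ⟨v, h1, rfl⟩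
  refine e1.trans (fsup_pj _) (OEv oG hf (fun i j => ?_) (fun i => ?_))
  · exact ol hq (oG.pj i) h0 (by rw [← ma, ← ma, h2]) (fsup_mul f j)
  · exact (conj_ev (he.pj i) h1 (le i)).symm.trans (oG.pj i) (h i)
theorem AddH {ι : Type*} {e e' f f' : ι → R} (he : Orth e) (he' : Orth e') (hf : Orth f) (hf' : Orth f')
    (h : ∀ i, Ev (e i) (f i)) (h1 : Ev (fsup e) (fsup e')) (h2 : Ev (fsup f) (fsup f'))
    (o1 : fsup e' * fsup e = 0) (o2 : fsup f' * fsup f = 0) : Ev (fsup e) (fsup f) := by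
  obtain ⟨z, hz, z1, z2⟩ := GC (fsup_pj e) (fsup_pj f)
  have key : ∀ {e f f' : ι → R} {z : R}, Orth e → Orth f → (∀ i, Ev (e i) (f i)) → Ev (fsup f) (fsup f') →
      fsup f' * fsup f = 0 → Cn z → Sb (z * fsup e) (z * fsup f) → Ev (z * fsup e) (z * fsup f) := by
    intro e f f' z he hf h h2 o2 hz z1
    have oe : Orth (fun i => z * e i) := ⟨fun i => hz.pmul (he.pj i), fun i j hij => hz.ort (he.or i j hij)⟩
    have of : Orth (fun i => z * f i) := ⟨fun i => hz.pmul (hf.pj i), fun i j hij => hz.ort (hf.or i j hij)⟩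
    rw [← fsup_zmul hz he.pj, ← fsup_zmul hz hf.pj]
    refine AddO oe of (fun i => (h i).zmul hz) (hz.pmul (fsup_pj f')) ?_ ?_
    · rw [fsup_zmul hz he.pj]
      exact z1.trans (hz.pmul (fsup_pj f)) ((h2.zmul hz).sb (hz.pmul (fsup_pj f)))
    · rw [fsup_zmul hz hf.pj]; exact hz.ort o2
  exact Ev.join hz (fsup_pj e) (key he hf h h2 o2 hz z1) (key hf he (fun i => (h i).symm) h1 o1 hz.compl z2).symm
theorem AddP {ι : Type*} {a d : ι → R} (ha : Orth a) (hd : Orth d) (h : ∀ i, Ev (a i) (d i)) (hp : ∀ i, PAb (a i))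
    (hf : Fn (fsup a)) : Ev (fsup a) (fsup d) := by
  classical
  obtain ⟨S, S1, S2, S3⟩ := exh (fun y => Ev (y * fsup a) (y * fsup d)) cn_one (fun y hy _ y0 => by
    by_cases hz : ∀ i, y * a i = 0
    · have hz' : ∀ i, y * d i = 0 := fun i => (h i).symm.zz hy (hd.pj i) (hz i)
      refine ⟨y, hy, hy.pj.2, y0, ?_⟩
      rw [fsup_ann hz, fsup_ann hz']; exact Ev.refl pj_zero
    push Not at hz
    obtain ⟨i0, h0⟩ := hz
    obtain ⟨x, N, hx, x0, hB⟩ := Bound hf (fsup_pj a) (hy.pmul (ha.pj i0)) h0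
    let Q : ℕ → Prop := fun m => ∃ (I : Finset ι) (z : R), I.card = m ∧ Cn z ∧ z ≠ 0 ∧ x * z = z ∧ y * z = z ∧ cc (a i0) * z = z ∧
      ∀ i ∈ I, cc (a i) * z = z
    have Q0 : Q 0 := by
      refine ⟨∅, x * y * cc (a i0), rfl, (hx.mul hy).mul (cn_cc _), ?_, ?_, ?_, ?_, by simp⟩
      · intro h
        apply x0
        rw [← ma]
        conv_lhs => rw [← cc_mul (a i0), ← ma, h, zero_mul]
      · rw [ma, ← ma, hx.pj.2]
      · rw [hx.cm, ma, ← ma, hy.pj.2]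
      · rw [← (cn_cc (a i0)).cm, ← ma, (cn_cc (a i0)).pj.2]
    have QN : ¬ Q N := by
      rintro ⟨I, z, c, hz, z0, z1, z2, z3, z4⟩
      apply z0
      let ψ : Fin N ≃ I := (Finset.equivFinOfCardEq c).symm
      have zy : z * (y * a i0) = z * a i0 := by rw [← ma, ← hy.cm, z2]
      have ccz : ∀ i, cc (a i) * z = z → cc (z * a i) = z := fun i hi => by
        rw [cc_zmul hz (ha.pj i), hz.cm, hi]
      have := hB z (fun i => a (ψ i)) hz z1 (ha.inj (φ := fun i => (ψ i).1) (fun i j hij => ψ.injective (Subtype.ext hij)))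
        (fun i => fsup_mul a _) (fun i => by
          rw [zy]
          have e1 : Ev (z * a i0) (z * a (ψ i)) := PAb.evcc ((hp i0).le (ha.pj _) (hz.pmul (ha.pj _)) (hz.le_mul (ha.pj _))) (hz.pmul (ha.pj _))
            ((hp _).le (ha.pj _) (hz.pmul (ha.pj _)) (hz.le_mul (ha.pj _))) (hz.pmul (ha.pj _)) (by
              rw [ccz _ z3, ccz _ (z4 _ (ψ i).2)])
          exact (e1.sb (hz.pmul (ha.pj _))).le (hz.le_mul (ha.pj _)))
      rw [zy] at this
      rw [← ccz i0 z3, this]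
      have := cc_le (e := (0 : R)) cn_zero (by simp)
      simpa using this.symm
    have : ∃ m, Q m ∧ ¬ Q (m + 1) := by
      by_contra hc
      push Not at hc
      exact QN (Nat.rec Q0 hc N)
    obtain ⟨m, ⟨I, z, c, hz, z0, z1, z2, z3, z4⟩, hm⟩ := this
    have zj : ∀ j, j ∉ I → z * a j = 0 := fun j hj => by
      by_contra hne
      apply hm
      have hc := cn_cc (a j)
      refine ⟨insert j I, cc (a j) * z, by rw [Finset.card_insert_of_notMem hj, c], hc.mul hz, ?_, ?_, ?_, ?_, ?_⟩
      · intro h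
        apply hne
        rw [← cc_mul (a j), ← ma, ← hc.cm, h, zero_mul]
      · rw [← ma, hx.cm, ma, z1]
      · rw [← ma, hy.cm, ma, z2]
      · rw [← ma, (cn_cc (a i0)).cm, ma, z3]
      · intro i hi
        rw [Finset.mem_insert] at hi
        obtain rfl | hi := hi
        · rw [← ma, hc.pj.2]
        · rw [← ma, (cn_cc (a i)).cm, ma, z4 i hi]
    have zd : ∀ j, j ∉ I → z * d j = 0 := fun j hj => (h j).symm.zz hz (hd.pj j) (zj j hj)
    refine ⟨z, hz, z2, z0, ?_⟩
    have oa : Orth (fun i => z * a i) := ⟨fun i => hz.pmul (ha.pj i), fun i j hij => hz.ort (ha.or i j hij)⟩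
    have od : Orth (fun i => z * d i) := ⟨fun i => hz.pmul (hd.pj i), fun i j hij => hz.ort (hd.or i j hij)⟩
    rw [← fsup_zmul hz ha.pj, ← fsup_zmul hz hd.pj, oa.fsum I zj, od.fsum I zd]
    exact EvSum oa od (fun i => (h i).zmul hz) I)
  have := glueEv (fun s : S => (S1 s s.2).1) S2 (fsup_pj a) (fun s => (S1 s s.2).2.2.2)
  rw [S3] at this
  simpa using this
theorem Add {ι : Type*} {e f : ι → R} (he : Orth e) (hf : Orth f) (h : ∀ i, Ev (e i) (f i)) (hF : Fn (fsup e)) :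
    Ev (fsup e) (fsup f) := by
  choose b b' a hb hb' ha o1 o2 o3 hs hev hab using fun i => halv (he.pj i)
  choose v v1 v2 using h
  have eb : ∀ i, e i * b i = b i := fun i => by
    rw [hs, add_mul, add_mul, (hb i).2, (hb i).fl0 (hb' i) (o1 i), (hb i).fl0 (ha i) (o2 i)]; simp
  have eb' : ∀ i, e i * b' i = b' i := fun i => by
    rw [hs, add_mul, add_mul, (hb' i).2, (o1 i), (hb' i).fl0 (ha i) (o3 i)]; simp
  have ea : ∀ i, e i * a i = a i := fun i => by
    rw [hs, add_mul, add_mul, (ha i).2, (o2 i), o3]; simp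
  let C : (ι → R) → ι → R := fun x i => v i * x i * star (v i)
  have lC : ∀ x : ι → R, ∀ i, f i * C x i = C x i := fun x i => by
    show f i * (v i * x i * star (v i)) = _
    rw [← ma, ← ma, pi_mul' (hf.pj i) (v2 i)]
  have pC : ∀ x : ι → R, (∀ i, Pj (x i)) → (∀ i, e i * x i = x i) → ∀ i, Pj (C x i) := fun x hx hl i => conj_pj (hx i) (v1 i) (hl i)
  have oC : ∀ x : ι → R, (∀ i, Pj (x i)) → (∀ i, e i * x i = x i) → Orth (C x) := fun x hx hl =>
    ⟨pC x hx hl, fun i j hij => ol (hf.pj i) (pC x hx hl i) (hf.or i j hij) (lC x i) (lC x j)⟩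
  have oE : ∀ x : ι → R, (∀ i, Pj (x i)) → (∀ i, e i * x i = x i) → Orth x := fun x hx hl =>
    ⟨hx, fun i j hij => ol (he.pj i) (hx i) (he.or i j hij) (hl i) (hl j)⟩
  have eC : ∀ x : ι → R, (∀ i, Pj (x i)) → (∀ i, e i * x i = x i) → ∀ i, Ev (x i) (C x i) := fun x hx hl i => conj_ev (hx i) (v1 i) (hl i)
  have oo : ∀ x y : ι → R, (∀ i, Pj (x i)) → (∀ i, e i * x i = x i) → (∀ i, e i * y i = y i) → (∀ i, x i * y i = 0) →
      (∀ i j, x i * y j = 0) ∧ (∀ i j, C x i * C y j = 0) := fun x y hx hl hl' h0 => by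
    refine ⟨fun i j => ?_, fun i j => ?_⟩
    · by_cases hij : i = j
      · rw [hij, h0]
      · exact ol (he.pj i) (hx i) (he.or i j hij) (hl i) (hl' j)
    · by_cases hij : i = j
      · subst hij
        calc v i * x i * star (v i) * (v i * y i * star (v i)) = v i * (x i * ((star (v i) * v i) * y i)) * star (v i) := by simp only [ma]
          _ = 0 := by rw [v1, hl', h0]; simp
      · exact ol (hf.pj i) (pC x hx hl i) (hf.or i j hij) (lC x i) (lC y j)
  obtain ⟨q1, q2⟩ := oo b b' hb eb eb' o1
  have q1' : ∀ i j, b' i * b j = 0 := fun i j => (hb j).fl0 (hb' i) (q1 j i)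
  have q2' : ∀ i j, C b' i * C b j = 0 := fun i j => (pC b hb eb j).fl0 (pC b' hb' eb' i) (q2 j i)
  have Eb := oE b hb eb
  have Eb' := oE b' hb' eb'
  have Ea := oE a ha ea
  have Cb := oC b hb eb
  have Cb' := oC b' hb' eb'
  have Ca := oC a ha ea
  have r1 : Ev (fsup b) (fsup b') := OEv Eb Eb' q1 hev
  have r2 : Ev (fsup (C b)) (fsup (C b')) := OEv Cb Cb' q2 (fun i =>
    ((eC b hb eb i).symm.trans (Cb.pj i) (hev i)).trans (Cb.pj i) (eC b' hb' eb' i))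
  have n1 := fsup_orth Eb.pj Eb'.pj q1
  have n2 := fsup_orth Cb.pj Cb'.pj q2
  have n1' := fsup_orth Eb'.pj Eb.pj q1'
  have n2' := fsup_orth Cb'.pj Cb.pj q2'
  have s1 : Ev (fsup b) (fsup (C b)) := AddH Eb Eb' Cb Cb' (eC b hb eb) r1 r2 n1' n2'
  have s2 : Ev (fsup b') (fsup (C b')) := AddH Eb' Eb Cb' Cb (eC b' hb' eb') r1.symm r2.symm n1 n2
  have s3 : Ev (fsup a) (fsup (C a)) := AddP Ea Ca (eC a ha ea) hab (hF.le (fsup_pj e) (fsup_pj a) (fsup_le fun i => by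
    rw [← ea i, ← ma, fsup_mul]))
  have hbb : ∀ i, Pj (b i + b' i) := fun i => (hb i).add (hb' i) (o1 i)
  have ebb : ∀ i, e i * (b i + b' i) = b i + b' i := fun i => by rw [mul_add, eb, eb']
  have obb := oE (fun i => b i + b' i) hbb ebb
  have oCbb := oC (fun i => b i + b' i) hbb ebb
  obtain ⟨t1, t2⟩ := oo (fun i => b i + b' i) a hbb ebb ea (fun i => by rw [add_mul, o2, o3, add_zero])
  obtain ⟨u1, u2⟩ := fsup_add (e := fun i => b i + b' i) (fun i => rfl) Eb Eb' q1
  obtain ⟨u3, u4⟩ := fsup_add (e := C (fun i => b i + b' i)) (fun i => by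
    show v i * (b i + b' i) * star (v i) = C b i + C b' i
    rw [mul_add, add_mul]) Cb Cb' q2
  obtain ⟨u5, u6⟩ := fsup_add (e := e) hs obb Ea t1
  obtain ⟨u7, u8⟩ := fsup_add (e := f) (fun i => by
    show f i = v i * (b i + b' i) * star (v i) + v i * a i * star (v i)
    rw [← add_mul, ← mul_add, ← hs, pi_mul (he.pj i) (v1 i), v2]) oCbb Ca t2
  rw [u5, u7]
  refine Ev.add (fsup_pj _) (fsup_pj _) ?_ s3 u6 u8
  rw [u1, u3]
  exact s1.add (fsup_pj _) (fsup_pj _) s2 u2 u4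
end AW
namespace AW
variable {R : Type u} [CStarAlgebra R] [AWStar R]
theorem pj_antisymm {e f : R} (he : Pj e) (hf : Pj f) (h : e * f = f) (h' : f * e = e) : e = f := by
  rw [← hf.fl he h, h']
theorem SPe {h : R} (hs : star h = h) (hp : ∀ t ∈ spectrum ℝ h, 0 ≤ t) {ε : ℝ} (hε : 0 < ε) :
    ∃ b : R, star b = b ∧ b * h * b = LP (cfc (fun t : ℝ => max (t - ε) 0) h) ∧
     h * b * b = LP (cfc (fun t : ℝ => max (t - ε) 0) h) ∧
     (∀ a : R, a * h = h * a → a * LP (cfc (fun t : ℝ => max (t - ε) 0) h) = LP (cfc (fun t : ℝ => max (t - ε) 0) h) * a) ∧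
     (∀ a : R, a * h = h * a → a * b = b * a) ∧ ‖h - cfc (fun t : ℝ => max (t - ε) 0) h‖ ≤ ε ∧
     ∀ δ : ℝ, 0 < δ → δ < ε → LP (cfc (fun t : ℝ => max (t - δ) 0) h) * LP (cfc (fun t : ℝ => max (t - ε) 0) h) =
       LP (cfc (fun t : ℝ => max (t - ε) 0) h) := by
  have hsa : IsSelfAdjoint h := hs
  let g : ℝ → ℝ := fun t => max (t - ε) 0
  let c : ℝ → ℝ := fun t => (Real.sqrt (max t ε))⁻¹
  have hg : Continuous g := by fun_prop
  have hc : Continuous c := by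
    apply Continuous.inv₀ (by fun_prop)
    intro t; have : 0 < max t ε := lt_max_of_lt_right hε
    positivity
  change ∃ b : R, star b = b ∧ b * h * b = LP (cfc g h) ∧ h * b * b = LP (cfc g h) ∧
     (∀ a : R, a * h = h * a → a * LP (cfc g h) = LP (cfc g h) * a) ∧
     (∀ a : R, a * h = h * a → a * b = b * a) ∧ ‖h - cfc g h‖ ≤ ε ∧
     ∀ δ : ℝ, 0 < δ → δ < ε → LP (cfc (fun t : ℝ => max (t - δ) 0) h) * LP (cfc g h) = LP (cfc g h)
  have h3 : ‖h - cfc g h‖ ≤ ε := by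
    have : h = cfc (fun t => t) h := (cfc_id' ℝ h hsa).symm
    have h2 : cfc (fun t => t - g t) h = h - cfc g h := by
      rw [cfc_sub (fun t => t) g h continuousOn_id hg.continuousOn, ← this]
    rw [← h2]
    apply norm_cfc_le hε.le
    intro t ht
    have := hp t ht
    simp only [g, Real.norm_eq_abs]
    rw [abs_le]
    constructor <;> rcases le_total (t - ε) 0 with h | h <;> simp [h] <;> linarith
  have hd : ∀ δ : ℝ, 0 < δ → δ < ε → LP (cfc (fun t : ℝ => max (t - δ) 0) h) * LP (cfc g h) = LP (cfc g h) := by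
    intro δ d0 dε
    have hm : Continuous (fun t : ℝ => (max (t - δ) (ε - δ))⁻¹) := by
      apply Continuous.inv₀ (by fun_prop)
      intro t; have : 0 < max (t - δ) (ε - δ) := lt_max_of_lt_right (by linarith)
      positivity
    have : cfc (fun t : ℝ => max (t - δ) 0 * (g t * (max (t - δ) (ε - δ))⁻¹)) h = cfc g h := by
      apply cfc_congr
      intro t ht
      simp only [g]
      rcases le_total (t - ε) 0 with h | h
      · simp [h]
      · have h1 : max (t - δ) (ε - δ) = t - δ := max_eq_left (by linarith)
        have h2 : max (t - δ) 0 = t - δ := max_eq_left (by linarith)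
        have h4 : t - δ ≠ 0 := by intro h; linarith
        simp only [h1, h2]
        field_simp
    rw [cfc_mul (fun t : ℝ => max (t - δ) 0) (fun t => g t * (max (t - δ) (ε - δ))⁻¹) h (by fun_prop) (hg.mul hm).continuousOn] at this
    apply LP_le
    rw [← this, ← ma, LP_mul]
  have cg : cfc (fun t => t * (c t * c t) * g t) h = cfc g h := by
    apply cfc_congr
    intro t ht
    have := hp t ht
    simp only [g]
    rcases le_total (t - ε) 0 with h | h
    · simp [h]
    · have h1 : max t ε = t := max_eq_left (by linarith)
      have h2 : 0 < t := by linarith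
      have h3 := Real.mul_self_sqrt h2.le
      have h4 : Real.sqrt t ≠ 0 := by positivity
      have h5 : t * ((Real.sqrt t)⁻¹ * (Real.sqrt t)⁻¹) = 1 := by
        rw [← mul_inv, h3, mul_inv_cancel₀ h2.ne']
      simp only [c, h1, h5, one_mul]
  have cg2 : h * (cfc c h * cfc c h) * cfc g h = cfc g h := by
    rw [cfc_mul _ g h (by fun_prop) hg.continuousOn, cfc_mul (fun t => t) _ h (by fun_prop) (by fun_prop), cfc_mul c c h (by fun_prop) (by fun_prop), cfc_id' ℝ h hsa] at cg
    exact cg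
  have cb : ∀ a : R, a * h = h * a → a * cfc c h = cfc c h * a := fun a ha =>
    ((show Commute h a from ha.symm).cfc_real c).symm
  have cgg : ∀ a : R, a * h = h * a → a * cfc g h = cfc g h * a := fun a ha =>
    ((show Commute h a from ha.symm).cfc_real g).symm
  have gs : star (cfc g h) = cfc g h := (cfc_predicate g h : IsSelfAdjoint _)
  have cs : star (cfc c h) = cfc c h := (cfc_predicate c h : IsSelfAdjoint _)
  have ce : ∀ a : R, a * h = h * a → a * LP (cfc g h) = LP (cfc g h) * a := fun a ha => LP_comm gs (cgg a ha)
  generalize cfc c h = B at *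
  have key : h * (B * B) * LP (cfc g h) = 1 * LP (cfc g h) := psup_eq (by rintro _ rfl; rw [cg2, one_mul])
  rw [one_mul] at key
  have hE : Pj (LP (cfc g h)) := pj_psup _
  generalize LP (cfc g h) = e at *
  have eh := ce h rfl
  have hB := cb h rfl
  have eB := ce B (by rw [hB])
  have x1 : h * (B * e) * (B * e) = e := by
    calc h * (B * e) * (B * e) = h * (B * ((e * B) * e)) := by simp only [ma]
      _ = h * (B * B) * e := by rw [← eB, ma B, hE.2]; simp only [ma]
      _ = e := key
  refine ⟨B * e, by rw [star_mul, cs, hE.1, eB], ?_, x1, ce, ?_, h3, hd⟩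
  · rw [ma B, ← eh, ← ma B, ← hB, ma h B e, x1]
  · intro a ha; rw [← ma, cb a ha, ma, ce a ha, ma]
theorem SP (x : R) : ∃ E b : ℕ → R, (∀ n, Pj (E n)) ∧ (∀ n, E (n+1) * E n = E n) ∧ (∀ n, star (b n) = b n) ∧
    (∀ n, b n * (star x * x) * b n = E n) ∧ (∀ n, (star x * x) * b n * b n = E n) ∧
    (∀ n a, a * (star x * x) = (star x * x) * a → a * E n = E n * a) ∧
    (∀ n a, a * (star x * x) = (star x * x) * a → a * b n = b n * a) ∧ fsup E = LP (star x) := by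
  have hs : star (star x * x) = star x * x := by simp
  have hp : ∀ t ∈ spectrum ℝ (star x * x), 0 ≤ t := fun t ht => spectrum_star_mul_self_nonneg t ht
  have hε : ∀ n : ℕ, (0:ℝ) < 1 / (n + 1) := fun n => by positivity
  choose b h1 h2 h3 h4 h5 h6 h7 using fun n : ℕ => SPe hs hp (hε n)
  set P : ℕ → R := fun n => cfc (fun t : ℝ => max (t - 1 / (n + 1)) 0) (star x * x) with hP
  refine ⟨fun n => LP (P n), b, fun n => LP_pj _, fun n => ?_, h1, h2, h3, h4, h5, ?_⟩
  · exact h7 n (1 / ((n+1 : ℕ) + 1)) (hε _) (by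
      push_cast
      apply one_div_lt_one_div_of_lt <;> [positivity; linarith])
  · have hF := fsup_pj (fun n => LP (P n))
    set F := fsup (fun n => LP (P n)) with hFd
    have k1 : (1 - F) * (star x * x) = 0 := by
      have : ∀ n : ℕ, ‖(1 - F) * (star x * x)‖ ≤ 1 / (n + 1) := by
        intro n
        have e1 : (1 - F) * (star x * x) = (1 - F) * (star x * x - P n) := by
          rw [mul_sub, sub_mul 1 F (P n), one_mul]
          have : F * P n = P n := by
            rw [← LP_mul (P n), ← ma, fsup_mul (fun n => LP (P n)) n]
          rw [this]; simp
        rw [e1]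
        refine (norm_mul_le _ _).trans ?_
        have := hF.compl.norm_le
        have := h6 n
        have := norm_nonneg (star x * x - P n)
        have : ‖1 - F‖ * ‖star x * x - P n‖ ≤ 1 * ‖star x * x - P n‖ := by gcongr
        linarith [h6 n]
      have h0 : ‖(1 - F) * (star x * x)‖ ≤ 0 :=
        ge_of_tendsto' (tendsto_one_div_add_atTop_nhds_zero_nat (𝕜 := ℝ)) this
      exact norm_le_zero_iff.1 h0
    have k2 : (1 - F) * star x = 0 := by
      apply sq0'
      rw [star_mul, star_star, ma, ← ma (star x), ← ma, k1, zero_mul]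
    apply pj_antisymm hF (LP_pj _)
    · apply LP_le; rw [sub_mul, one_mul, sub_eq_zero] at k2; exact k2.symm
    · apply fsup_le; intro n
      have := LP_mul (star x)
      change LP (star x) * LP (P n) = LP (P n)
      conv_lhs => rw [← h3 n]
      rw [ma, ma (star x), ← ma (LP _), LP_mul, ← h3 n]
      simp only [ma]
def incr (E : ℕ → R) : ℕ → R
  | 0 => E 0
  | n+1 => E (n+1) - E n
theorem incr_mono {E : ℕ → R} (hm : ∀ n, E (n+1) * E n = E n) (hE : ∀ n, Pj (E n)) {n m : ℕ} (h : n ≤ m) : E m * E n = E n := by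
  induction m, h using Nat.le_induction with
  | base => exact (hE n).2
  | succ m _ ih => exact lt (hm m) ih
theorem incr_le {E : ℕ → R} (hm : ∀ n, E (n+1) * E n = E n) (hE : ∀ n, Pj (E n)) (n : ℕ) : E n * incr E n = incr E n := by
  cases n with
  | zero => exact (hE 0).2
  | succ n => exact (hE (n+1)).dl (hm n)
theorem incr_pj {E : ℕ → R} (hm : ∀ n, E (n+1) * E n = E n) (hE : ∀ n, Pj (E n)) (n : ℕ) : Pj (incr E n) := by
  cases n with
  | zero => exact hE 0
  | succ n => exact (hE n).sub (hE _) (hm n)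
theorem incr_orth {E : ℕ → R} (hm : ∀ n, E (n+1) * E n = E n) (hE : ∀ n, Pj (E n)) : Orth (incr E) := by
  have key : ∀ n m, n < m → incr E m * incr E n = 0 := by
    intro n m h
    obtain ⟨m, rfl⟩ : ∃ k, m = k + 1 := ⟨m - 1, by omega⟩
    have h1 := incr_le hm hE n
    have h2 := incr_mono hm hE (show n ≤ m by omega)
    rw [← h1, ← h2, ← ma, ← ma]
    have : incr E (m+1) * E m = 0 := (hE m).d0' (hm m)
    rw [this]; simp
  refine ⟨incr_pj hm hE, fun i j hij => ?_⟩
  rcases lt_or_gt_of_ne hij with h | h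
  · exact (incr_pj hm hE j).fl0 (incr_pj hm hE i) (key _ _ h)
  · exact key _ _ h
theorem incr_fsup {E : ℕ → R} (hm : ∀ n, E (n+1) * E n = E n) (hE : ∀ n, Pj (E n)) : fsup (incr E) = fsup E := by
  apply pj_antisymm (fsup_pj _) (fsup_pj _)
  · apply fsup_le; intro n
    induction n with
    | zero => exact fsup_mul (incr E) 0
    | succ n ih =>
      have := fsup_mul (incr E) (n+1)
      have e : E (n+1) = incr E (n+1) + E n := by simp [incr]
      rw [e, mul_add, this, ih]
  · apply fsup_le; intro n
    exact lt (fsup_mul E n) (incr_le hm hE n)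
theorem LPRP {x : R} (hF : Fn (LP (star x))) : Ev (LP (star x)) (LP x) := by
  obtain ⟨E, b, hE, hm, h1, h2, h3, h4, h5, h6⟩ := SP x
  have oe := incr_orth hm hE
  have fe := incr_fsup hm hE
  have le := incr_le hm hE
  set h := star x * x with hh
  set e := incr E with he
  have Eh : ∀ n, h * E n = E n * h := fun n => h4 n h rfl
  have bh : ∀ n, h * b n = b n * h := fun n => h5 n h rfl
  have Ec : ∀ n m, E n * b m = b m * E n := fun n m => h5 m _ (Eh n).symm
  have ec : ∀ n m, e n * b m = b m * e n := by
    intro n m; rcases n with _ | n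
    · exact Ec 0 m
    · simp only [he, incr, sub_mul, mul_sub, Ec]
  have eh : ∀ n, h * e n = e n * h := by
    intro n; rcases n with _ | n
    · exact Eh 0
    · simp only [he, incr, sub_mul, mul_sub, Eh]
  let w : ℕ → R := fun n => x * b n * e n
  have ww : ∀ n m, star (w n) * w m = e n * e m * (b n * h * b m) := by
    intro n m
    simp only [w, star_mul, h1, (oe.pj n).1]
    calc e n * (b n * star x) * (x * b m * e m) = e n * (b n * (h * (b m * e m))) := by simp only [hh, ma]
      _ = _ := by
        rw [← ec, ← ma h, eh, ← ma (b n), ← ma (b n), ← ec]; simp only [ma]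
  have wn : ∀ n, star (w n) * w n = e n := fun n => by
    rw [ww, h2, (oe.pj n).2, (oe.pj n).fl (hE n) (le n)]
  have w0 : ∀ n m, n ≠ m → star (w n) * w m = 0 := fun n m hnm => by rw [ww, oe.or n m hnm, zero_mul]
  let f : ℕ → R := fun n => w n * star (w n)
  have of : Orth f := ⟨fun n => pj_final (by rw [wn n]; exact oe.pj n), fun i j hij => by
    simp only [f]; rw [ma, ← ma (star _), w0 i j hij]; simp⟩
  have ev : ∀ n, Ev (e n) (f n) := fun n => ⟨w n, wn n, rfl⟩
  rw [← h6, ← fe] at hF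
  have := Add oe of ev hF
  rw [fe, h6] at this
  convert this using 1
  apply pj_antisymm (LP_pj _) (fsup_pj _)
  · apply fsup_le; intro n; simp only [f, w]; rw [← ma, ← ma, ← ma, LP_mul]
  · apply LP_le
    have q : ∀ n, (1 - fsup f) * x * e n = 0 * e n := fun n => by
      have q1 : x * e n = w n * (b n * h) := by
        calc x * e n = x * (E n * e n) := by rw [le]
          _ = x * (h * b n * b n * e n) := by rw [h3]
          _ = x * (b n * e n * (b n * h)) := by
            rw [bh, ma (b n) h, bh, ma (b n), ma (b n) h, eh, ← ma (b n) (e n), ← ec, ← ma (b n) (e n * b n), ← ma (b n) (e n) (b n), ← ec, ma (e n * b n)]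
          _ = _ := by simp only [w, ma]
      have q2 : fsup f * w n = w n := by
        have : f n * w n = w n := pi_mul' (of.pj n) rfl
        rw [← this, ← ma, fsup_mul]
      rw [ma, q1, ← ma, sub_mul, q2]; simp
    have := fsup_eq q
    rw [fe, h6] at this
    have lx : x * LP (star x) = x := by
      have := congrArg star (LP_mul (star x)); simpa [(LP_pj (star x)).1] using this
    rw [ma, lx, zero_mul, sub_mul, one_mul, sub_eq_zero] at this
    exact this.symm
theorem KC {t k : R} {E : ℕ → R} (h : Fn t) (ht : Pj t) (hk : Pj k) (hE : ∀ n, Pj (E n)) (hm : ∀ n, E (n+1) * E n = E n)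
    (hs : fsup E = t) (hv : ∀ n, Sb k (t - E n)) : k = 0 := by
  have tE : ∀ n, t * E n = E n := fun n => by rw [← hs]; exact fsup_mul E n
  obtain ⟨k0, hk0, l0, v0⟩ := (hv 0).ex hk
  have tk0 : t * k0 = k0 := lt (ht.dl (tE 0)) l0
  have sE : ∀ n, Sb (E n) (t - k0) := by
    intro n
    obtain ⟨k1, hk1, l1, v1⟩ := (hv n).ex hk
    have tk1 : t * k1 = k1 := lt (ht.dl (tE n)) l1
    have e1 : Ev (t - k1) (t - k0) := FC h ht hk1 hk0 tk1 tk0 ((v1.symm).trans hk1 v0)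
    have : Sb (E n) (t - k1) := Sb.of_le (hE n) (by
      have : k1 * E n = 0 := by
        rw [← hk1.fl ((hE n).sub ht (tE n)) l1, ma, (hE n).d0' (tE n), mul_zero]
      rw [sub_mul, tE, this, sub_zero])
    exact this.trans (hk1.sub ht tk1) (e1.sb (hk1.sub ht tk1))
  have pr := hk0.sub ht tk0
  have hr := h.le ht pr (ht.dl tk0)
  set r := t - k0 with hrd
  have step : ∀ n (a : {a : R // Pj a ∧ r * a = a ∧ Ev (E n) a}), ∃ a' : {a : R // Pj a ∧ r * a = a ∧ Ev (E (n+1)) a},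
      a'.1 * a.1 = a.1 ∧ Ev (E (n+1) - E n) (a'.1 - a.1) := by
    rintro n ⟨a, ha, la, va⟩
    have pd := (hE n).sub (hE (n+1)) (hm n)
    have := FC2 (a := a) (b := r - a) (p := E n) (q := E (n+1) - E n) (by simpa using hr) ha (ha.sub pr la) (hE n) pd
      (ha.d0 pr la) ((hE n).d0 (hE _) (hm n)) va (by simpa using sE (n+1))
    obtain ⟨g, hg, lg, vg⟩ := this.ex pd
    have ag : a * g = 0 := by rw [← lg, ← ma, ha.d0 pr la, zero_mul]
    have ga := ha.fl0 hg ag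
    refine ⟨⟨a + g, ha.add hg ag, ?_, ?_⟩, ?_, ?_⟩
    · rw [mul_add, la, lt (pr.dl la) lg]
    · have := va.add (hE n) pd vg ((hE n).d0 (hE _) (hm n)) ag
      simpa using this
    · simp [add_mul, ha.2, ga]
    · simpa using vg
  choose nx n1 n2 using step
  obtain ⟨a0, ha0, la0, va0⟩ := (sE 0).ex (hE 0)
  let G : ∀ n, {a : R // Pj a ∧ r * a = a ∧ Ev (E n) a} := fun n => Nat.rec ⟨a0, ha0, la0, va0⟩ (fun n a => nx n a) n
  have G1 : ∀ n, (G (n+1)).1 * (G n).1 = (G n).1 := fun n => n1 n (G n)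
  have ev : ∀ n, Ev (incr E n) (incr (fun n => (G n).1) n) := by
    intro n; cases n with
    | zero => exact (G 0).2.2.2
    | succ n => exact n2 n (G n)
  have := Add (incr_orth hm hE) (incr_orth G1 (fun n => (G n).2.1)) ev (by rw [incr_fsup hm hE, hs]; exact h)
  rw [incr_fsup hm hE, hs, incr_fsup G1 (fun n => (G n).2.1)] at this
  have s1 : Sb t r := (this.sb ht).le (fsup_le (fun n => (G n).2.2.1))
  have := h.eq ht (ht.dl tk0) pr s1
  have k00 : k0 = 0 := by simpa using this
  rw [k00] at v0
  exact v0.zero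
end AW
namespace AW
variable {R : Type u} [CStarAlgebra R] [AWStar R]
def Dbl (t : R) : Prop := ∃ g h : R, Pj g ∧ Pj h ∧ g * h = 0 ∧ t = g + h ∧ Ev g t ∧ Ev h t
def PI (t : R) : Prop := ∀ z, Cn z → Fn (z * t) → z * t = 0
theorem fnGlue {ι : Type*} {z : ι → R} (hz : ∀ i, Cn (z i)) {t : R} (ht : Pj t) (h : ∀ i, Fn (z i * t)) : Fn (fsup z * t) := by
  intro v h1 h2
  have hZ := Cn.fsup hz
  have zz : ∀ i, z i * fsup z = z i := fun i => mul_fsup (fun i => (hz i).pj) i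
  have key : fsup z * (v * star v) = fsup z * t := fsup_eqz hz (fun i => by
    rw [(hz i).sq]
    have hs : z i * star v = star (z i * v) := by rw [star_mul, (hz i).pj.1, (hz i).cm]
    rw [hs]
    apply h i
    · rw [← hs, ← (hz i).sq, h1, ← ma, zz]
    · calc z i * t * (z i * v) = z i * (t * v) := ((hz i).sq).symm
        _ = z i * fsup z * (t * v) := by rw [zz]
        _ = z i * (fsup z * t * v) := by simp only [ma]
        _ = z i * v := by rw [h2])
  have : fsup z * v = v := by
    rw [← h2, ma, ← ma, hZ.pj.2]
  rwa [← ma, this] at key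
theorem fpi {t : R} (ht : Pj t) : ∃ z, Cn z ∧ Fn (z * t) ∧ PI ((1 - z) * t) := by
  obtain ⟨S, h1, h2, h3⟩ := zorn_pw (fun s : R => Cn s ∧ s ≠ 0 ∧ Fn (s * t)) (fun s t => s * t = 0 ∧ t * s = 0)
    (fun s t h => h.symm)
  set Z := fsup (fun s : S => s.1) with hZd
  have hZ : Cn Z := Cn.fsup (fun s : S => (h1 s s.2).1)
  refine ⟨Z, hZ, fnGlue (fun s : S => (h1 s s.2).1) ht (fun s : S => (h1 s s.2).2.2), fun y hy hf => ?_⟩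
  by_contra hne
  rw [← ma] at hf hne
  have hy' := hy.mul hZ.compl
  have m : y * (1 - Z) ∈ S := h3 _ ⟨hy', fun h => hne (by rw [h, zero_mul]), hf⟩ (fun s hs => by
    have : Z * s = s := fsup_mul (fun s : S => s.1) ⟨s, hs⟩
    have : y * (1 - Z) * s = 0 := by rw [ma, sub_mul, this]; simp
    exact ⟨this, by rw [← hy'.cm, this]⟩)
  have : Z * (y * (1 - Z)) = y * (1 - Z) := fsup_mul (fun s : S => s.1) ⟨_, m⟩
  apply hne
  rw [← this, ← ma, ← hy.cm, ma y, mul_sub, hZ.pj.2]; simp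
theorem PI.zmul {t z : R} (h : PI t) (hz : Cn z) : PI (z * t) := fun y hy hf => by
  rw [← ma] at hf ⊢; exact h _ (hy.mul hz) hf
theorem PI.sb {t s : R} (h : PI t) (ht : Pj t) (hs : Pj s) (hl : Sb t s) (hc : cc t * s = s) : PI s := fun y hy hf => by
  have : y * t = 0 := h y hy (hf.sb (hy.pmul hs) (hy.pmul ht) (hl.zmul hy ht))
  have h2 : (1 - y) * cc t = cc t := cc_le hy.compl (by rw [sub_mul, this]; simp)
  rw [← hc, ← ma, ← h2, ← ma, mul_sub, hy.pj.2]; simp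
theorem PI.ev {t s : R} (h : PI t) (ht : Pj t) (hv : Ev t s) : PI s :=
  h.sb ht (hv.pj ht) (hv.sb ht) ((hv.symm).cn (cn_cc t) (hv.pj ht) (cc_mul t))
theorem Dbl.mk' {t g : R} (ht : Pj t) (hg : Pj g) (hl : t * g = g) (h1 : Sb t g) (h2 : Sb t (t - g)) : Dbl t :=
  ⟨g, t - g, hg, hg.sub ht hl, hg.d0 ht hl, by simp, SB hg ht (.of_le hg hl) h1,
    SB (hg.sub ht hl) ht (.of_le (hg.sub ht hl) (ht.dl hl)) h2⟩
theorem Dbl.absorb {t s : R} (h : Dbl t) (ht : Pj t) (hs : Pj s) (hv : Sb s t) (ho : t * s = 0) : Sb (t + s) t := by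
  obtain ⟨g, h, hg, hh, gh, e, v1, v2⟩ := h
  have : Sb (t + s) (g + h) := Sb.add ht hs hg hh (v1.symm.sb ht) (hv.trans ht (v2.symm.sb ht)) ho gh
  rwa [← e] at this
theorem DblA {a b c r t : R} (ha : Pj a) (hb : Pj b) (hc : Pj c) (hr : Pj r) (ab : a * b = 0) (ac : a * c = 0) (bc : b * c = 0)
    (ra : r * a = 0) (rb : r * b = 0) (rc : r * c = 0) (vab : Ev a b) (vbc : Ev b c) (v : Ev (a + b) c) (vr : Sb r a)
    (ht : t = a + b + c + r) : Dbl t := by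
  have pab := ha.add hb ab
  have abc : (a + b) * c = 0 := by rw [add_mul, ac, bc, zero_add]
  have cr := hr.fl0 hc rc
  have ar := hr.fl0 ha ra
  have br := hr.fl0 hb rb
  have ba := ha.fl0 hb ab
  have ca := ha.fl0 hc ac
  have pcr := hc.add hr cr
  have pt : Pj t := by
    rw [ht]; exact (pab.add hc abc).add hr (by simp [add_mul, ar, br, cr])
  have s1 : Sb (c + r) b := by
    have : Sb (c + r) (b + a) := Sb.add hc hr hb ha (vbc.symm.sb hc) vr cr ba
    rw [add_comm b a] at this
    exact this.trans pab ((v.trans pab vbc.symm).sb pab)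
  have s2 : Sb t (c + b) := by
    have : Sb ((a + b) + (c + r)) (c + b) := Sb.add pab pcr hc hb (v.sb pab) s1 (by simp [mul_add, abc, add_mul, ar, br, ac, bc]) (hb.fl0 hc bc)
    rw [ht]; convert this using 1; abel
  have pcb := hc.add hb (hb.fl0 hc bc)
  have s3 : Sb (c + b) c := by
    have : Ev (c + b) (a + b) := Ev.add hc hb ((vab.trans ha vbc).symm) (.refl hb) (hb.fl0 hc bc) ab
    exact ((this.trans pcb v).sb pcb)
  have s4 : Sb t c := s2.trans pcb s3
  have s5 : Sb t a := s4.trans hc ((vab.trans ha vbc).symm.sb hc)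
  have la : t * a = a := by rw [ht]; simp [add_mul, ha.2, ba, ca, ra]
  refine Dbl.mk' pt ha la s5 (s4.le ?_)
  rw [ht]; simp [add_mul, sub_mul, hc.2, ac, bc, rc]
theorem iter_orth {t v : R} (ht : Pj t) (h1 : star v * v = t) (h2 : t * v = v) :
    ∃ e : ℕ → R, Orth e ∧ (∀ n, t * e n = e n) ∧ (∀ n, Ev (t - v * star v) (e n)) := by
  have vt := pi_mul ht h1
  have pf : Pj (v * star v) := pj_final (h1 ▸ ht)
  have lf : t * (v * star v) = v * star v := by rw [← ma, h2]
  have pr := pf.sub ht lf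
  set r := t - v * star v with hr
  have tr : t * r = r := ht.dl lf
  have sv : star v * t = star v := by have := congrArg star h2; simpa [ht.1] using this
  have tsv : t * star v = star v := by have := congrArg star vt; simpa [ht.1] using this
  have rv : star v * r = 0 := by rw [hr, mul_sub, sv, ← ma, h1, tsv, sub_self]
  let w : ℕ → R := fun n => Nat.rec r (fun _ a => v * a) n
  have w0 : w 0 = r := rfl
  have ws : ∀ n, w (n+1) = v * w n := fun n => rfl
  have tw : ∀ n, t * w n = w n := by
    intro n; induction n with
    | zero => exact tr
    | succ n ih => rw [ws, ← ma, h2]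
  have key : ∀ n m, star (w n) * w m = if n = m then r else 0 := by
    intro n; induction n with
    | zero =>
      intro m; cases m with
      | zero => simp [w0, pr.1, pr.2]
      | succ m =>
        have := congrArg star rv
        rw [w0, ws, pr.1, ← ma]; simp [pr.1] at this; simp [this]
    | succ n ih =>
      intro m; cases m with
      | zero => rw [ws, star_mul, w0, ma, rv]; simp
      | succ m =>
        rw [ws, ws, star_mul, ma, ← ma (star v), h1, tw, ih]; simp
  have kn : ∀ n, star (w n) * w n = r := fun n => by simp [key]
  refine ⟨fun n => w n * star (w n), ⟨fun n => pj_final (by rw [kn]; exact pr), fun i j hij => ?_⟩, fun n => ?_, fun n => ⟨w n, kn n, rfl⟩⟩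
  · rw [ma, ← ma (star _), key, if_neg hij]; simp
  · rw [← ma, tw]
theorem DblI {ι : Type*} [Infinite ι] {e : ι → R} {ρ t : R} (he : Orth e) (hv : ∀ i j, Ev (e i) (e j)) (hr : Pj ρ)
    (hre : ∀ i, ρ * e i = 0) (hs : ∀ i, Sb ρ (e i)) (ht : t = fsup e + ρ) : Dbl t := by
  have a1 : Nonempty (ι ⊕ ι ≃ ι) := by
    apply Cardinal.eq.1; rw [Cardinal.mk_sum]; simp [Cardinal.add_eq_self (Cardinal.aleph0_le_mk ι)]
  obtain ⟨φ⟩ := a1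
  let ψ : (ι ⊕ ι) ⊕ ι ≃ ι := (Equiv.sumCongr φ (Equiv.refl ι)).trans φ
  let A : ι → R := fun i => e (ψ (.inl (.inl i)))
  let B : ι → R := fun i => e (ψ (.inl (.inr i)))
  let C : ι → R := fun i => e (ψ (.inr i))
  let AB : ι ⊕ ι → R := fun i => e (ψ (.inl i))
  have oA : Orth A := he.inj (φ := fun i => ψ (.inl (.inl i))) (fun i j h => by simpa using h)
  have oB : Orth B := he.inj (φ := fun i => ψ (.inl (.inr i))) (fun i j h => by simpa using h)
  have oC : Orth C := he.inj (φ := fun i => ψ (.inr i)) (fun i j h => by simpa using h)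
  have oAB : Orth AB := he.inj (φ := fun i => ψ (.inl i)) (fun i j h => by simpa using h)
  have orAB : ∀ i j, A i * B j = 0 := fun i j => he.or _ _ (by simp)
  have orBC : ∀ i j, B i * C j = 0 := fun i j => he.or _ _ (by simp)
  have orAC : ∀ i j, A i * C j = 0 := fun i j => he.or _ _ (by simp)
  have orABC : ∀ i j, AB i * C j = 0 := fun i j => he.or _ _ (by simp)
  have sAB : fsup AB = fsup A + fsup B := by
    have pAB := (fsup_pj A).add (fsup_pj B) (fsup_orth oA.pj oB.pj orAB)
    apply pj_antisymm (fsup_pj _) pAB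
    · rw [mul_add, fsup_le (e := A), fsup_le (e := B)]
      · exact fun i => fsup_mul AB (.inr i)
      · exact fun i => fsup_mul AB (.inl i)
    · apply fsup_le; rintro (i | i)
      · have : fsup B * A i = 0 := (oA.pj i).fl0 (fsup_pj B) (fsup_ann (orAB i))
        change (fsup A + fsup B) * A i = A i
        rw [add_mul, fsup_mul, this, add_zero]
      · have : fsup A * B i = 0 := (oB.pj i).fl0 (fsup_pj A) (fsup_ann (fun j => (oA.pj j).fl0 (oB.pj i) (orAB j i)))
        change (fsup A + fsup B) * B i = B i
        rw [add_mul, fsup_mul, this, zero_add]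
  have oABC := fsup_orth oAB.pj oC.pj orABC
  have st : fsup e = fsup AB + fsup C := by
    apply pj_antisymm (fsup_pj _) ((fsup_pj _).add (fsup_pj _) oABC)
    · rw [mul_add, fsup_le (e := AB), fsup_le (e := C)]
      · exact fun i => fsup_mul e _
      · exact fun i => fsup_mul e _
    · apply fsup_le; intro i
      obtain ⟨j, rfl⟩ := ψ.surjective i
      rcases j with j | j
      · have : fsup C * AB j = 0 := (oAB.pj j).fl0 (fsup_pj _) (fsup_ann (orABC j))
        change (fsup AB + fsup C) * AB j = AB j
        rw [add_mul, fsup_mul, this, add_zero]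
      · have : fsup AB * C j = 0 := (oC.pj j).fl0 (fsup_pj _) (fsup_ann (fun k => (oAB.pj k).fl0 (oC.pj j) (orABC k j)))
        change (fsup AB + fsup C) * C j = C j
        rw [add_mul, fsup_mul, this, zero_add]
  have ra : ∀ (κ : Type _) (f : κ → ι), ρ * fsup (fun k => e (f k)) = 0 := fun κ f => fsup_ann (fun k => hre _)
  refine DblA (fsup_pj A) (fsup_pj B) (fsup_pj C) hr (fsup_orth oA.pj oB.pj orAB) (fsup_orth oA.pj oC.pj orAC) (fsup_orth oB.pj oC.pj orBC)
    (ra _ _) (ra _ _) (ra _ _) (OEv oA oB orAB (fun i => hv _ _)) (OEv oB oC orBC (fun i => hv _ _)) ?_ ?_ (by rw [ht, st, sAB])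
  · rw [← sAB]
    have hC : fsup C = fsup (C ∘ φ) := by
      apply pj_antisymm (fsup_pj _) (fsup_pj _)
      · exact fsup_le (fun i => fsup_mul C _)
      · apply fsup_le; intro i; obtain ⟨j, rfl⟩ := φ.surjective i; exact fsup_mul (C ∘ φ) j
    rw [hC]
    exact OEv oAB (oC.inj φ.injective) (fun i j => orABC _ _) (fun i => hv _ _)
  · obtain ⟨i⟩ := (inferInstance : Nonempty ι)
    exact (hs _).le (fsup_mul A i)
theorem max_copies {t r : R} (ht : Pj t) (hr : Pj r) : ∃ S : Set R, Orth (fun s : S => s.1) ∧ (∀ s ∈ S, t * s = s ∧ Ev r s) ∧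
    (r ≠ 0 → ¬ Sb r (t - fsup (fun s : S => s.1))) := by
  obtain ⟨S, h1, h2, h3⟩ := zorn_pw (fun s : R => Pj s ∧ t * s = s ∧ Ev r s) (fun s t => s * t = 0 ∧ t * s = 0)
    (fun s t h => h.symm)
  refine ⟨S, ⟨fun s => (h1 s s.2).1, fun s t h => (h2 s.2 t.2 (fun h' => h (Subtype.ext h'))).1⟩, fun s hs => (h1 s hs).2, fun r0 hv => ?_⟩
  set Z := fsup (fun s : S => s.1) with hZ
  have hl : t * Z = Z := fsup_le (fun s : S => (h1 s s.2).2.1)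
  obtain ⟨g, hg, lg, vg⟩ := hv.ex hr
  have zg : Z * g = 0 := by rw [← lg, ← ma, (fsup_pj _).d0 ht hl, zero_mul]
  have m : g ∈ S := h3 g ⟨hg, lt (ht.dl hl) lg, vg⟩ (fun s hs => by
    have : s * Z = s := mul_fsup (e := fun s : S => s.1) (fun s => (h1 s s.2).1) ⟨s, hs⟩
    have : s * g = 0 := by rw [← this, ma, zg, mul_zero]
    exact ⟨(h1 s hs).1.fl0 hg this, this⟩)
  have : Z * g = g := fsup_mul (fun s : S => s.1) ⟨g, m⟩
  rw [zg] at this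
  exact r0 (by rw [← this] at vg; exact vg.zero)
theorem infDbl {t : R} (ht : Pj t) (h : ¬ Fn t) : ∃ y, Cn y ∧ y * t ≠ 0 ∧ Dbl (y * t) := by
  simp only [Fn, not_forall] at h
  obtain ⟨v, h1, h2, h3⟩ := h
  obtain ⟨e, oe, le, ve⟩ := iter_orth ht h1 h2
  have pf : Pj (v * star v) := pj_final (h1 ▸ ht)
  have lf : t * (v * star v) = v * star v := by rw [← ma, h2]
  have pr := pf.sub ht lf
  have r0 : t - v * star v ≠ 0 := fun h => h3 (sub_eq_zero.1 h).symm
  have lr := ht.dl lf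
  set r := t - v * star v
  have lE : t * fsup e = fsup e := fsup_le le
  have pE := fsup_pj e
  obtain ⟨S, oS, lS, mS⟩ := max_copies (pE.sub ht lE) pr
  set Q := fsup (fun s : S => s.1) with hQ
  have pQ : Pj Q := fsup_pj _
  have lQ : (t - fsup e) * Q = Q := fsup_le (fun s : S => (lS s s.2).1)
  have pρ := pQ.sub (pE.sub ht lE) lQ
  set ρ := t - fsup e - Q with hρ
  have lρ : (t - fsup e) * ρ = ρ := (pE.sub ht lE).dl lQ
  obtain ⟨z, hz, s1, s2⟩ := GC pρ pr
  have zr : z * r ≠ 0 := fun h0 => mS r0 (by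
    have : (1 - z) * r = r := by rw [sub_mul, h0]; simp
    rw [this] at s2
    exact s2.le (hz.compl.le_mul pρ))
  have eS : ∀ n (s : S), e n * s.1 = 0 := fun n s => by
    rw [← (lS s s.2).1, ← ma, mul_sub, mul_fsup oe.pj, (oe.pj n).fl ht (le n)]; simp
  let E : ℕ ⊕ S → R := fun i => z * Sum.elim e (fun s => s.1) i
  have pE' : ∀ i, Pj (Sum.elim e (fun s : S => s.1) i) := by rintro (n | s); exacts [oe.pj n, oS.pj s]
  have oE : Orth E := by
    refine ⟨fun i => hz.pmul (pE' i), fun i j hij => hz.ort ?_⟩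
    rcases i with n | s <;> rcases j with m | s'
    · exact oe.or n m (fun h => hij (by rw [h]))
    · exact eS n s'
    · exact (oe.pj m).fl0 (oS.pj s) (eS m s)
    · exact oS.or s s' (fun h => hij (by rw [h]))
  have vE : ∀ i, Ev (z * r) (E i) := by
    rintro (n | s)
    · exact (ve n).zmul hz
    · exact (lS s s.2).2.zmul hz
  have ρe : ∀ i, ρ * (Sum.elim e (fun s : S => s.1) i) = 0 := by
    rintro (n | s)
    · apply (oe.pj n).fl0 pρ
      change e n * ρ = 0
      have z0 : e n * (t - fsup e) = 0 := by rw [mul_sub, mul_fsup oe.pj, (oe.pj n).fl ht (le n), sub_self]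
      rw [← lρ, ← ma, z0, zero_mul]
    · have := fsup_mul (fun s : S => s.1) s
      change ρ * s.1 = 0
      change Q * s.1 = s.1 at this
      rw [← this, ← ma, pQ.d0' lQ, zero_mul]
  have pz := hz.pmul pr
  refine ⟨z, hz, fun h => zr (by rw [← lr, ← ma, h, zero_mul]), DblI (e := E) (ρ := z * ρ) oE (fun i j => ((vE i).symm).trans (oE.pj i) (vE j)) (hz.pmul pρ)
    (fun i => hz.ort (ρe i)) (fun i => s1.trans pz ((vE i).sb pz)) ?_⟩
  have : fsup E = z * (fsup e + Q) := by
    rw [fsup_zmul hz pE']; congr 1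
    have o : fsup e * Q = 0 := fsup_orth oe.pj oS.pj eS
    apply pj_antisymm (fsup_pj _) (pE.add pQ o)
    · rw [mul_add, fsup_le (e := e) (fun n => fsup_mul (Sum.elim e (fun s : S => s.1)) (.inl n)), hQ,
        fsup_le (e := fun s : S => s.1) (fun n => fsup_mul (Sum.elim e (fun s : S => s.1)) (.inr n))]
    · apply fsup_le; rintro (n | s)
      · have : Q * e n = 0 := (oe.pj n).fl0 pQ (fsup_ann (eS n))
        change (fsup e + Q) * e n = e n
        rw [add_mul, fsup_mul, this, add_zero]
      · have : fsup e * s.1 = 0 := (oS.pj s).fl0 pE (fsup_ann (fun n => (oe.pj n).fl0 (oS.pj s) (eS n s)))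
        have h2 := fsup_mul (fun s : S => s.1) s
        change (fsup e + Q) * s.1 = s.1
        rw [add_mul, this, zero_add]; exact h2
  rw [this, ← mul_add, hρ]; congr 1; abel
theorem PI.dbl {t : R} (h : PI t) (ht : Pj t) : Dbl t := by
  obtain ⟨S, h1, h2, h3⟩ := exh (fun y => Dbl (y * t)) (cn_cc t) (fun y hy yl y0 => by
    have yt : y * t ≠ 0 := fun h0 => y0 (by
      have : y * cc t = 0 := cc_ann (fun a => by rw [hy.cm, ma, h0, mul_zero])
      rw [← yl, ← hy.cm, this])
    have : ¬ Fn (y * t) := fun hf => yt (h y hy hf)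
    obtain ⟨y', c1, c2, c3⟩ := infDbl (hy.pmul ht) this
    rw [← ma] at c2 c3
    exact ⟨y' * y, c1.mul hy, by rw [← ma, hy.cm, ma, hy.pj.2], fun h => c2 (by rw [h, zero_mul]), c3⟩)
  have hz : ∀ s : S, Cn s.1 := fun s => (h1 s s.2).1
  choose g k pg pk gk e vg vk using fun s : S => (h1 s s.2).2.2.2
  choose v hv1 hv2 using fun s => (vg s).symm
  have gl : ∀ s, (s.1 * t) * g s = g s := fun s => by rw [e s, add_mul, (pg s).2, (pg s).fl0 (pk s) (gk s), add_zero]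
  have zg : ∀ s, s.1 * g s = g s := fun s => by rw [← gl s, ← ma, (hz s).le_mul2]
  have zv : ∀ s, s.1 * v s = v s := fun s => by
    have := pi_mul' (pg s) (hv2 s); rw [← this, ← ma, zg]
  obtain ⟨y, y1, y2⟩ := CG hz h2 zv (fun s => pi_norm (by rw [hv1]; exact (hz s).pmul ht))
  rw [h3] at y2
  have sy : ∀ s : S, s.1 * star y = star (v s) := fun s => by rw [← y1, star_mul, (hz s).pj.1, (hz s).cm]
  have ct := cc_mul t
  have hc := cn_cc t
  have yy : star y * y = t := by
    have := fsup_eqz hz (a := star y * y) (b := t) (fun s => by rw [(hz s).sq, sy, y1, hv1])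
    rwa [h3, ct, ← ma, hc.cm, ma, y2] at this
  have sg : ∀ s : S, s.1 * (y * star y) = g s := fun s => by rw [(hz s).sq, sy, y1, hv2]
  have py : Pj (y * star y) := pj_final (yy ▸ ht)
  have ly : t * (y * star y) = y * star y := by
    have := fsup_eqz hz (a := t * (y * star y)) (b := y * star y) (fun s => by
      rw [sg, ← gl s, ← sg, (hz s).sq])
    rwa [h3, ← ma, ct, ← ma (cc t), y2] at this
  have e2 : Ev (t - y * star y) t := by
    have := glueEv hz h2 (e := t - y * star y) (f := t) (py.sub ht ly) (fun s => by
      rw [mul_sub, sg]; have := vk s; convert this using 1; rw [e s]; simp)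
    rwa [h3, ct, mul_sub, ct, ← ma, y2] at this
  exact ⟨y * star y, t - y * star y, py, py.sub ht ly, py.d0 ht ly, by simp, Ev.symm ⟨y, yy, rfl⟩, e2⟩
theorem PI.z {t g f z : R} (h : PI t) (ht : Pj t) (hg : Pj g) (hf : Pj f) (hz : Cn z) (hv : Ev g t) (hs : Sb (z * g) (z * f)) (F : Fn f) : z * t = 0 := by
  apply h z hz
  exact ((F.zmul hf hz).sb (hz.pmul hf) (hz.pmul hg) hs).ev (hz.pmul hg) (hv.zmul hz)
theorem FnS0 {e f : R} (he : Pj e) (hf : Pj f) (ho : e * f = 0) (h1 : Fn e) (h2 : Fn f) (h : PI (e + f)) : e + f = 0 := by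
  have ht := he.add hf ho
  obtain ⟨g, k, hg, hk, gk, e1, v1, v2⟩ := h.dbl ht
  have fe := he.fl0 hf ho
  set t := e + f with htd
  have te : t * e = e := by rw [htd, add_mul, he.2, fe, add_zero]
  have tf : t * f = f := by rw [htd, add_mul, hf.2, ho, zero_add]
  have et := he.fl ht te
  have kg := hg.fl0 hk gk
  have tg : t * g = g := by rw [e1, add_mul, hg.2, kg, add_zero]
  have tk : t * k = k := by rw [e1, add_mul, hk.2, gk, zero_add]
  have gt := hg.fl ht tg
  obtain ⟨c, u, hc, cg, ce', us, uu, ug, ub, c1⟩ := T2u hg he.compl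
  have ce : c * e = e * c := by
    rw [mul_sub, sub_mul] at ce'; simpa using ce'
  have tu : t * u = u * t := ub t (by
    have : g + (1 - e) - 1 = g - e := by abel
    rw [this, mul_sub, sub_mul, tg, te, gt, et])
  have tc : t * c = c * t := by rw [← uu, ← ma, tu, ma, tu, ma]
  have cf : c * f = f * c := by
    have : f = t - e := by rw [htd]; simp
    rw [this, mul_sub, sub_mul, tc, ce]
  have ck : c * k = k * c := by
    have : k = t - g := by rw [e1]; simp
    rw [this, mul_sub, sub_mul, tc, cg]
  have gu : g * u = u * (1 - e) := by
    have := congrArg star ug; simpa [us, he.1, hg.1] using this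
  have ugu : u * g * u = f * c := by
    have a1 : u * g * u = t * (u * g * u) := by rw [← ma, ← ma, tu, ma u t, tg]
    rw [a1, ug, ma, uu, ← ma, mul_sub, te, mul_one, htd]; simp
  have A : Ev (g * c) (f * c) := by
    refine ⟨u * g, ?_, ?_⟩
    · rw [star_mul, us, hg.1, ma, ← ma u, uu, cg, ← ma, hg.2]
    · rw [star_mul, us, hg.1, ma, ← ma g, hg.2, ← ma, ugu]
  have B : Ev (k * c) (e * c) := by
    refine ⟨u * k, ?_, ?_⟩
    · rw [star_mul, us, hk.1, ma, ← ma u, uu, ck, ← ma, hk.2]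
    · rw [star_mul, us, hk.1, ma, ← ma k, hk.2, ← ma]
      have : k = t - g := by rw [e1]; simp
      rw [this, mul_sub, sub_mul, ugu, ← tu, ma, uu, htd, add_mul]; simp
  have C : g * (1 - c) = e * (1 - c) := by rw [c1]; simp
  have D : k * (1 - c) = f * (1 - c) := by
    have h1 : k = t - g := by rw [e1]; simp
    have h2 : f = t - e := by rw [htd]; simp
    rw [h1, h2, sub_mul, sub_mul, C]
  have cm1 : ∀ x, c * x = x * c → x * (1 - c) = (1 - c) * x := fun x hx => by rw [mul_sub, sub_mul, hx]; simp
  have pec := he.mul hc.compl (cm1 e ce)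
  have pfc := hf.mul hc.compl (cm1 f cf)
  obtain ⟨z, hz, s1, s2⟩ := GC pec pfc
  have sp : ∀ x, x = x * c + x * (1 - c) := fun x => by rw [mul_sub]; simp
  have oc : ∀ x y, c * y = y * c → (x * c) * (y * (1 - c)) = 0 := fun x y hy => by
    rw [ma, ← ma c, hy, ma, mul_sub, hc.2]; simp
  have r1 : z * t = 0 := by
    apply h.z ht hg hf hz v1 _ h2
    rw [sp g, sp f, mul_add, mul_add, C]
    exact Sb.add (hz.pmul (hg.mul hc cg.symm)) (hz.pmul pec) (hz.pmul (hf.mul hc cf.symm)) (hz.pmul pfc) ((A.zmul hz).sb (hz.pmul (hg.mul hc cg.symm)))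
      s1 (hz.ort (by rw [← C]; exact oc g g cg)) (hz.ort (oc f f cf))
  have r2 : (1 - z) * t = 0 := by
    have hz := hz.compl
    apply h.z ht hk he hz v2 _ h1
    rw [sp k, sp e, mul_add, mul_add, D]
    exact Sb.add (hz.pmul (hk.mul hc ck.symm)) (hz.pmul pfc) (hz.pmul (he.mul hc ce.symm)) (hz.pmul pec) ((B.zmul hz).sb (hz.pmul (hk.mul hc ck.symm)))
      s2 (hz.ort (by rw [← D]; exact oc k k ck)) (hz.ort (oc e e ce))
  rw [hz.split t, r1, r2, add_zero]
theorem FnS {e f : R} (he : Pj e) (hf : Pj f) (ho : e * f = 0) (h1 : Fn e) (h2 : Fn f) : Fn (e + f) := by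
  obtain ⟨z, hz, F, P⟩ := fpi (he.add hf ho)
  have hz' := hz.compl
  have := FnS0 (hz'.pmul he) (hz'.pmul hf) (hz'.ort ho) (h1.zmul he hz') (h2.zmul hf hz') (by rw [← mul_add]; exact P)
  rw [← mul_add] at this
  rw [hz.split (e + f), this, add_zero]; exact F
end AW
namespace AW
variable {R : Type u} [CStarAlgebra R] [AWStar R] {m : Type} [Fintype m] [DecidableEq m]
def ip (x y : m → R) : R := ∑ k, star (x k) * y k
def sm (x : m → R) (r : R) : m → R := fun k => x k * r
theorem ip_sm (x y : m → R) (r : R) : ip x (sm y r) = ip x y * r := by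
  simp only [ip, sm, Finset.sum_mul, ma]
theorem sm_ip (x y : m → R) (r : R) : ip (sm x r) y = star r * ip x y := by
  simp only [ip, sm, Finset.mul_sum, star_mul, ma]
theorem star_ip (x y : m → R) : star (ip x y) = ip y x := by
  simp [ip, star_sum]
theorem ip_add (x y z : m → R) : ip x (y + z) = ip x y + ip x z := by
  simp [ip, mul_add, Finset.sum_add_distrib]
theorem ip_sub (x y z : m → R) : ip x (y - z) = ip x y - ip x z := by
  simp [ip, mul_sub, Finset.sum_sub_distrib]
theorem ip_zero (x : m → R) : ip x 0 = 0 := by simp [ip]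
theorem ip_self {x : m → R} (h : ip x x = 0) : x = 0 := funext (sumsq0 h)
theorem ip_fl0 {x y : m → R} (h : ip x y = 0) : ip y x = 0 := by rw [← star_ip, h, star_zero]
theorem sm_sm (x : m → R) (r s : R) : sm (sm x r) s = sm x (r * s) := by funext k; simp [sm, ma]
theorem sm_one (x : m → R) : sm x 1 = x := by funext k; simp [sm]
theorem sm_zero (x : m → R) : sm x 0 = 0 := by funext k; simp [sm]
theorem zero_sm (r : R) : sm (0 : m → R) r = 0 := by funext k; simp [sm]
theorem sm_sub (x : m → R) (r s : R) : sm x (r - s) = sm x r - sm x s := by funext k; simp [sm, mul_sub]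
theorem ip_self_sm {w : m → R} {r : R} (h : ip w w * r = 0) : sm w r = 0 :=
  ip_self (by rw [ip_sm, sm_ip, ma, h, mul_zero])
theorem ip_pi {w : m → R} (h : Pj (ip w w)) : sm w (ip w w) = w := by
  have : sm w (1 - ip w w) = 0 := ip_self_sm (by rw [mul_sub, h.2]; simp)
  rw [sm_sub, sm_one, sub_eq_zero] at this; exact this.symm
theorem ip_pi' {w : m → R} {q : R} (h : Pj q) (e : ip w w = q) : sm w q = w := by subst e; exact ip_pi h
theorem ip_norm {w : m → R} (h : Pj (ip w w)) (k : m) : ‖w k‖ ≤ 1 := by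
  letI := CStarAlgebra.spectralOrder R
  letI := CStarAlgebra.spectralOrderedRing R
  have h1 : star (w k) * w k ≤ ip w w := Finset.single_le_sum (f := fun k => star (w k) * w k) (fun k _ => star_mul_self_nonneg _) (Finset.mem_univ k)
  have h2 := CStarAlgebra.norm_le_norm_of_nonneg_of_le (star_mul_self_nonneg (w k)) h1
  have h3 := CStarRing.norm_star_mul_self (x := w k)
  have := h.norm_le
  nlinarith [norm_nonneg (w k)]
def Cl (K : Set (m → R)) : Prop := ∃ S : Set (m → R), ∀ x, x ∈ K ↔ ∀ s ∈ S, ip s x = 0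
theorem Cl.sm {K : Set (m → R)} (h : Cl K) {x : m → R} (hx : x ∈ K) (r : R) : sm x r ∈ K := by
  obtain ⟨S, hS⟩ := h
  exact (hS _).2 (fun s hs => by rw [ip_sm, (hS x).1 hx s hs, zero_mul])
theorem Cl.sub {K : Set (m → R)} (h : Cl K) {x y : m → R} (hx : x ∈ K) (hy : y ∈ K) : x - y ∈ K := by
  obtain ⟨S, hS⟩ := h
  exact (hS _).2 (fun s hs => by rw [ip_sub, (hS x).1 hx s hs, (hS y).1 hy s hs, sub_zero])
theorem Cl.add {K : Set (m → R)} (h : Cl K) {x y : m → R} (hx : x ∈ K) (hy : y ∈ K) : x + y ∈ K := by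
  obtain ⟨S, hS⟩ := h
  exact (hS _).2 (fun s hs => by rw [ip_add, (hS x).1 hx s hs, (hS y).1 hy s hs, add_zero])
theorem Cl.zero {K : Set (m → R)} (h : Cl K) : (0 : m → R) ∈ K := by
  obtain ⟨S, hS⟩ := h
  exact (hS _).2 (fun s hs => ip_zero s)
theorem Cl.inter {K : Set (m → R)} (h : Cl K) (T : Set (m → R)) : Cl {x | x ∈ K ∧ ∀ t ∈ T, ip t x = 0} := by
  obtain ⟨S, hS⟩ := h
  refine ⟨S ∪ T, fun x => ?_⟩
  simp only [Set.mem_setOf_eq, hS, Set.mem_union]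
  exact ⟨fun h s hs => hs.elim (h.1 s) (h.2 s), fun h => ⟨fun s hs => h s (.inl hs), fun s hs => h s (.inr hs)⟩⟩
def Cp (K : Set (m → R)) : Prop := ∃ P : m → m → R, (∀ k l, star (P k l) = P l k) ∧ (∀ l, P l ∈ K) ∧
  ∀ x ∈ K, ∀ l, ip (P l) x = x l
theorem Cp.add {N : Set (m → R)} (hN : Cl N) (a : m → R) (h1 : Cp {x | x ∈ N ∧ ∀ t ∈ ({a} : Set (m → R)), ip t x = 0})
    (h2 : ∀ K : Set (m → R), Cl K → (∀ x ∈ K, ip a x = 0 → x = 0) → K ⊆ N → Cp K) : Cp N := by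
  obtain ⟨P, p1, p2, p3⟩ := h1
  have hK := hN.inter (Set.range P)
  set K := {x | x ∈ N ∧ ∀ t ∈ Set.range P, ip t x = 0} with hKd
  obtain ⟨Q, q1, q2, q3⟩ := h2 K hK (fun x hx h0 => by
    have := p3 x ⟨hx.1, by simpa using h0⟩
    funext l; rw [← this l]; exact hx.2 _ ⟨l, rfl⟩) (fun x hx => hx.1)
  have PQ : ∀ l j, ip (P l) (Q j) = 0 := fun l j => (q2 j).2 _ ⟨l, rfl⟩
  refine ⟨fun l => P l + Q l, fun k l => by simp [p1, q1], fun l => hN.add (p2 l).1 (q2 l).1, fun x hx l => ?_⟩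
  let y : m → R := fun l => ip (P l) x
  have ipy : ∀ w, ip w y = ∑ j, ip w (P j) * x j := fun w => by
    simp only [ip, y, Finset.mul_sum, Finset.sum_mul]
    rw [Finset.sum_comm]
    refine Finset.sum_congr rfl (fun i _ => Finset.sum_congr rfl (fun j _ => ?_))
    rw [p1, ma]
  have yN : y ∈ N := by
    obtain ⟨S, hS⟩ := hN
    refine (hS y).2 (fun s hs => ?_)
    rw [ipy]; exact Finset.sum_eq_zero (fun j _ => by rw [(hS _).1 (p2 j).1 s hs, zero_mul])
  have yK : x - y ∈ K := by
    refine ⟨hN.sub hx yN, ?_⟩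
    rintro _ ⟨l, rfl⟩
    rw [ip_sub, ipy, sub_eq_zero]
    simp only [ip]
    refine Finset.sum_congr rfl (fun j _ => ?_)
    have := p3 _ (p2 j) l
    rw [ip] at this; rw [this, p1]
  have e1 := q3 _ yK l
  have e2 : ip (Q l) y = 0 := by
    rw [ipy]; exact Finset.sum_eq_zero (fun j _ => by rw [ip_fl0 (PQ j l), zero_mul])
  rw [ip_sub, e2, sub_zero] at e1
  have : ip (P l + Q l) x = ip (P l) x + ip (Q l) x := by
    rw [← star_ip, ip_add, star_add, star_ip, star_ip]
  rw [this, e1]; simp [y]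
theorem Cp.W {K : Set (m → R)} (hK : Cl K) {W : m → R} (hW : W ∈ K) (h : ∀ x ∈ K, sm W (ip W x) = x) : Cp K :=
  ⟨fun l k => W k * star (W l), fun k l => by simp, fun l => hK.sm hW _, fun x hx l => by
    have := congrFun (h x hx) l
    simp only [sm] at this
    conv_rhs => rw [← this]
    simp only [ip, star_mul, star_star, Finset.mul_sum, ma]⟩
theorem annP (S : Set R) : ∃ p : R, Pj p ∧ ∀ a : R, (∀ s ∈ S, s * a = 0) ↔ p * a = a := by
  obtain ⟨p, hp, h⟩ := AWStar.ann (R := R) S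
  refine ⟨p, hp, fun a => ?_⟩
  have := Set.ext_iff.1 h a
  simp only [Set.mem_setOf_eq] at this
  rw [this]
  exact ⟨fun ⟨b, hb⟩ => by rw [hb, ← ma, hp.2], fun h => ⟨a, h.symm⟩⟩
theorem Cp.tr {K : Set (m → R)} (hK : Cl K) {U : m → R} (ho : ∀ k l, k ≠ l → star (U k) * U l = 0)
    (h : ∀ x ∈ K, ∀ k, star (U k) * U k * x k = x k) : Cp K := by
  obtain ⟨S, hS⟩ := hK
  obtain ⟨p, hp, ha⟩ := annP (insert (1 - ∑ k, U k * star (U k)) ((fun s : m → R => ∑ k, star (s k) * star (U k)) '' S))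
  have mem : ∀ y : R, p * y = y → (fun k => star (U k) * y) ∈ K := fun y hy => by
    refine (hS _).2 (fun s hs => ?_)
    have := (ha y).2 hy _ (.inr ⟨s, hs, rfl⟩)
    simpa [ip, Finset.sum_mul, ma] using this
  have sU : ∀ (x : m → R) k, star (U k) * ∑ l, U l * x l = star (U k) * U k * x k := fun x k => by
    rw [Finset.mul_sum, Finset.sum_eq_single k]
    · rw [ma]
    · intro l _ hl; rw [← ma, ho k l (Ne.symm hl), zero_mul]
    · simp
  have fx : ∀ x ∈ K, p * (∑ k, U k * x k) = ∑ k, U k * x k := fun x hx => by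
    refine (ha _).1 ?_
    rintro _ (rfl | ⟨s, hs, rfl⟩)
    · rw [sub_mul, one_mul, Finset.sum_mul, sub_eq_zero]
      refine Finset.sum_congr rfl (fun k _ => ?_)
      rw [ma, sU, h x hx]
    · have := (hS x).1 hx s hs
      simp only [Finset.sum_mul]
      rw [← this, ip]
      refine Finset.sum_congr rfl (fun k _ => ?_)
      rw [ma, sU, h x hx]
  refine ⟨fun l k => star (U k) * (p * U l), fun k l => by simp [hp.1, ma], fun l => mem _ (by rw [← ma, hp.2]), fun x hx l => ?_⟩
  simp only [ip, star_mul, star_star, hp.1]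
  have := congrArg (fun y => star (U l) * y) (fx x hx)
  simp only [sU, h x hx] at this
  rw [← this]
  simp only [Finset.mul_sum, ma]
theorem Cp.abel {K : Set (m → R)} (hK : Cl K) {g : R} {i0 : m} (hg : Pj g) (ab : PAb g) (hi : ∀ x ∈ K, g * x i0 = 0 → x = 0) : Cp K := by
  obtain ⟨S, h1, h2, h3⟩ := exh (fun c => ∃ w ∈ K, Pj (ip w w) ∧ sm w c = w ∧ ∀ x ∈ K, ∃ r, sm x c = sm w r) cn_one (fun y hy _ y0 => by
    by_cases hx : ∀ x ∈ K, sm x y = 0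
    · refine ⟨y, hy, hy.pj.2, y0, 0, hK.zero, by rw [ip_zero]; exact pj_zero, zero_sm _, fun x h => ⟨0, by rw [hx x h, sm_zero]⟩⟩
    push Not at hx
    obtain ⟨x, xK, x0⟩ := hx
    have xK := hK.sm xK y
    have xy : sm (sm x y) y = sm x y := by rw [sm_sm, hy.pj.2]
    generalize sm x y = x at *
    have f0 : star (g * x i0) ≠ 0 := fun h => x0 (hi x xK (star_eq_zero.1 h))
    obtain ⟨e, _, _, he, e0, -, -, -, k, hk⟩ := T1x f0
    rw [star_star] at hk
    have ge : g * e = e := by rw [hk, ← ma, ← ma, hg.2]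
    have ec := ab.eq he ge
    have hc := cn_cc e
    set c := cc e with hcd
    have vK := hK.sm xK (k * e)
    have ve : sm (sm x (k * e)) e = sm x (k * e) := by rw [sm_sm, ma, he.2]
    have vy : sm (sm x (k * e)) y = sm x (k * e) := by
      conv_rhs => rw [← xy]
      rw [sm_sm, sm_sm, hy.cm]
    have fv : g * (sm x (k * e)) i0 = e := by simp only [sm]; rw [← ma, ← ma, ← hk, he.2]
    generalize sm x (k * e) = v at *
    have v1 : ∀ x ∈ K, sm x c = sm v (g * x i0) := fun x hx => by
      have := hi _ (hK.sub (hK.sm hx c) (hK.sm vK (g * x i0))) (by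
        simp only [Pi.sub_apply, sm, mul_sub]
        rw [← ma g (v i0), fv, ← ec, ← hc.cm, ← ma g c, ← hc.cm, ma c g (g * _), ← ma g g, hg.2, ma, sub_self])
      exact sub_eq_zero.1 this
    have v0 : ∃ k, v k ≠ 0 := by
      by_contra hn; push Not at hn
      exact e0 (by rw [← fv, hn]; simp)
    obtain ⟨e', b, he', e0', bs, b1, b2, b3, b4, -, bc⟩ := T1s v0
    change b * ip v v * b = e' at b1
    change ip v v * b * b = e' at b2
    replace bc : ∀ a : R, a * ip v v = ip v v * a → a * b = b * a := bc
    have ee' : e * e' = e' := by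
      have : e * ip v v = ip v v := by
        conv_lhs => rw [← star_ip, ← he.1, ← star_mul, ← ip_sm, ve, star_ip]
      rw [← b2, ← ma, ← ma, this]
    have ge' := lt ge ee'
    have ec' := ab.eq he' ge'
    have hc' := cn_cc e'
    have cc' : c * cc e' = cc e' := cc_le hc (by rw [← ee', ← ma, cc_mul])
    have hh : ip v v * b = b * ip v v := bc _ rfl
    have ww : ip (sm v b) (sm v b) = e' := by rw [ip_sm, sm_ip, bs, b1]
    have ve' : sm v e' = sm (sm v b) (b * ip v v) := by
      rw [sm_sm, ← b2, hh, ma, hh]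
    refine ⟨cc e', hc', ?_, fun h => e0' (by rw [← cc_mul e', h, zero_mul]), sm v b, hK.sm vK b, ww ▸ he', ?_, fun x hx => ⟨(b * ip v v) * (g * x i0), ?_⟩⟩
    · apply cc_le hy
      have : ip (sm v b) (sm v b) * y = e' := by
        rw [← ip_sm, sm_sm, ← hy.cm, ← sm_sm, vy, ww]
      rw [hy.cm, ← ww, this, ww]
    · have : b * cc e' = b := by
        conv_lhs => rw [← b3, ma, ← hc'.cm, cc_mul, b3]
      rw [sm_sm, this]
    · have q : e' * (g * x i0) = (g * x i0) * cc e' := by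
        calc e' * (g * x i0) = cc e' * g * (g * x i0) := by rw [ec']
          _ = (g * x i0) * cc e' := by rw [ma, ← ma g g, hg.2, hc'.cm]
      rw [← sm_sm, ← ve', sm_sm, q, ← sm_sm, ← v1 x hx, sm_sm, cc'])
  have hz : ∀ s : S, Cn s.1 := fun s => (h1 s s.2).1
  choose w wK wp wc wr using fun s : S => (h1 s s.2).2.2.2
  have wck : ∀ s k, s.1 * w s k = w s k := fun s k => by
    have := congrFun (wc s) k; rw [(hz s).cm]; exact this
  choose W W1 W2 using fun k => CG hz h2 (fun s => wck s k) (fun s => ip_norm (wp s) k)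
  have ipW : ∀ (s : S) x, s.1 * ip x W = ip x (w s) := fun s x => by
    rw [(hz s).cm, ← ip_sm]; congr 1; funext k; simp only [sm]; rw [← (hz s).cm, W1]
  have Wip : ∀ (s : S) x, ip W (sm x s.1) = ip (w s) x := fun s x => by
    rw [ip_sm, ← star_ip, ← star_ip x, ← ipW, star_mul, (hz s).pj.1]
  have WK : W ∈ K := by
    obtain ⟨T, hT⟩ := hK
    refine (hT _).2 (fun t ht => ?_)
    have := fsup_eqz hz (a := ip t W) (b := 0) (fun s => by rw [ipW, (hT _).1 (wK s) t ht, mul_zero])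
    rwa [h3, one_mul, mul_zero] at this
  refine Cp.W hK WK (fun x hx => ?_)
  funext k
  have := fsup_eqz hz (a := (sm W (ip W x)) k) (b := x k) (fun s => by
    obtain ⟨r, hr⟩ := wr s x hx
    have h5 : sm (w s) (ip (w s) x) = sm x s.1 := by
      have : ip (w s) (sm x s.1) = ip (w s) x := by
        rw [ip_sm]; conv_rhs => rw [← wc s, sm_ip, (hz s).pj.1, (hz s).cm]
      rw [← this, hr, ip_sm, ← sm_sm, ip_pi (wp s)]
    have h6 := congrFun h5 k
    simp only [sm] at h6 ⊢
    rw [(hz s).cm (x k), ← h6, ← Wip, ip_sm, ← ma, W1, ← (hz s).cm (ip W x), ← ma, ← (hz s).cm, wck])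
  rwa [h3, one_mul, one_mul] at this
end AW
namespace AW
variable {R : Type u} [CStarAlgebra R] [AWStar R] {m : Type} [Fintype m] [DecidableEq m]
theorem RangeSb {ι : Type*} {q x : ι → R} {g : R} (hq : Orth q) (hx : ∀ i, x i * q i = x i) (hg : Pj g) (h : Fn g)
    (gq : ∀ i, g * q i = q i) : Sb (psup (Set.range x)) g := by
  classical
  let r : ι → ι → Prop := WellOrderingRel
  have wf : WellFounded r := WellOrderingRel.isWellOrder.wf
  let s : ι → R := fun i => psup {y | ∃ j, r j i ∧ y = x j}
  have ps : ∀ i, Pj (s i) := fun i => pj_psup _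
  let y : ι → R := fun i => (1 - s i) * x i
  have yq : ∀ i, q i * star (y i) = star (y i) := fun i => by
    have : y i * q i = y i := by simp only [y]; rw [ma, hx]
    conv_rhs => rw [← this, star_mul, (hq.pj i).1]
  have cq : ∀ i, q i * LP (star (y i)) = LP (star (y i)) := fun i => LP_le (yq i)
  have ho : Orth (fun i => LP (star (y i))) := ⟨fun i => LP_pj _, fun i j hij => ol (hq.pj i) (LP_pj _) (hq.or i j hij) (cq i) (cq j)⟩
  have sy : ∀ i, s i * LP (y i) = 0 := fun i => LP_ann (by
    simp only [y]; rw [← ma, mul_sub, (ps i).2]; simp)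
  have sy' : ∀ i j, r j i → s i * LP (y j) = LP (y j) := fun i j hij => LP_le (by
    have h1 : s i * x j = x j := psup_mul ⟨j, hij, rfl⟩
    have h2 : s i * s j = s j := psup_le (by
      rintro _ ⟨k, hk, rfl⟩; exact psup_mul ⟨k, _root_.trans hk hij, rfl⟩)
    simp only [y]; rw [sub_mul, one_mul, mul_sub, h1, ← ma, h2])
  have o1 : ∀ i j, r j i → LP (y j) * LP (y i) = 0 := fun i j hij => by
    have := sy' i j hij
    rw [← (LP_pj _).fl (ps i) this, ma, sy, mul_zero]
  have hd : Orth (fun i => LP (y i)) := ⟨fun i => LP_pj _, fun i j hij => by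
    rcases trichotomous_of r i j with h | h | h
    · exact o1 _ _ h
    · exact absurd h hij
    · exact (LP_pj _).fl0 (LP_pj _) (o1 _ _ h)⟩
  have gc : ∀ i, g * LP (star (y i)) = LP (star (y i)) := fun i => lt (gq i) (cq i)
  have gF : g * fsup (fun i => LP (star (y i))) = fsup (fun i => LP (star (y i))) := fsup_le gc
  have F1 := h.le hg (fsup_pj _) gF
  have ev := Add ho hd (fun i => LPRP (h.le hg (LP_pj _) (gc i))) F1
  have D : ∀ i, (1 - fsup (fun i => LP (y i))) * x i = 0 := fun i => by
    induction i using wf.induction with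
    | _ i ih =>
    have h1 : (1 - fsup (fun i => LP (y i))) * s i = 0 := psup_ann (by
      rintro _ ⟨j, hj, rfl⟩; exact ih j hj)
    have lm : ∀ D t : R, D * LP t = LP t → (1 - D) * t = 0 := fun D t h => by
      rw [sub_mul, one_mul]; nth_rw 2 [← LP_mul t]; rw [← ma, h, LP_mul, sub_self]
    have h2 : (1 - fsup (fun i => LP (y i))) * y i = 0 := lm _ _ (fsup_mul (fun i => LP (y i)) i)
    have : x i = s i * x i + y i := by simp only [y]; rw [sub_mul, one_mul]; abel
    rw [this, mul_add, ← ma, h1, h2]; simp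
  refine (((ev.symm.sb (fsup_pj _)).le gF).sub (pj_psup _) (psup_le ?_))
  rintro _ ⟨i, rfl⟩
  have := D i
  rw [sub_mul, one_mul, sub_eq_zero] at this; exact this.symm
theorem famP {ι : Type*} {w : ι → m → R} {g : R} {u : m → R} (hg : Pj g) (hF : Fn g) (hu : ∀ k, star (u k) * u k = g)
    (ho : ∀ k l, k ≠ l → star (u k) * u l = 0) (hq : Orth (fun i => ip (w i) (w i))) (gq : ∀ i, g * ip (w i) (w i) = ip (w i) (w i))
    (hw : ∀ i j, i ≠ j → ip (w i) (w j) = 0) :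
    ∃ (V : m → R) (P : m → m → R), ip V V = fsup (fun i => ip (w i) (w i)) ∧ (∀ s, (∀ i, ip s (w i) = 0) → ip s V = 0) ∧
      (∀ k l, star (P k l) = P l k) ∧ (∀ s, (∀ i, ip s (w i) = 0) → ∀ l, ip s (P l) = 0) ∧ ∀ i l, ip (P l) (w i) = w i l := by
  have := fun k => RangeSb (x := fun i => w i k) hq (fun i => congrFun (ip_pi (hq.pj i)) k) hg hF gq
  choose v v1 v2 using this
  let U : m → R := fun k => u k * v k
  have UU : ∀ k, star (U k) * U k = psup (Set.range fun i => w i k) := fun k => by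
    simp only [U, star_mul]
    rw [ma, ← ma (star (u k)), hu, v2, v1]
  have Uo : ∀ k l, k ≠ l → star (U k) * U l = 0 := fun k l h => by
    simp only [U, star_mul]
    rw [ma, ← ma (star (u k)), ho k l h]; simp
  have Uw : ∀ i k, star (U k) * U k * w i k = w i k := fun i k => by rw [UU]; exact psup_mul ⟨i, rfl⟩
  have sU : ∀ i k, star (U k) * ∑ l, U l * w i l = w i k := fun i k => by
    rw [Finset.mul_sum, Finset.sum_eq_single k]
    · rw [← ma, Uw]
    · intro l _ hl; rw [← ma, Uo k l (Ne.symm hl), zero_mul]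
    · simp
  let o : ι → R := fun i => ∑ l, U l * w i l
  have sT : ∀ (s : m → R) i, (∑ k, star (s k) * star (U k)) * o i = ip s (w i) := fun s i => by
    rw [Finset.sum_mul, ip]
    exact Finset.sum_congr rfl (fun k _ => by rw [ma]; simp only [o]; rw [sU])
  have oo : ∀ i j, star (o i) * o j = ip (w i) (w j) := fun i j => by
    rw [← sT (w i) j]
    congr 1
    simp [o, star_sum]
  have fp : ∀ i, Pj (o i * star (o i)) := fun i => pj_final (by rw [oo]; exact hq.pj i)
  have fo : Orth (fun i => o i * star (o i)) := ⟨fp, fun i j hij => by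
    rw [ma, ← ma (star (o i)), oo, hw i j hij]; simp⟩
  have gE : g * fsup (fun i => ip (w i) (w i)) = fsup (fun i => ip (w i) (w i)) := fsup_le gq
  obtain ⟨a, a1, a2⟩ := Add hq fo (fun i => ⟨o i, oo i i, rfl⟩) (hF.le hg (fsup_pj _) gE)
  set Om := fsup (fun i => o i * star (o i)) with hOm
  have Oo : ∀ i, Om * o i = o i := fun i => by
    have := fsup_mul (fun i => o i * star (o i)) i
    have h2 := pi_mul' (fp i) rfl
    rw [← h2, ← ma, this]
  have Oa : Om * a = a := pi_mul' (fsup_pj _) a2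
  have tO : ∀ t : R, (∀ i, t * o i = 0) → t * Om = 0 := fun t h => fsup_ann (fun i => by rw [← ma, h, zero_mul])
  have sO : ∀ s : m → R, (∀ i, ip s (w i) = 0) → (∑ k, star (s k) * star (U k)) * Om = 0 := fun s h =>
    tO _ (fun i => by rw [sT, h])
  have G : (∑ k, U k * star (U k)) * Om = Om := fsup_le (fun i => by
    rw [← ma]; congr 1
    rw [Finset.sum_mul]
    exact Finset.sum_congr rfl (fun k _ => by rw [ma]; simp only [o]; rw [sU]))
  have sy : ∀ (s : m → R) y, ip s (fun k => star (U k) * (Om * y)) = (∑ k, star (s k) * star (U k)) * Om * y := fun s y => by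
    simp only [ip, Finset.sum_mul, ma]
  refine ⟨fun k => star (U k) * (Om * a), fun l k => star (U k) * (Om * U l), ?_, fun s h => ?_, fun k l => ?_, fun s h l => ?_, fun i l => ?_⟩
  · have k1 : (∑ k, star (star (U k) * a) * star (U k)) = star a * (∑ k, U k * star (U k)) := by
      simp [Finset.mul_sum, ma]
    rw [sy, Oa, k1, ma (star a), G, ma, Oa, a1]
  · rw [sy, sO s h, zero_mul]
  · simp [hOm, (fsup_pj _).1, ma]
  · rw [sy, sO s h, zero_mul]
  · have : ip (fun k => star (U k) * (Om * U l)) (w i) = star (U l) * (Om * o i) := by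
      simp only [ip, o, Finset.mul_sum, star_mul, star_star, hOm, (fsup_pj _).1, ma]
    rw [this, Oo]; exact sU i l
end AW
namespace AW
variable {R : Type u} [CStarAlgebra R] [AWStar R] {m : Type} [Fintype m] [DecidableEq m]
theorem nrm {K : Set (m → R)} (hK : Cl K) {g : R} {i0 : m} (hg : Pj g) (hi : ∀ x ∈ K, g * x i0 = 0 → x = 0)
    {x : m → R} (hx : x ∈ K) (x0 : x ≠ 0) : ∃ r, Pj (ip (sm x r) (sm x r)) ∧ ip (sm x r) (sm x r) ≠ 0 ∧
      g * ip (sm x r) (sm x r) = ip (sm x r) (sm x r) := by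
  obtain ⟨e, b, he, e0, bs, b1, b2, b3, b4, -, bc⟩ := T1s (x := x) (by
    by_contra hn; push Not at hn; exact x0 (funext hn))
  change b * ip x x * b = e at b1
  have n0 : g * sm x b i0 * e ≠ 0 := fun h => by
    have : sm x b i0 * e = sm x b i0 := by simp only [sm]; rw [ma, b3]
    rw [ma, this] at h
    have := hi _ (hK.sm hx b) h
    apply e0
    rw [← b1]
    have h2 : ip (sm x b) (sm x b) = b * ip x x * b := by rw [ip_sm, sm_ip, bs]
    rw [← h2, this, ip_zero]
  obtain ⟨v, v0, v1, v2, v3⟩ := corner he hg n0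
  have ve : e * star v = star v := by
    have := pi_mul v1 rfl
    conv_rhs => rw [← this, star_mul, v1.1, ← v2]
    conv_lhs => rw [← this, star_mul, v1.1]
    rw [ma e]
  have k : ip (sm x (b * star v)) (sm x (b * star v)) = v * star v := by
    rw [ip_sm, sm_ip, star_mul, star_star, bs]
    calc v * b * ip x x * (b * star v) = v * ((b * ip x x * b) * star v) := by simp only [ma]
      _ = _ := by rw [b1, ve]
  refine ⟨b * star v, ?_⟩
  rw [k]
  exact ⟨pj_final v1, fun h => v0 (by rw [sq0' h]; simp), by rw [← ma, v3]⟩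
theorem finKey {K : Set (m → R)} (hK : Cl K) {g E : R} {i0 : m} (hg : Pj g) (hF : Fn g) (hi : ∀ x ∈ K, g * x i0 = 0 → x = 0)
    {V : m → R} (hV : V ∈ K) (hE : Pj E) (gE : g * E = E) (VV : ip V V = E) {x : m → R} (hx : x ∈ K) (x0 : x ≠ 0) (xV : ip x V = 0) :
    ∃ r, Pj (ip (sm x r) (sm x r)) ∧ ip (sm x r) (sm x r) ≠ 0 ∧
      g * ip (sm x r) (sm x r) = ip (sm x r) (sm x r) ∧ E * ip (sm x r) (sm x r) = 0 := by
  obtain ⟨r, q1, q2, q3⟩ := nrm hK hg hi hx x0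
  by_contra hcon
  have con : ∀ d, Pj d → ip (sm x r) (sm x r) * d = d → Sb d (g - E) → d = 0 := fun d hd dl ⟨v, v1, v2⟩ => by
    by_contra d0
    refine hcon ⟨r * star v, ?_⟩
    have vd := pi_mul hd v1
    have : ip (sm x (r * star v)) (sm x (r * star v)) = v * star v := by
      rw [← sm_sm, ip_sm, sm_ip, star_star, ma]
      conv_lhs => rw [← vd, star_mul, hd.1]
      rw [← ma (ip _ _), dl, ← ma, vd, vd]
    rw [this]
    have gv : (g - E) * (v * star v) = v * star v := by rw [← ma, v2]
    refine ⟨pj_final (v1 ▸ hd), fun h => d0 (by rw [← v1, sq0' h]; simp), ?_, ?_⟩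
    · rw [← gv, ← ma, mul_sub, hg.2, gE]
    · rw [← gv, ← ma, mul_sub, hE.2, hE.fl hg gE, sub_self, zero_mul]
  have hx := hK.sm hx r
  replace xV : ip (sm x r) V = 0 := by rw [sm_ip, xV, mul_zero]
  generalize sm x r = x at *
  set q := ip x x with hq
  have xq : sm x q = x := ip_pi q1
  have hgE := hE.sub hg gE
  obtain ⟨z, hz, z1, z2⟩ := GC q1 hgE
  have zq : z * q = 0 := con _ (hz.pmul q1) (hz.le_mul q1) (z1.le (hz.le_mul hgE))
  have yE : (1 - z) * (g - E) = 0 := by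
    obtain ⟨d, hd, dl, ev⟩ := z2.ex (hz.compl.pmul hgE)
    have := con d hd (lt (hz.compl.le_mul q1) dl) ((ev.symm.sb hd).le (hz.compl.le_mul hgE))
    exact (this ▸ ev).zero
  have hy := hz.compl
  have yq : (1 - z) * q = q := by rw [sub_mul, zq]; simp
  generalize 1 - z = y at *
  have ygE : y * g = y * E := by rw [mul_sub, sub_eq_zero] at yE; exact yE
  have hV' := hK.sm hV y
  have VV' : ip (sm V y) (sm V y) = y * g := by rw [ip_sm, sm_ip, VV, hy.pj.1, ← hy.cm, ← ma, hy.pj.2, ygE]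
  replace xV : ip x (sm V y) = 0 := by rw [ip_sm, xV, zero_mul]
  generalize sm V y = V' at *
  have ht : Pj (y * g) := hy.pmul hg
  have hFt : Fn (y * g) := hF.zmul hg hy
  have gt : g * (y * g) = y * g := hy.le_mul hg
  have Vt : sm V' (y * g) = V' := ip_pi' ht VV'
  set t := y * g with htd
  set a := g * V' i0 with had
  have at' : a * t = a := by rw [had, ma]; congr 1; exact congrFun Vt i0
  have ta : t * a = a := by
    have ga : g * a = a := by rw [had, ← ma, hg.2]
    rw [htd, ma, ga, hy.cm]; conv_lhs => rw [← at', ma, ← hy.cm, htd, ← ma y y, hy.pj.2]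
    exact at'
  have ts : t * star a = star a := by conv_rhs => rw [← at', star_mul, ht.1]
  have tl := LP_le ts
  have LPs : LP (star a) = t := by
    have ap : a * (t - LP (star a)) = 0 := by
      rw [mul_sub, at']
      have := congrArg star (LP_mul (star a))
      rw [star_mul, star_star, (LP_pj _).1] at this
      rw [this, sub_self]
    have := hi _ (hK.sm hV' (t - LP (star a))) (by simp only [sm]; rw [← ma]; exact ap)
    have h2 : ip V' (sm V' (t - LP (star a))) = 0 := by rw [this, ip_zero]
    rw [ip_sm, VV', mul_sub, ht.2, tl, sub_eq_zero] at h2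
    exact h2.symm
  have LPa : LP a = t := hFt.eq ht (LP_le ta) (LP_pj _) (by
    have := LPRP (x := a) (by rw [LPs]; exact hFt)
    rw [LPs] at this; exact this.sb ht)
  obtain ⟨En, b, hEn, hm, -, -, h5, -, -, h8⟩ := SP (star a)
  rw [star_star] at h8
  simp only [star_star] at h5
  refine q2 (KC hFt ht q1 hEn hm (h8.trans LPa) (fun n => ?_))
  have tE : t * En n = En n := by rw [← LPa, ← h8, fsup_mul En n]
  have Er : En n = a * (star a * b n * b n) := by rw [← h5 n]; simp only [ma]
  generalize star a * b n * b n = r at Er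
  set c := g * x i0 with hc
  have cq : c * q = c := by rw [hc, ma]; congr 1; exact congrFun xq i0
  have tc : t * c = c := by
    have gc : g * c = c := by rw [hc, ← ma, hg.2]
    rw [htd, ma, gc, hy.cm]; conv_lhs => rw [← cq, ma, ← hy.cm, yq]
    exact cq
  have Xe : (t - En n) * c = g * (x - sm V' (r * c)) i0 := by
    simp only [Pi.sub_apply, sm, mul_sub, sub_mul]
    rw [tc, Er, ← hc, ← ma g, ← had, ma]
  set X := (t - En n) * c with hX
  have Xq : X * q = X := by rw [hX, ma, cq]
  have qX : q * star X = star X := by conv_rhs => rw [← Xq, star_mul, q1.1]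
  have ql := LP_le qX
  have LX : LP (star X) = q := by
    have ap : X * (q - LP (star X)) = 0 := by
      rw [mul_sub, Xq]
      have := congrArg star (LP_mul (star X))
      rw [star_mul, star_star, (LP_pj _).1] at this
      rw [this, sub_self]
    have := hi _ (hK.sm (hK.sub hx (hK.sm hV' (r * c))) (q - LP (star X))) (by
      simp only [sm]; rw [← ma, ← Xe]; exact ap)
    have h2 : ip x (sm (x - sm V' (r * c)) (q - LP (star X))) = 0 := by rw [this, ip_zero]
    rw [ip_sm, ip_sub, ip_sm, xV, zero_mul, sub_zero, ← hq, mul_sub, q1.2, ql, sub_eq_zero] at h2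
    exact h2.symm
  have ev := LPRP (x := X) (by rw [LX]; exact hF.le hg q1 q3)
  rw [LX] at ev
  refine (ev.sb q1).le (LP_le ?_)
  rw [hX, ← ma, ((hEn n).sub ht tE).2]
theorem Cp.fin {K : Set (m → R)} (hK : Cl K) {g : R} {i0 : m} {u : m → R} (hg : Pj g) (hF : Fn g) (hu : ∀ k, star (u k) * u k = g)
    (ho : ∀ k l, k ≠ l → star (u k) * u l = 0) (hi : ∀ x ∈ K, g * x i0 = 0 → x = 0) : Cp K := by
  obtain ⟨S, s1, s2, s3⟩ := zorn_pw (fun w : m → R => w ∈ K ∧ Pj (ip w w) ∧ ip w w ≠ 0 ∧ g * ip w w = ip w w)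
    (fun w w' => ip w w' = 0 ∧ ip w w * ip w' w' = 0 ∧ ip w' w' * ip w w = 0) (fun a b h => ⟨ip_fl0 h.1, h.2.2, h.2.1⟩)
  have hq : Orth (fun i : S => ip i.1 i.1) := ⟨fun i => (s1 i i.2).2.1, fun i j hij => (s2 i.2 j.2 (fun h => hij (Subtype.ext h))).2.1⟩
  obtain ⟨V, P, p1, p2, p3, p4, p5⟩ := famP (w := fun i : S => i.1) hg hF hu ho hq (fun i => (s1 i i.2).2.2.2)
    (fun i j hij => (s2 i.2 j.2 (fun h => hij (Subtype.ext h))).1)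
  set E := fsup (fun i : S => ip i.1 i.1) with hE
  have dK : ∀ y, (∀ s, (∀ i : S, ip s i.1 = 0) → ip s y = 0) → y ∈ K := fun y h => by
    obtain ⟨T, hT⟩ := hK
    exact (hT y).2 (fun s hs => h s (fun i => (hT _).1 (s1 i i.2).1 s hs))
  have Kz : ∀ x ∈ K, (∀ i : S, ip x i.1 = 0) → x = 0 := fun x hx h => by
    by_contra x0
    obtain ⟨r, r1, r2, r3, r4⟩ := finKey hK hg hF hi (dK V p2) (fsup_pj _) (fsup_le (fun i : S => (s1 i i.2).2.2.2)) p1 hx x0 (p2 x h)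
    have k1 : ∀ s ∈ S, ip s s * ip (sm x r) (sm x r) = 0 := fun s hs => by
      rw [← mul_fsup (e := fun i : S => ip i.1 i.1) hq.pj ⟨s, hs⟩, ma, ← hE, r4, mul_zero]
    have k2 : ∀ s ∈ S, ip (sm x r) s = 0 := fun s hs => by rw [sm_ip, h ⟨s, hs⟩, mul_zero]
    have mem := s3 (sm x r) ⟨hK.sm hx r, r1, r2, r3⟩ (fun s hs => ⟨k2 s hs, r1.fl0 (s1 s hs).2.1 |> fun _ => (s1 s hs).2.1.fl0 r1 (k1 s hs), k1 s hs⟩)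
    exact r2 (k2 _ mem)
  refine ⟨P, p3, fun l => dK _ (fun s h => p4 s h l), fun x hx l => ?_⟩
  let y : m → R := fun l => ip (P l) x
  have ipy : ∀ w, ip w y = ∑ j, ip w (P j) * x j := fun w => by
    simp only [ip, y, Finset.mul_sum, Finset.sum_mul]
    rw [Finset.sum_comm]
    refine Finset.sum_congr rfl (fun i _ => Finset.sum_congr rfl (fun j _ => ?_))
    rw [p3, ma]
  have yK : y ∈ K := dK _ (fun s h => by rw [ipy]; exact Finset.sum_eq_zero (fun j _ => by rw [p4 s h j, zero_mul]))
  have := Kz (x - y) (hK.sub hx yK) (fun i => by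
    apply ip_fl0
    rw [ip_sub, ipy, sub_eq_zero]
    simp only [ip]
    refine Finset.sum_congr rfl (fun j _ => ?_)
    have := p5 i j
    change star (i.1 j) * _ = ip i.1 (P j) * _
    rw [← star_ip, this])
  exact (congrFun (sub_eq_zero.1 this) l).symm
theorem Cp.pi {K : Set (m → R)} (hK : Cl K) {z : R} {i0 : m} {U : m → R} (hz : Cn z) (hU : ∀ k, star (U k) * U k = z)
    (ho : ∀ k l, k ≠ l → star (U k) * U l = 0) (hi : ∀ x ∈ K, z * x i0 = 0 → x = 0) : Cp K := by
  refine Cp.tr hK ho (fun x hx k => ?_)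
  have := hi _ (hK.sm hx (1 - z)) (by simp only [sm]; rw [hz.cm, ma, sub_mul, one_mul, hz.pj.2, sub_self, mul_zero])
  rw [sm_sub, sm_one, sub_eq_zero] at this
  rw [hU, hz.cm]; exact (congrFun this k).symm
theorem cp2 {N : Set (Fin 2 → R)} (hN : Cl N) : Cp N := by
  obtain ⟨z, hz, z1, z2⟩ := fpi (R := R) pj_one
  rw [mul_one] at z1 z2
  have hzc := hz.compl
  obtain ⟨g, h, hg, hh, gh, -, ⟨v1, v11, v12⟩, ⟨v2, v21, v22⟩⟩ := z2.dbl hzc.pj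
  obtain ⟨b, b', a, hb, hb', ha, bb, ba, b'a, ze, ⟨w, w1, w2⟩, ab⟩ := halv hz.pj
  have lb : z * b = b := by rw [ze]; simp only [add_mul]; rw [hb.2, hb.fl0 hb' bb, hb.fl0 ha ba]; simp
  have lb' : z * b' = b' := by rw [ze]; simp only [add_mul]; rw [hb'.2, bb, hb'.fl0 ha b'a]; simp
  have ev : ∀ x : R, (1 - z) * x = 0 → b * x = 0 → b' * x = 0 → a * x = 0 → x = 0 := fun x h1 h2 h3 h4 => by
    have : x = (1 - z) * x + (b + b' + a) * x := by rw [← ze, ← add_mul]; simp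
    rw [this, add_mul, add_mul, h1, h2, h3, h4]; simp
  have ips : ∀ g : R, Pj g → ∀ x : Fin 2 → R, ip (Pi.single 1 g) x = g * x 1 := fun g hg x => by
    simp [ip, Fin.sum_univ_two, hg.1]
  have sp : ∀ g : R, Pj g → (∀ K : Set (Fin 2 → R), Cl K → (∀ x ∈ K, g * x 1 = 0 → x = 0) → Cp K) → ∀ N : Set (Fin 2 → R), Cl N →
      (Cp {x | x ∈ N ∧ ∀ t ∈ ({Pi.single 1 g} : Set (Fin 2 → R)), ip t x = 0}) → Cp N := fun g hg H N hN h =>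
    Cp.add hN _ h (fun K hK hi _ => H K hK (fun x hx h0 => hi x hx (by rw [ips g hg, h0])))
  have fin2 : ∀ g p q : R, Pj g → Fn g → star p * p = g → star q * q = g → star p * q = 0 →
     (∀ K : Set (Fin 2 → R), Cl K → (∀ x ∈ K, g * x 1 = 0 → x = 0) → Cp K) := fun g p q hg hF hp hq hpq K hK hi => by
    have hqp : star q * p = 0 := by have := congrArg star hpq; simpa using this
    refine Cp.fin (u := ![p, q]) hK hg hF (Fin.forall_fin_two.2 ⟨hp, hq⟩) ?_ hi
    refine Fin.forall_fin_two.2 ⟨Fin.forall_fin_two.2 ⟨fun h => (h rfl).elim, fun _ => hpq⟩, Fin.forall_fin_two.2 ⟨fun _ => hqp, fun h => (h rfl).elim⟩⟩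
  refine sp (1 - z) hzc.pj (fun K hK hi => ?_) N hN ?_
  · have o1 : v1 * star v2 = 0 := by
      have e2 := congrArg star (pi_mul hh v21)
      rw [star_mul, hh.1] at e2
      rw [← pi_mul hg v11, ← e2, ma, ← ma g, gh]; simp
    have o2 : v2 * star v1 = 0 := by have := congrArg star o1; simpa using this
    refine Cp.pi (U := ![star v1, star v2]) hK hzc (Fin.forall_fin_two.2 ⟨?_, ?_⟩) ?_ hi
    · change star (star v1) * star v1 = _; rw [star_star, v12]
    · change star (star v2) * star v2 = _; rw [star_star, v22]
    · refine Fin.forall_fin_two.2 ⟨Fin.forall_fin_two.2 ⟨fun h => (h rfl).elim, fun _ => ?_⟩, Fin.forall_fin_two.2 ⟨fun _ => ?_, fun h => (h rfl).elim⟩⟩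
      · change star (star v1) * star v2 = _; rw [star_star, o1]
      · change star (star v2) * star v1 = _; rw [star_star, o2]
  have hN1 := hN.inter {Pi.single 1 (1 - z)}
  have fb := z1.le hz.pj hb lb
  have fb' := z1.le hz.pj hb' lb'
  refine sp b hb (fin2 b b w hb fb (by rw [hb.1, hb.2]) w1 ?_) _ hN1 ?_
  · rw [hb.1, ← pi_mul' hb' w2, ← ma, bb, zero_mul]
  have hN2 := hN1.inter {Pi.single 1 b}
  refine sp b' hb' (fin2 b' b' (star w) hb' fb' (by rw [hb'.1, hb'.2]) (by rw [star_star, w2]) ?_) _ hN2 ?_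
  · have e2 := congrArg star (pi_mul hb w1)
    rw [star_mul, hb.1] at e2
    rw [hb'.1, ← e2, ← ma, hb.fl0 hb' bb, zero_mul]
  have hN3 := hN2.inter {Pi.single 1 b'}
  refine sp a ha (fun K hK hi => Cp.abel hK ha ab hi) _ hN3 ?_
  obtain ⟨S, hS⟩ := hN3.inter {Pi.single 1 a}
  have x1 : ∀ x, (∀ s ∈ S, ip s x = 0) → x 1 = 0 := fun x hx => by
    obtain ⟨⟨⟨⟨-, h1⟩, h2⟩, h3⟩, h4⟩ := (hS x).2 hx
    have h1 := h1 _ rfl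
    have h2 := h2 _ rfl
    have h3 := h3 _ rfl
    have h4 := h4 _ rfl
    rw [ips _ hzc.pj] at h1
    rw [ips _ hb] at h2
    rw [ips _ hb'] at h3
    rw [ips _ ha] at h4
    exact ev _ h1 h2 h3 h4
  obtain ⟨p, hp, pa⟩ := annP ((fun s : Fin 2 → R => star (s 0)) '' S)
  refine ⟨fun l => ![![p, 0], ![0, 0]] l, ?_, ?_, ?_⟩
  · refine Fin.forall_fin_two.2 ⟨Fin.forall_fin_two.2 ⟨hp.1, star_zero _⟩, Fin.forall_fin_two.2 ⟨star_zero _, star_zero _⟩⟩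
  · intro l
    refine (hS _).2 (fun s hs => ?_)
    have := (pa p).2 hp.2 _ ⟨s, hs, rfl⟩
    fin_cases l <;> simp [ip, Fin.sum_univ_two, this]
  · intro x hx
    have hx := (hS x).1 hx
    have h1 := x1 x hx
    have h0 : p * x 0 = x 0 := (pa _).1 (by
      rintro _ ⟨s, hs, rfl⟩
      have := hx s hs
      simpa [ip, Fin.sum_univ_two, h1] using this)
    intro l
    fin_cases l <;> simp [ip, Fin.sum_univ_two, h1, hp.1, h0]
end AW
namespace AW
def CPm (m : Type) [Fintype m] : Prop := ∀ (R : Type u) [CStarAlgebra R] [AWStar R] (N : Set (m → R)), Cl N → Cp N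
theorem mat_aw {m : Type} [Fintype m] [DecidableEq m] (h : CPm.{u} m) {R : Type u} [CStarAlgebra R] [AWStar R] :
    IsAWStarRing (Matrix m m R) := fun S => by
  have hN : Cl {x : m → R | ∀ s ∈ S, ∀ i, ∑ k, s i k * x k = 0} := by
    refine ⟨{t | ∃ s ∈ S, ∃ i, t = fun k => star (s i k)}, fun x => ?_⟩
    constructor
    · rintro hx _ ⟨s, hs, i, rfl⟩; simpa [ip] using hx s hs i
    · intro hx s hs i; simpa [ip] using hx _ ⟨s, hs, i, rfl⟩
  obtain ⟨P, p1, p2, p3⟩ := h R _ hN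
  let Q : Matrix m m R := Matrix.of fun k l => P l k
  have hQ : ∀ a : Matrix m m R, (∀ s ∈ S, s * a = 0) → Q * a = a := fun a ha => by
    ext i j
    have := p3 (fun k => a k j) (fun s hs i => by
      have := congrFun (congrFun (ha s hs) i) j
      rwa [Matrix.mul_apply] at this) i
    rw [ip] at this
    rw [Matrix.mul_apply, ← this]
    exact Finset.sum_congr rfl (fun k _ => by rw [p1]; rfl)
  have sQ : ∀ s ∈ S, s * Q = 0 := fun s hs => by
    ext i j; rw [Matrix.mul_apply]; exact p2 j s hs i
  refine ⟨Q, ⟨?_, hQ Q sQ⟩, ?_⟩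
  · ext i j; rw [Matrix.star_apply]; exact p1 _ _
  · ext a; constructor
    · intro h; exact ⟨a, (hQ a h).symm⟩
    · rintro ⟨b, rfl⟩ s hs; rw [← ma, sQ s hs, zero_mul]
theorem cstar_aw {m : Type} [Fintype m] [DecidableEq m] (h : CPm.{u} m) {R : Type u} [CStarAlgebra R] [PartialOrder R] [StarOrderedRing R] [AWStar R] :
    AWStar (CStarMatrix m m R) := ⟨mat_aw h⟩
theorem CPm.prod {m : Type} [Fintype m] [DecidableEq m] (h : CPm.{u} m) : CPm.{u} (m × Fin 2) := fun R _ _ N hN => by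
  letI := CStarAlgebra.spectralOrder R
  letI := CStarAlgebra.spectralOrderedRing R
  haveI : AWStar (CStarMatrix (Fin 2) (Fin 2) R) := cstar_aw (fun R _ _ N hN => cp2 hN)
  obtain ⟨S, hS⟩ := hN
  have e0 : ∀ (X Y : m → CStarMatrix (Fin 2) (Fin 2) R) i j, ip X Y i j = ∑ k, ∑ t, star (X k t i) * Y k t j := fun X Y i j => by
    let ent : CStarMatrix (Fin 2) (Fin 2) R →+ R := ⟨⟨fun M => M i j, rfl⟩, fun _ _ => rfl⟩
    change ent (ip X Y) = _
    rw [ip, map_sum]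
    refine Finset.sum_congr rfl (fun k _ => ?_)
    change (star (X k) * Y k) i j = _
    rw [CStarMatrix.mul_apply]; rfl
  have ipp : ∀ x y : m × Fin 2 → R, ip x y = ∑ k, ∑ t, star (x (k, t)) * y (k, t) := fun x y => by
    rw [ip, Fintype.sum_prod_type]
  let hat : (m × Fin 2 → R) → m → CStarMatrix (Fin 2) (Fin 2) R := fun x k => CStarMatrix.ofMatrix (Matrix.of fun t j => if j = 0 then x (k, t) else 0)
  have hat0 : ∀ x k t, hat x k t 0 = x (k, t) := fun x k t => rfl
  have hat1 : ∀ x k t, hat x k t 1 = 0 := fun x k t => rfl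
  obtain ⟨P, p1, p2, p3⟩ := h (CStarMatrix (Fin 2) (Fin 2) R) {X | ∀ s ∈ hat '' S, ip s X = 0} ⟨_, fun x => Iff.rfl⟩
  refine ⟨fun lj ki => P lj.1 ki.1 ki.2 lj.2, fun k l => ?_, fun l => (hS _).2 (fun s hs => ?_), fun x hx l => ?_⟩
  · exact congrFun (congrFun (p1 k.1 l.1) k.2) l.2
  · have := congrFun (congrFun (p2 l.1 _ ⟨s, hs, rfl⟩) 0) l.2
    rw [e0] at this
    rw [ipp]; exact this
  · have := p3 (hat x) (by
      rintro _ ⟨s, hs, rfl⟩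
      have h1 : ∀ i j, ip (hat s) (hat x) i j = 0 := by
        intro i j
        rw [e0]
        have h2 := (hS x).1 hx s hs
        rw [ipp] at h2
        fin_cases i <;> fin_cases j <;> simp [hat0, hat1]
        simpa using h2
      ext i j; exact h1 i j) l.1
    have := congrFun (congrFun this l.2) 0
    rw [e0] at this
    rw [ipp]; exact this
theorem CPm.emb {m k : Type} [Fintype m] [Fintype k] [DecidableEq m] [DecidableEq k] (h : CPm.{u} m) (f : k → m) (hf : Function.Injective f) : CPm.{u} k := fun R _ _ N ⟨S, hS⟩ => by
  let ex : (k → R) → m → R := fun x => Function.extend f x 0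
  have exf : ∀ x i, ex x (f i) = x i := fun x i => hf.extend_apply _ _ _
  have exn : ∀ x j, (¬ ∃ i, f i = j) → ex x j = 0 := fun x j h => Function.extend_apply' _ _ _ h
  have sum : ∀ (F : m → R), (∀ j, (¬ ∃ i, f i = j) → F j = 0) → ∑ j, F j = ∑ i, F (f i) := fun F hF => by
    symm
    apply Finset.sum_of_injOn f (hf.injOn) (fun _ _ => by simp) (fun j _ hj => hF j (by simpa using hj)) (fun _ _ => rfl)
  have ip1 : ∀ x y, ip (ex x) y = ip x (fun i => y (f i)) := fun x y => by
    rw [ip, sum _ (fun j hj => by rw [exn x j hj]; simp), ip]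
    simp only [exf]
  have ip2 : ∀ x y, ip y (ex x) = ip (fun i => y (f i)) x := fun x y => by
    rw [← star_ip, ip1, star_ip]
  obtain ⟨P, p1, p2, p3⟩ := h R {y | ∀ s ∈ (ex '' S) ∪ {t | ∃ j, (¬ ∃ i, f i = j) ∧ t = Pi.single j 1}, ip s y = 0} ⟨_, fun x => Iff.rfl⟩
  refine ⟨fun l k => P (f l) (f k), fun k l => p1 _ _, fun l => (hS _).2 (fun s hs => ?_), fun x hx l => ?_⟩
  · have := p2 (f l) _ (.inl ⟨s, hs, rfl⟩)
    rwa [ip1] at this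
  · have := p3 (ex x) (by
      rintro _ (⟨s, hs, rfl⟩ | ⟨j, hj, rfl⟩)
      · rw [ip1]; simp only [exf]; exact (hS x).1 hx s hs
      · have : ∀ y : m → R, ip (Pi.single j 1) y = y j := fun y => by
          rw [ip, Finset.sum_eq_single j] <;> simp +contextual
        rw [this, exn x j hj]) (f l)
    rwa [ip2, exf] at this
theorem cpm_fin (n : ℕ) : CPm.{u} (Fin n) := by
  have : ∀ n : ℕ, ∃ (m : Type) (_ : Fintype m) (_ : DecidableEq m), n ≤ Fintype.card m ∧ CPm.{u} m := fun n => by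
    induction n with
    | zero => exact ⟨Fin 2, inferInstance, inferInstance, by simp, fun R _ _ N hN => cp2 hN⟩
    | succ n ih =>
      rcases n with _ | n
      · exact ⟨Fin 2, inferInstance, inferInstance, by simp, fun R _ _ N hN => cp2 hN⟩
      obtain ⟨m, _, _, h1, h2⟩ := ih
      exact ⟨m × Fin 2, inferInstance, inferInstance, by simp; omega, h2.prod⟩
  obtain ⟨m, _, _, h1, h2⟩ := this n
  refine h2.emb (fun i => (Fintype.equivFin m).symm (Fin.castLE h1 i)) (fun i j h => ?_)
  simpa using h
end AW
namespace AW
variable {R : Type u} [CStarAlgebra R] [AWStar R]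
structure Ms (M : Set R) : Prop where
  cm : ∀ x, x ∈ M ↔ ∀ y ∈ M, x * y = y * x
  st : ∀ x ∈ M, star x ∈ M
theorem sa_comm {x a : R} (h1 : x * (a + star a) = (a + star a) * x)
    (h2 : x * (Complex.I • (a - star a)) = (Complex.I • (a - star a)) * x) : x * a = a * x := by
  rw [mul_smul_comm, smul_mul_assoc] at h2
  have h3 := congrArg (fun t => (-Complex.I) • t) h2
  simp only [smul_smul, neg_mul, Complex.I_mul_I, neg_neg, one_smul] at h3
  have h4 : (2:ℂ) • (x * a) = (2:ℂ) • (a * x) := by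
    rw [two_smul, two_smul]
    calc x * a + x * a = x * (a + star a) + x * (a - star a) := by rw [mul_add, mul_sub]; abel
      _ = (a + star a) * x + (a - star a) * x := by rw [h1, h3]
      _ = _ := by rw [add_mul, sub_mul]; abel
  have := congrArg (fun t => (2:ℂ)⁻¹ • t) h4
  simpa [smul_smul] using this
theorem sa1 (a : R) : star (a + star a) = a + star a := by rw [star_add, star_star, add_comm]
theorem sa2 (a : R) : star (Complex.I • (a - star a)) = Complex.I • (a - star a) := by
  rw [star_smul, star_sub, star_star]; simp [smul_sub]; abel
theorem masa {X : Set R} (hn : ∀ a ∈ X, star a * a = a * star a) (hc : ∀ a ∈ X, ∀ b ∈ X, a * b = b * a) :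
    ∃ M : Set R, Ms M ∧ X ⊆ M := by
  obtain ⟨S, s1, s2, s3⟩ := zorn_pw (fun a : R => star a = a ∧ ∀ x ∈ X, a * x = x * a) (fun a b => a * b = b * a) (fun a b h => h.symm)
  have s2' : ∀ a ∈ S, ∀ b ∈ S, a * b = b * a := fun a ha b hb => by
    by_cases h : a = b
    · rw [h]
    · exact s2 ha hb h
  have cst : ∀ x a : R, star x = x → x * a = a * x → x * star a = star a * x := fun x a hx h => by
    have := congrArg star h; simp only [star_mul, hx] at this; exact this.symm
  have c1 : ∀ x a : R, x * a = a * x → x * star a = star a * x → x * (a + star a) = (a + star a) * x := fun x a h h' => by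
    rw [mul_add, add_mul, h, h']
  have c2 : ∀ x a : R, x * a = a * x → x * star a = star a * x → x * (Complex.I • (a - star a)) = (Complex.I • (a - star a)) * x := fun x a h h' => by
    rw [mul_smul_comm, smul_mul_assoc, mul_sub, sub_mul, h, h']
  have Xst : ∀ a ∈ X, ∀ x ∈ X, x * star a = star a * x := fun a ha x hx => by
    haveI : IsStarNormal a := ⟨hn a ha⟩
    exact (IsStarNormal.commute_star_right ‹_› (hc x hx a ha)).eq
  have XS : ∀ a ∈ X, (a + star a) ∈ S ∧ Complex.I • (a - star a) ∈ S := fun a ha =>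
    ⟨s3 _ ⟨sa1 a, fun x hx => (c1 x a (hc x hx a ha) (Xst a ha x hx)).symm⟩
      (fun s hs => (c1 s a ((s1 s hs).2 a ha) (cst _ _ (s1 s hs).1 ((s1 s hs).2 a ha))).symm),
     s3 _ ⟨sa2 a, fun x hx => (c2 x a (hc x hx a ha) (Xst a ha x hx)).symm⟩
      (fun s hs => (c2 s a ((s1 s hs).2 a ha) (cst _ _ (s1 s hs).1 ((s1 s hs).2 a ha))).symm)⟩
  have MX : ∀ x : R, (∀ s ∈ S, x * s = s * x) → ∀ a ∈ X, x * a = a * x := fun x hx a ha =>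
    sa_comm (hx _ (XS a ha).1) (hx _ (XS a ha).2)
  have MS : ∀ x : R, star x = x → (∀ s ∈ S, x * s = s * x) → x ∈ S := fun x h hx => s3 x ⟨h, MX x hx⟩ hx
  have st : ∀ x : R, (∀ s ∈ S, x * s = s * x) → ∀ s ∈ S, star x * s = s * star x := fun x hx s hs =>
    (cst s x (s1 s hs).1 (hx s hs).symm).symm
  refine ⟨{x | ∀ s ∈ S, x * s = s * x}, ⟨fun x => ⟨fun hx y hy => ?_, fun h s hs => h s (fun t ht => s2' s hs t ht)⟩, fun x hx => st x hx⟩,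
    fun a ha s hs => ((s1 s hs).2 a ha).symm⟩
  exact sa_comm (hx _ (MS _ (sa1 y) (fun s hs => (c1 s y (hy s hs).symm (st y hy s hs).symm).symm)))
    (hx _ (MS _ (sa2 y) (fun s hs => (c2 s y (hy s hs).symm (st y hy s hs).symm).symm)))
variable {M : Set R}
theorem Ms.com (h : Ms M) {x y : R} (hx : x ∈ M) (hy : y ∈ M) : x * y = y * x := (h.cm x).1 hx y hy
theorem Ms.mul (h : Ms M) {x y : R} (hx : x ∈ M) (hy : y ∈ M) : x * y ∈ M :=
  (h.cm _).2 (fun w hw => by rw [ma, h.com hy hw, ← ma, h.com hx hw, ma])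
theorem Ms.sub (h : Ms M) {x y : R} (hx : x ∈ M) (hy : y ∈ M) : x - y ∈ M :=
  (h.cm _).2 (fun w hw => by rw [mul_sub, sub_mul, h.com hx hw, h.com hy hw])
theorem Ms.cn (h : Ms M) {z : R} (hz : Cn z) : z ∈ M := (h.cm _).2 (fun w _ => hz.cm w)
theorem Ms.fsp (h : Ms M) {ι : Type*} {e : ι → R} (he : ∀ i, e i ∈ M) : fsup e ∈ M :=
  (h.cm _).2 (fun w hw => (psup_comm (by rintro _ ⟨i, rfl⟩; exact h.com hw (he i)) (by rintro _ ⟨i, rfl⟩; exact h.com (h.st w hw) (he i))).symm)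
theorem Ms.zmul (h : Ms M) {x z : R} (hz : Cn z) (hx : x ∈ M) : z * x ∈ M := h.mul (h.cn hz) hx
theorem Ms.pab (h : Ms M) {q : R} (hq : Pj q) (qM : q ∈ M)
    (H : ∀ p ∈ M, Pj p → q * p = p → ∀ x, (q - p) * x * p = 0) : PAb q := by
  have mem : ∀ a, q * a * q ∈ M := fun a => (h.cm _).2 (fun y hy => by
    have key : ∀ k ∈ M, star k = k → (q * a * q) * k = k * (q * a * q) := fun k hk ks => by
      have := spanP (h := k) (q := q) (a := q * a * q) ks (fun p hp hb => by
        have pM : p ∈ M := (h.cm _).2 (fun w hw => (hb w (h.com hw hk)).symm)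
        have hqp : Pj (q * p) := hq.mul hp (h.com qM pM)
        have qp : q * (q * p) = q * p := by rw [← ma, hq.2]
        have qp' := hqp.fl hq qp
        have h1 := H _ (h.mul qM pM) hqp qp a
        have h2 := H _ (h.mul qM pM) hqp qp (star a)
        generalize q * p = f at *
        replace h2 := congrArg star h2
        rw [star_mul, star_mul, star_sub, star_star, hqp.1, hq.1, star_zero] at h2
        rw [sub_mul, sub_mul, sub_eq_zero] at h1
        rw [mul_sub, mul_sub, sub_eq_zero, ← ma, ← ma] at h2
        rw [ma (q * a), qp, h1, ← ma f, ← ma f, qp', h2])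
      calc q * a * q * k = q * a * q * (q * k) := by rw [← ma _ q k, ma (q * a) q q, hq.2]
        _ = k * q * (q * a * q) := by rw [this, h.com qM hk]
        _ = _ := by rw [ma k, ← ma q, ← ma q, hq.2]
    refine sa_comm (key _ ?_ (sa1 y)) (key _ ?_ (sa2 y))
    · exact (h.cm _).2 (fun w hw => by rw [mul_add, add_mul, h.com hw hy, h.com hw (h.st y hy)])
    · exact (h.cm _).2 (fun w hw => by rw [mul_smul_comm, smul_mul_assoc, mul_sub, sub_mul, h.com hw hy, h.com hw (h.st y hy)]))
  intro p hp hl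
  refine H p ?_ hp hl
  have := mem p
  rwa [hl, hp.fl hq hl] at this
end AW
namespace AW
variable {R : Type u} [CStarAlgebra R] [AWStar R] {M : Set R}
theorem Orth.cons {n : ℕ} {d : Fin n → R} {r : R} (h : Orth d) (hr : Pj r) (h0 : ∀ i, d i * r = 0) :
    Orth (Fin.cons r d : Fin (n+1) → R) := by
  refine ⟨Fin.forall_fin_succ.2 ⟨hr, h.pj⟩, Fin.forall_fin_succ.2 ⟨Fin.forall_fin_succ.2 ⟨fun h => absurd rfl h, fun j _ => ?_⟩, fun i => Fin.forall_fin_succ.2 ⟨fun _ => ?_, fun j hij => ?_⟩⟩⟩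
  · exact (h.pj j).fl0 hr (h0 j)
  · exact h0 i
  · exact h.or i j (fun e => hij (by rw [e]))
theorem Ms.split (h : Ms M) {q : R} (hq : Pj q) (qM : q ∈ M) (hn : ¬ PAb q) :
    ∃ c a b, Cn c ∧ c ≠ 0 ∧ a ∈ M ∧ b ∈ M ∧ Pj a ∧ Pj b ∧ q * a = a ∧ q * b = b ∧ a * b = 0 ∧ c * q = a + b ∧ cc a = c ∧ cc b = c := by
  have : ¬ ∀ p ∈ M, Pj p → q * p = p → ∀ x, (q - p) * x * p = 0 := fun H => hn (h.pab hq qM H)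
  push Not at this
  obtain ⟨p, pM, hp, qp, x, hx⟩ := this
  have hp' := hp.sub hq qp
  have c1 := cn_cc p
  have c2 := cn_cc (q - p)
  have hc := c1.mul c2
  refine ⟨cc p * cc (q - p), cc p * cc (q-p) * p, cc p * cc (q-p) * (q - p), hc, fun h0 => hx ?_, h.zmul hc pM, h.zmul hc (h.sub qM pM), hc.pmul hp, hc.pmul hp', ?_, ?_, ?_, ?_, ?_, ?_⟩
  · calc (q - p) * x * p = (cc (q-p) * (q - p)) * x * (cc p * p) := by rw [cc_mul, cc_mul]
      _ = cc (q-p) * (((q - p) * x) * cc p) * p := by simp only [ma]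
      _ = (cc p * cc (q-p)) * ((q - p) * x * p) := by rw [← c1.cm, ← ma, ← c1.cm]; simp only [ma]
      _ = 0 := by rw [h0, zero_mul]
  · rw [← ma, ← hc.cm, ma, qp]
  · rw [← ma, ← hc.cm, ma, hq.dl qp]
  · exact hc.ort (hp.d0 hq qp)
  · rw [← mul_add]; simp
  · rw [cc_zmul hc hp, ← c2.cm, ma, c1.pj.2]
  · rw [cc_zmul hc hp', ma, c2.pj.2]
theorem Ms.LQ (h : Ms M) {r s : R} (hr : Pj r) (rM : r ∈ M) (rF : Fn r) (hs : Pj s) (s0 : s ≠ 0) (hsr : Sb s r) :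
    ∃ q ∈ M, Pj q ∧ q ≠ 0 ∧ r * q = q ∧ Sb q s := by
  by_contra H0
  have H : ∀ q ∈ M, Pj q → r * q = q → Sb q s → q = 0 := fun q a b c d => by
    by_contra q0; exact H0 ⟨q, a, b, q0, c, d⟩
  have C1 : ∀ q ∈ M, Pj q → r * q = q → Sb (cc q * s) q := fun q qM hq rq => by
    obtain ⟨z, hz, z1, z2⟩ := GC hq hs
    have zq : z * q = 0 := H _ (h.zmul hz qM) (hz.pmul hq) (by rw [← ma, ← hz.cm, ma, rq]) (z1.le (hz.le_mul hs))
    have e1 : (1 - z) * q = q := by rw [sub_mul, zq]; simp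
    have e2 := cc_le hz.compl e1
    have := Sb.zmul (cn_cc q) (hz.compl.pmul hs) z2
    rwa [e1, cc_mul, ← ma, (cn_cc q).cm, e2] at this
  obtain ⟨y, N, hy, ys, B⟩ := Bound rF hr hs s0
  have zs0 : ∀ z, Cn z → cc s * z = z → z * s = 0 → z = 0 := fun z hz h1 h2 => by
    have := cc_le hz.compl (e := s) (by rw [sub_mul, h2]; simp)
    rw [sub_mul, one_mul, sub_eq_self, hz.cm, h1] at this; exact this
  have key : ∀ k, ∃ z x, ∃ d : Fin k → R, Cn z ∧ z ≠ 0 ∧ y * z = z ∧ cc s * z = z ∧ x ∈ M ∧ Pj x ∧ r * x = x ∧ cc x = z ∧ Orth d ∧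
      (∀ i, d i * x = 0) ∧ (∀ i, r * d i = d i) ∧ ∀ i, Sb (z * s) (d i) := by
    intro k
    induction k with
    | zero =>
      have cs := cn_cc s
      have hz := hy.mul cs
      refine ⟨y * cc s, y * cc s * r, Fin.elim0, hz, fun h0 => ys ?_, ?_, ?_, h.zmul hz rM, hz.pmul hr, hz.le_mul hr, ?_, ⟨fun i => i.elim0, fun i => i.elim0⟩, fun i => i.elim0, fun i => i.elim0, fun i => i.elim0⟩
      · rw [← cc_mul s, ← ma, h0, zero_mul]
      · rw [← ma, hy.pj.2]
      · rw [hy.cm, ← ma, cs.pj.2]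
      · rw [cc_zmul hz hr, ma, cs.cm, cc_le (cn_cc r) hsr.cc]
    | succ k ih =>
      obtain ⟨z, x, d, hz, z0, yz, sz, xM, hx, rx, cx, hd, dx, rd, sd⟩ := ih
      by_cases pa : PAb x
      · have := C1 x xM hx rx
        rw [cx] at this
        obtain ⟨g, hg, xg, eg⟩ := this.ex (hz.pmul hs)
        have gM : g ∈ M := by rw [← pa.eq hg xg]; exact h.zmul (cn_cc g) xM
        have g0 := H g gM hg (lt rx xg) ((eg.symm.sb hg).le (hz.le_mul hs))
        rw [g0] at eg
        exact absurd (zs0 z hz sz eg.zero) z0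
      · obtain ⟨c, a, b, hc, c0, aM, bM, ha, hb, xa, xb, ab, cx', ca, cb⟩ := h.split hx xM pa
        have zc : z * c = c := by
          rw [← ca]; refine cc_le hz (lt ?_ xa); rw [← cx]; exact cc_mul x
        refine ⟨c, a, Fin.cons b d, hc, c0, lt yz zc, lt sz zc, aM, ha, lt rx xa, ca, hd.cons hb (fun i => by rw [← xb, ← ma, dx, zero_mul]), ?_, ?_, ?_⟩
        · exact Fin.forall_fin_succ.2 ⟨ha.fl0 hb ab, fun i => by simp only [Fin.cons_succ]; rw [← xa, ← ma, dx, zero_mul]⟩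
        · exact Fin.forall_fin_succ.2 ⟨lt rx xb, rd⟩
        · refine Fin.forall_fin_succ.2 ⟨by have := C1 b bM hb (lt rx xb); rwa [cb] at this, fun i => (sd i).sub (hc.pmul hs) ?_⟩
          rw [ma, hc.le_mul hs, ← ma, zc]
  obtain ⟨z, x, d, hz, z0, yz, sz, -, -, -, -, hd, -, rd, sd⟩ := key N
  exact z0 (zs0 z hz sz (B z d hz yz hd rd sd))
theorem Ms.LF (h : Ms M) {r e : R} (hr : Pj r) (rM : r ∈ M) (rF : Fn r) (he : Pj e) (re : r * e = e) :
    ∃ p ∈ M, Pj p ∧ r * p = p ∧ Ev p e := by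
  obtain ⟨S, s1, s2, s3⟩ := zorn_pw (fun v : R => star v * v ∈ M ∧ Pj (star v * v) ∧ star v * v ≠ 0 ∧ r * (star v * v) = star v * v ∧ e * v = v)
    (fun v w => (star v * v) * (star w * w) = 0 ∧ (v * star v) * (w * star w) = 0 ∧ (star w * w) * (star v * v) = 0 ∧ (w * star w) * (v * star v) = 0)
    (fun v w h => ⟨h.2.2.1, h.2.2.2, h.1, h.2.1⟩)
  let i : S → R := fun v => star v.1 * v.1
  let f : S → R := fun v => v.1 * star v.1
  have hi : Orth i := ⟨fun v => (s1 _ v.2).2.1, fun v w hvw => (s2 v.2 w.2 (fun h => hvw (Subtype.ext h))).1⟩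
  have hf : Orth f := ⟨fun v => pj_final (hi.pj v), fun v w hvw => (s2 v.2 w.2 (fun h => hvw (Subtype.ext h))).2.1⟩
  have ip := fsup_pj i
  have fp := fsup_pj f
  have iM : fsup i ∈ M := h.fsp (fun v => (s1 _ v.2).1)
  have ri : r * fsup i = fsup i := fsup_le (fun v => (s1 _ v.2).2.2.2.1)
  have ef : e * fsup f = fsup f := fsup_le (fun v => by show e * (v.1 * star v.1) = _; rw [← ma, (s1 _ v.2).2.2.2.2])
  have E := AW.Add hi hf (fun v => ⟨v.1, rfl, rfl⟩) (rF.le hr ip ri)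
  by_cases s0 : e - fsup f = 0
  · rw [sub_eq_zero] at s0
    exact ⟨_, iM, ip, ri, by rw [s0]; exact E⟩
  exfalso
  have rf : r * fsup f = fsup f := lt re ef
  have E2 := (FC rF hr ip fp ri rf E).symm
  have hs := fp.sub he ef
  have hri := ip.sub hr ri
  have sr : Sb (e - fsup f) (r - fsup f) := Sb.of_le hs (by
    rw [sub_mul, mul_sub, mul_sub, re, rf, fp.2, fp.fl he ef]; simp)
  have sr2 := sr.trans (fp.sub hr rf) (E2.sb (fp.sub hr rf))
  obtain ⟨q, qM, hq, q0, rq, v, v1, v2⟩ := h.LQ hri (h.sub rM iM) (rF.le hr hri (hr.dl ri)) hs s0 sr2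
  have oi : ∀ w : S, star v * v * i w = 0 := fun w => by
    rw [v1, ← fsup_mul i w, ← ma, ← hq.fl hri rq, ma q, ip.d0' ri, mul_zero, zero_mul]
  have fv : fsup f * v = 0 := by rw [← v2, ← ma, fp.d0 he ef, zero_mul]
  have of : ∀ w : S, f w * (v * star v) = 0 := fun w => by
    rw [← mul_fsup hf.pj w, ma, ← ma (fsup f), fv, zero_mul, mul_zero]
  have hq' : Pj (star v * v) := by rw [v1]; exact hq
  have vS : v ∈ S := s3 v ⟨by rw [v1]; exact qM, hq', by rw [v1]; exact q0, by rw [v1]; exact lt (hr.dl ri) rq, by rw [← v2, ← ma, he.dl ef]⟩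
    (fun w hw => ⟨oi ⟨w, hw⟩, (hf.pj ⟨w,hw⟩).fl0 (pj_final hq') (of ⟨w, hw⟩), hq'.fl0 (hi.pj ⟨w,hw⟩) (oi ⟨w,hw⟩), of ⟨w, hw⟩⟩)
  have := oi ⟨v, vS⟩
  simp only [i] at this
  rw [hq'.2, v1] at this
  exact q0 this
theorem Ms.fin (h : Ms M) (n : ℕ) : ∀ {r : R} (e : Fin n → R), Pj r → r ∈ M → Fn r → Orth e → ∑ i, e i = r →
    ∃ p : Fin n → R, (∀ i, p i ∈ M) ∧ Orth p ∧ ∑ i, p i = r ∧ ∀ i, Ev (p i) (e i) := by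
  induction n with
  | zero => intro r e hr rM rF he hs; exact ⟨e, fun i => i.elim0, he, hs, fun i => i.elim0⟩
  | succ n ih =>
    intro r e hr rM rF he hs
    have re : ∀ i, r * e i = e i := fun i => by rw [← hs]; exact he.sum_mul _ i (Finset.mem_univ i)
    obtain ⟨p, pM, hp, rp, pe⟩ := h.LF hr rM rF (he.pj 0) (re 0)
    have hrp := hp.sub hr rp
    obtain ⟨v, v1, v2⟩ := (FC rF hr hp (he.pj 0) rp (re 0) pe).symm
    have le : ∀ i : Fin n, (r - e 0) * e i.succ = e i.succ := fun i => by
      rw [sub_mul, re, he.or 0 i.succ (Fin.succ_ne_zero i).symm, sub_zero]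
    have oc : ∀ i j, (v * e (Fin.succ i) * star v) * (v * e (Fin.succ j) * star v) = v * (e i.succ * e j.succ) * star v := fun i j => by
      calc _ = v * (e i.succ * ((star v * v) * e j.succ)) * star v := by simp only [ma]
        _ = _ := by rw [v1, le]
    obtain ⟨q, qM, hq, qs, qe⟩ := ih (r := r - p) (fun i => v * e i.succ * star v) hrp (h.sub rM pM) (rF.le hr hrp (hr.dl rp))
      ⟨fun i => conj_pj (he.pj _) v1 (le i), fun i j hij => by
        rw [oc, he.or _ _ (fun h => hij (Fin.succ_injective _ h)), mul_zero, zero_mul]⟩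
      (by rw [← Finset.sum_mul, ← Finset.mul_sum]
          have : ∑ i : Fin n, e i.succ = r - e 0 := by rw [← hs, Fin.sum_univ_succ]; abel
          rw [this, ← v1, ← ma, v2, ma, v2, hrp.2])
    refine ⟨Fin.cons p q, Fin.forall_fin_succ.2 ⟨pM, qM⟩, hq.cons hp (fun i => ?_), by rw [Fin.sum_univ_succ]; simp [qs], Fin.forall_fin_succ.2 ⟨pe, fun i => ?_⟩⟩
    · rw [← (hq.pj i).fl hrp (by rw [← qs]; exact hq.sum_mul _ i (Finset.mem_univ i)), ma, hp.d0' rp, mul_zero]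
    · exact (qe i).trans (hq.pj i) (conj_ev (he.pj _) v1 (le i)).symm
end AW
namespace AW
variable {R : Type u} [CStarAlgebra R] [AWStar R] {M : Set R}
theorem Dbl.sb2 {t a b : R} (h : Dbl t) (ht : Pj t) (ha : Pj a) (hb : Pj b) (h1 : Sb a t) (h2 : Sb b t) (ab : a * b = 0) : Sb (a + b) t := by
  obtain ⟨g, k, hg, hk, gk, e, Eg, Ek⟩ := h
  rw [e]
  exact Sb.add ha hb hg hk (h1.trans ht (Eg.symm.sb ht)) (h2.trans ht (Ek.symm.sb ht)) ab gk
theorem Dbl.sbs {t : R} (h : Dbl t) (ht : Pj t) {ι : Type*} {e : ι → R} (he : Orth e) (hs : ∀ i, Sb (e i) t) (I : Finset ι) : Sb (∑ i ∈ I, e i) t := by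
  classical
  induction I using Finset.induction_on with
  | empty => simpa using Sb.bot t
  | insert i I hi ih =>
    rw [Finset.sum_insert hi]
    refine h.sb2 ht (he.pj i) (he.sum I) (hs i) ih ?_
    rw [Finset.mul_sum]
    exact Finset.sum_eq_zero (fun j hj => he.or i j (fun e => hi (e ▸ hj)))
def St (M : Set R) (x : R) : Prop := ∀ p ∈ M, ∀ q ∈ M, Pj p → Pj q → x * p = p → x * q = q → p * q = 0 → Ev p q → p = 0
structure Dt (M : Set R) (x : R) {ι : Type u} (y0 y1 : R) (e : ι → R) : Prop where
  m0 : y0 ∈ M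
  m1 : y1 ∈ M
  p0 : Pj y0
  p1 : Pj y1
  x0 : x * y0 = y0
  x1 : x * y1 = y1
  ne : y1 ≠ 0
  or : y0 * y1 = 0
  sb : Sb y1 y0
  oe : Orth e
  ev : ∀ i, Ev y1 (e i)
  le : ∀ i, y0 * e i = e i
  rest : Sb (y0 - fsup e) y1
theorem zle {x z y : R} (hz : Cn z) (h : x * y = y) : x * (z * y) = z * y := by
  rw [← ma, ← hz.cm, ma, h]
theorem Dt.fle {x y0 y1 : R} {ι : Type u} {e : ι → R} (D : Dt M x y0 y1 e) : y0 * fsup e = fsup e := fsup_le D.le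
theorem Dt.cut {x y0 y1 w : R} {ι : Type u} {e : ι → R} (D : Dt M x y0 y1 e) (h : Ms M) (hw : Cn w) (w0 : w * y1 ≠ 0) :
    Dt M x (w * y0) (w * y1) (fun i => w * e i) where
  m0 := h.zmul hw D.m0
  m1 := h.zmul hw D.m1
  p0 := hw.pmul D.p0
  p1 := hw.pmul D.p1
  x0 := zle hw D.x0
  x1 := zle hw D.x1
  ne := w0
  or := hw.ort D.or
  sb := Sb.zmul hw D.p1 D.sb
  oe := ⟨fun i => hw.pmul (D.oe.pj i), fun i j hij => hw.ort (D.oe.or i j hij)⟩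
  ev := fun i => Ev.zmul hw (D.ev i)
  le := fun i => hw.mono (D.le i)
  rest := by
    have := Sb.zmul hw ((fsup_pj e).sub D.p0 D.fle) D.rest
    rwa [fsup_zmul hw D.oe.pj, ← mul_sub]
theorem Ms.dt (h : Ms M) {x y0 y1 : R} (m0 : y0 ∈ M) (m1 : y1 ∈ M) (p0 : Pj y0) (p1 : Pj y1) (x0 : x * y0 = y0) (x1 : x * y1 = y1)
    (ne : y1 ≠ 0) (or : y0 * y1 = 0) (sb : Sb y1 y0) : ∃ w, ∃ ι : Type u, ∃ e : ι → R, Cn w ∧ w * y1 ≠ 0 ∧ Dt M x (w * y0) (w * y1) e := by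
  obtain ⟨S, s1, s2, s3⟩ := max_copies p0 p1
  have fl : y0 * fsup (fun s : S => s.1) = fsup (fun s : S => s.1) := fsup_le (fun s => (s2 s.1 s.2).1)
  have rp := (fsup_pj (fun s : S => s.1)).sub p0 fl
  obtain ⟨z, hz, z1, z2⟩ := GC p1 rp
  have w0 : (1 - z) * y1 ≠ 0 := fun h0 => s3 ne (by
    have e : z * y1 = y1 := by rw [sub_mul, one_mul, sub_eq_zero] at h0; exact h0.symm
    rw [e] at z1
    exact z1.le (hz.le_mul rp))
  have hw := hz.compl
  refine ⟨1 - z, S, fun s => (1 - z) * s.1, hw, w0, ⟨h.zmul hw m0, h.zmul hw m1, hw.pmul p0, hw.pmul p1, zle hw x0, zle hw x1, w0, hw.ort or, Sb.zmul hw p1 sb, ⟨fun i => hw.pmul (s1.pj i), fun i j hij => hw.ort (s1.or i j hij)⟩, fun i => Ev.zmul hw (s2 i.1 i.2).2, fun i => hw.mono (s2 i.1 i.2).1, ?_⟩⟩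
  rwa [fsup_zmul hw s1.pj, ← mul_sub]
theorem Dt.fls {x Y0 Y1 P1 P2 : R} {I J : Type u} {f : I → R} {e : J → R} (h : Ms M)
    (hP : ∀ q ∈ M, Pj q → x * q = q → Dbl q) (st : St M x)
    (D : Dt M x Y0 Y1 f) (E : Dt M x P1 P2 e) (eq : Y1 = P1 + P2) (hc : Cardinal.mk I ≤ Cardinal.mk J) : False := by
  have Y1P1 : Sb Y1 P1 := by rw [eq]; exact (hP _ E.m0 E.p0 E.x0).absorb E.p0 E.p1 E.sb E.or
  have yp : Y1 * P1 = P1 := by rw [eq, add_mul, E.p0.2, E.p0.fl0 E.p1 E.or, add_zero]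
  have EYP : Ev P1 Y1 := SB E.p0 D.p1 (Sb.of_le E.p0 yp) Y1P1
  have ef := fsup_pj e
  rcases finite_or_infinite J with hJ | hJ
  · haveI := Fintype.ofFinite J
    have s1 : Sb (fsup e) P2 := by
      rw [E.oe.fsum Finset.univ (fun i hi => absurd (Finset.mem_univ i) hi)]
      exact (hP _ E.m1 E.p1 E.x1).sbs E.p1 E.oe (fun i => (E.ev i).symm.sb (E.oe.pj i)) _
    have s2 := (hP _ E.m1 E.p1 E.x1).sb2 E.p1 ef (ef.sub E.p0 E.fle) s1 E.rest (ef.d0 E.p0 E.fle)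
    rw [add_sub_cancel] at s2
    have := st P1 E.m0 P2 E.m1 E.p0 E.p1 E.x0 E.x1 E.or (SB E.p0 E.p1 s2 E.sb)
    have h2 := E.sb
    rw [this] at h2
    exact E.ne h2.zero
  · choose v v1 v2 using fun i => EYP.trans E.p0 (D.ev i)
    let Eo : Option J → R := fun o => o.elim (P1 - fsup e) e
    have hr := ef.sub E.p0 E.fle
    have re : ∀ j, (P1 - fsup e) * e j = 0 := fun j => by
      rw [← fsup_mul e j, ← ma, ef.d0' E.fle, zero_mul]
    have hE : Orth Eo := by
      refine ⟨fun o => ?_, fun o o' ho => ?_⟩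
      · cases o; exacts [hr, E.oe.pj _]
      · rcases o with _ | j <;> rcases o' with _ | j'
        · exact absurd rfl ho
        · exact re j'
        · exact hr.fl0 (E.oe.pj j) (re j)
        · exact E.oe.or j j' (fun h => ho (by rw [h]))
    have lE : ∀ o, P1 * Eo o = Eo o := fun o => by
      cases o; exacts [E.p0.dl E.fle, E.le _]
    have fE : fsup Eo = P1 := by
      have e1 : fsup Eo * P1 = P1 := by
        conv_lhs => rw [← add_sub_cancel (fsup e) P1, mul_add]
        rw [show fsup Eo * fsup e = fsup e from fsup_le (fun j => fsup_mul Eo (some j)), show fsup Eo * (P1 - fsup e) = P1 - fsup e from fsup_mul Eo none, add_sub_cancel]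
      exact pj_antisymm (fsup_pj Eo) E.p0 e1 (fsup_le lE)
    have sE : ∀ o, Sb (Eo o) P2 := fun o => by
      cases o; exacts [E.rest, (E.ev _).symm.sb (E.oe.pj _)]
    let g : I × Option J → R := fun k => v k.1 * Eo k.2 * star (v k.1)
    have gp : ∀ k, Pj (g k) := fun k => conj_pj (hE.pj _) (v1 _) (lE _)
    have fg : ∀ k, f k.1 * g k = g k := fun k => by
      have hv := pi_mul E.p0 (v1 k.1)
      calc f k.1 * g k = (v k.1 * (star (v k.1) * v k.1)) * Eo k.2 * star (v k.1) := by
            rw [← v2]; simp only [g, ma]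
        _ = _ := by rw [v1, hv]
    have hg : Orth g := ⟨gp, fun k l hkl => by
      by_cases hi : k.1 = l.1
      · have ho : k.2 ≠ l.2 := fun h => hkl (Prod.ext hi h)
        calc g k * g l = v k.1 * (Eo k.2 * ((star (v k.1) * v k.1) * Eo l.2)) * star (v k.1) := by simp only [g, ← hi, ma]
          _ = 0 := by rw [v1, lE, hE.or _ _ ho, mul_zero, zero_mul]
      · exact ol (D.oe.pj _) (gp k) (D.oe.or _ _ hi) (fg k) (fg l)⟩
    obtain ⟨φ⟩ : Nonempty (I × Option J ↪ J) := by
      have hJ' : Cardinal.aleph0 ≤ Cardinal.mk J := Cardinal.aleph0_le_mk J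
      rw [← Cardinal.le_def, Cardinal.mk_prod, Cardinal.lift_id, Cardinal.lift_id, Cardinal.mk_option, Cardinal.add_one_eq hJ']
      exact (mul_le_mul_left hc _).trans (Cardinal.mul_eq_self hJ').le
    have sg : ∀ k, Sb (g k) (e (φ k)) := fun k =>
      (((conj_ev (hE.pj k.2) (v1 k.1) (lE k.2)).symm.sb (gp k)).trans (hE.pj _) (sE k.2)).trans E.p1 ((E.ev (φ k)).sb E.p1)
    choose k kp ek gk using fun i => (sg i).ex (gp i)
    have hk : Orth k := ⟨kp, fun a b hab => ol (E.oe.pj _) (kp a) (E.oe.or _ _ (fun h => hab (φ.injective h))) (ek a) (ek b)⟩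
    have Pk : ∀ a, P1 * k a = k a := fun a => lt (E.le _) (ek a)
    have ev := OEv hg hk (fun a b => ol D.p0 (gp a) D.or (lt (D.le _) (fg a)) (lt yp (Pk b))) gk
    have gf : fsup g * fsup f = fsup f := fsup_le (fun i => by
      have := conj_fsup (v := v i) hE.pj ((v1 i).trans fE.symm)
      rw [v2] at this
      rw [← this]
      exact fsup_le (fun o => fsup_mul g (i, o)))
    have ff := fsup_pj f
    have s1 : Sb (fsup f) P1 := ((ev.sb (fsup_pj g)).le (fsup_le Pk)).sub ff gf
    have s2 := (hP _ E.m0 E.p0 E.x0).sb2 E.p0 ff (ff.sub D.p0 D.fle) s1 (D.rest.trans D.p1 Y1P1) (ff.d0 D.p0 D.fle)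
    rw [add_sub_cancel] at s2
    have := st Y0 D.m0 Y1 D.m1 D.p0 D.p1 D.x0 D.x1 D.or (SB D.p0 D.p1 (s2.le yp) D.sb)
    have h2 := D.sb
    rw [this] at h2
    exact D.ne h2.zero
theorem Ms.split2 (h : Ms M) {q : R} (hq : Pj q) (qM : q ∈ M) (hn : ¬ PAb q) :
    ∃ c a b, Cn c ∧ a ∈ M ∧ b ∈ M ∧ Pj a ∧ Pj b ∧ q * a = a ∧ q * b = b ∧ a * b = 0 ∧ c * q = a + b ∧ Sb b a ∧ b ≠ 0 := by
  obtain ⟨c, a, b, hc, c0, aM, bM, ha, hb, qa, qb, ab, cq, ca, cb⟩ := h.split hq qM hn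
  obtain ⟨z, hz, z1, z2⟩ := GC ha hb
  by_cases h0 : (1 - z) * b = 0
  · have e : z * b = b := by rw [sub_mul, one_mul, sub_eq_zero] at h0; exact h0.symm
    have zc := cc_le hz e
    have za : z * a = a := lt (by rw [ca, ← cb]; exact zc) (cc_mul a)
    rw [za, e] at z1
    refine ⟨c, b, a, hc, bM, aM, hb, ha, qb, qa, ha.fl0 hb ab, by rw [cq, add_comm], z1, fun a0 => c0 ?_⟩
    rw [← ca, ← zero_mul (cc a)]
    rw [a0]; exact (cc_le cn_zero (by simp)).symm
  · have hw := hz.compl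
    refine ⟨(1 - z) * c, (1-z) * a, (1-z) * b, hw.mul hc, h.zmul hw aM, h.zmul hw bM, hw.pmul ha, hw.pmul hb, zle hw qa, zle hw qb, hw.ort ab, by rw [ma, cq, mul_add], z2, h0⟩
theorem Ms.N2 (h : Ms M) {x : R} (hx : Pj x) (xM : x ∈ M) (hF : ∀ q ∈ M, Pj q → x * q = q → Fn q → q = 0) (st : St M x) : x = 0 := by
  by_contra x0
  have hP : ∀ q ∈ M, Pj q → x * q = q → Dbl q := fun q qM hq xq =>
    PI.dbl (fun z hz hf => hF _ (h.zmul hz qM) (hz.pmul hq) (zle hz xq) hf) hq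
  have sp : ∀ q ∈ M, Pj q → x * q = q → q ≠ 0 → ¬ PAb q := fun q qM hq xq q0 pa => q0 (hF q qM hq xq (pa.fn hq))
  let C : Set Cardinal.{u} := {c | ∃ (ι : Type u) (y0 y1 : R) (e : ι → R), Dt M x y0 y1 e ∧ Cardinal.mk ι = c}
  have hC : C.Nonempty := by
    obtain ⟨c, a, b, hc, aM, bM, ha, hb, xa, xb, ab, cx, sb, b0⟩ := h.split2 hx xM (sp x xM hx hx.2 x0)
    obtain ⟨w, ι, e, hw, w0, D⟩ := h.dt aM bM ha hb xa xb b0 ab sb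
    exact ⟨_, ι, _, _, e, D, rfl⟩
  obtain ⟨_, ⟨I, y0, y1, f, D, rfl⟩, mn⟩ := Cardinal.lt_wf.has_min C hC
  obtain ⟨c, a, b, hc, aM, bM, ha, hb, ya, yb, ab, cy, sb, b0⟩ := h.split2 D.p1 D.m1 (sp _ D.m1 D.p1 D.x1 D.ne)
  obtain ⟨w, J, e, hw, w0, E⟩ := h.dt aM bM ha hb (lt D.x1 ya) (lt D.x1 yb) b0 ab sb
  have eq : w * c * y1 = w * a + w * b := by rw [ma, cy, mul_add]
  refine Dt.fls h hP st (D.cut h (hw.mul hc) ?_) E eq (not_lt.1 (mn _ ⟨J, _, _, e, E, rfl⟩))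
  intro h0
  rw [h0] at eq
  have := congrArg (fun t => t * (w * b)) eq
  simp only [zero_mul, add_mul, E.or, E.p1.2, zero_add] at this
  exact w0 this.symm
theorem Ms.N (h : Ms M) {ρ : R} (hρ : Pj ρ) (ρM : ρ ∈ M) (pi : PI ρ) (st : St M ρ) : ρ = 0 := by
  obtain ⟨S, s1, s2, s3⟩ := zorn_pw (fun q : R => q ∈ M ∧ Pj q ∧ q ≠ 0 ∧ ρ * q = q ∧ Fn q) (fun p q => p * q = 0 ∧ q * p = 0) (fun _ _ h => ⟨h.2, h.1⟩)
  let s : S → R := fun s => s.1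
  have hs : Orth s := ⟨fun i => (s1 _ i.2).2.1, fun i j hij => (s2 i.2 j.2 (fun h => hij (Subtype.ext h))).1⟩
  have co : ∀ i j, i ≠ j → cc (s i) * s j = 0 := fun i j hij => by
    have : s j * cc (s i) = 0 := by
      refine cc_ann (fun a => ?_)
      by_contra h0
      obtain ⟨iM, hi, i0, ρi, iF⟩ := s1 _ i.2
      obtain ⟨jM, hj, j0, ρj, jF⟩ := s1 _ j.2
      obtain ⟨v, v0, hv, iv, jv⟩ := corner hi hj h0
      obtain ⟨q, qM, hq, q0, jq, qv⟩ := h.LQ hj jM jF hv v0 ⟨v, rfl, jv⟩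
      obtain ⟨g, hg, ig, qg⟩ := (qv.le iv).ex hq
      obtain ⟨p, pM, hp, ip, pg⟩ := h.LF hi iM iF hg ig
      have e := pg.trans hp qg.symm
      have := st p pM q qM hp hq (lt ρi ip) (lt ρj jq) (ol hi hp (hs.or i j hij) ip jq) e
      rw [this] at e
      exact q0 e.symm.zero
    rw [(cn_cc _).cm, this]
  have q0 := fsup_pj s
  have F : Fn (fsup s) := by
    have := fnGlue (z := fun i => cc (s i)) (fun i => cn_cc _) q0 (fun i => by
      have : cc (s i) * fsup s = s i * fsup s := fsup_eq (fun j => by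
        by_cases hij : i = j
        · rw [hij, cc_mul, (hs.pj j).2]
        · rw [co i j hij, hs.or i j hij])
      rw [this, mul_fsup hs.pj]; exact (s1 _ i.2).2.2.2.2)
    rwa [fsup_le (fun i => lt (fsup_mul (fun i => cc (s i)) i) (cc_mul (s i)))] at this
  have le : ρ * fsup s = fsup s := fsup_le (fun i => (s1 _ i.2).2.2.2.1)
  have sM : fsup s ∈ M := h.fsp (fun i => (s1 _ i.2).1)
  have x0 := h.N2 (q0.sub hρ le) (h.sub ρM sM) (fun q qM hq xq qF => by
      by_contra qne
      have o : ∀ i, q * s i = 0 := fun i => by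
        rw [← fsup_mul s i, ← ma, ← hq.fl (q0.sub hρ le) xq, ma q, q0.d0' le, mul_zero, zero_mul]
      have qS : q ∈ S := s3 q ⟨qM, hq, qne, lt (hρ.dl le) xq, qF⟩ (fun t ht => ⟨o ⟨t, ht⟩, hq.fl0 (hs.pj ⟨t, ht⟩) (o ⟨t, ht⟩)⟩)
      have := o ⟨q, qS⟩
      exact qne (by rw [← hq.2]; exact this))
    (fun p pM q qM hp hq xp xq => st p pM q qM hp hq (lt (hρ.dl le) xp) (lt (hρ.dl le) xq))
  rw [sub_eq_zero] at x0
  have := pi 1 cn_one (by rw [one_mul, x0]; exact F)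
  rwa [one_mul] at this
end AW
namespace AW
variable {R : Type u} [CStarAlgebra R] [AWStar R] {M : Set R}
theorem Ms.add (h : Ms M) {x y : R} (hx : x ∈ M) (hy : y ∈ M) : x + y ∈ M :=
  (h.cm _).2 (fun w hw => by rw [mul_add, add_mul, h.com hx hw, h.com hy hw])
def Hv (M : Set R) (r : R) : Prop := ∃ p ∈ M, Pj p ∧ r * p = p ∧ Ev p r ∧ Ev (r - p) r
theorem H1 {a b ρ r y : R} (aM : y * a ∈ M) (hr : Pj r) (pi : PI r) (ha : Pj a) (hb : Pj b) (hρ : Pj ρ) (ab : a * b = 0) (aρ : a * ρ = 0) (bρ : b * ρ = 0)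
    (E : Ev a b) (sum : a + (b + ρ) = r) (hy : Cn y) (F : Fn (y * ρ)) : Hv M (y * r) := by
  have h0 : ∀ z, Cn z → Fn (z * (y * a)) → z * (y * r) = 0 := fun z hz hf => by
    have hw := hz.mul hy
    rw [← ma] at hf ⊢
    refine pi _ hw ?_
    have f2 := hf.ev (hw.pmul ha) (Ev.zmul hw E)
    have f3 : Fn (z * y * ρ) := by rw [ma]; exact F.zmul (hy.pmul hρ) hz
    rw [← sum, mul_add, mul_add]
    refine FnS (hw.pmul ha) ((hw.pmul hb).add (hw.pmul hρ) (hw.ort bρ)) ?_ hf (FnS (hw.pmul hb) (hw.pmul hρ) (hw.ort bρ) f2 f3)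
    rw [mul_add, hw.ort ab, hw.ort aρ, add_zero]
  have ra : r * a = a := by rw [← sum, add_mul, add_mul, ha.2, ha.fl0 hb ab, ha.fl0 hρ aρ]; simp
  have rr : r * ρ = ρ := by rw [← sum, add_mul, add_mul, aρ, bρ, hρ.2]; simp
  have hs : y * a + (y * b + y * ρ) = y * r := by rw [← sum, mul_add, mul_add]
  have E' := Ev.zmul hy E
  have ab' := hy.ort ab
  have aρ' := hy.ort aρ
  have bρ' := hy.ort bρ
  have ra' := hy.mono ra
  have rr' := hy.mono rr
  have ha' := hy.pmul ha
  have hb' := hy.pmul hb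
  have hρ' := hy.pmul hρ
  have hr' := hy.pmul hr
  generalize y * a = a' at *
  generalize y * b = b' at *
  generalize y * ρ = ρ' at *
  generalize y * r = r' at *
  have pa : PI a' := fun z hz hf => by rw [← ra', ← ma, h0 z hz hf, zero_mul]
  have pb := pa.ev ha' E'
  obtain ⟨z, hz, z1, z2⟩ := GC hρ' ha'
  have hw := hz.compl
  have := h0 _ hw ((F.zmul hρ' hw).sb (hw.pmul hρ') (hw.pmul ha') z2)
  have wr : (1 - z) * ρ' = 0 := by rw [← rr', ← ma, this, zero_mul]
  rw [sub_mul, one_mul, sub_eq_zero] at wr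
  rw [← wr] at z1
  have s1 := z1.le (hz.le_mul ha')
  have s2 := (pb.dbl hb').absorb hb' hρ' (s1.trans ha' (E'.sb ha')) bρ'
  have hbr := hb'.add hρ' bρ'
  have s3 := (pa.dbl ha').absorb ha' hbr (s2.trans hb' (E'.symm.sb hb')) (by rw [mul_add, ab', aρ', add_zero])
  rw [hs] at s3
  have e : r' - a' = b' + ρ' := by rw [← hs]; abel
  refine ⟨a', aM, ha', ra', SB ha' hr' (Sb.of_le ha' ra') s3, ?_⟩
  have hd := ha'.sub hr' ra'
  refine SB hd hr' (Sb.of_le hd (hr'.dl ra')) ((s3.trans ha' (E'.sb ha')).le ?_)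
  rw [e, add_mul, hb'.2, hb'.fl0 hρ' bρ', add_zero]
theorem Ms.H0 (h : Ms M) {r : R} (hr : Pj r) (rM : r ∈ M) (pi : PI r) (r0 : r ≠ 0) : ∃ y, Cn y ∧ y * r ≠ 0 ∧ Hv M (y * r) := by
  obtain ⟨S, s1, s2, s3⟩ := zorn_pw (fun v : R => (star v * v ∈ M ∧ v * star v ∈ M ∧ Pj (star v * v) ∧ r * (star v * v) = star v * v) ∧ (r * (v * star v) = v * star v ∧ (star v * v) * (v * star v) = 0))
    (fun v w => (star v * v + v * star v) * (star w * w + w * star w) = 0 ∧ (star w * w + w * star w) * (star v * v + v * star v) = 0)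
    (fun _ _ h => ⟨h.2, h.1⟩)
  let i : S → R := fun v => star v.1 * v.1
  let f : S → R := fun v => v.1 * star v.1
  have ip : ∀ v, Pj (i v) := fun v => (s1 _ v.2).1.2.2.1
  have fp : ∀ v, Pj (f v) := fun v => pj_final (ip v)
  have o1 : ∀ v, i v * f v = 0 := fun v => (s1 _ v.2).2.2
  have T1 : ∀ v, (i v + f v) * i v = i v := fun v => by rw [add_mul, (ip v).2, (ip v).fl0 (fp v) (o1 v), add_zero]
  have T2 : ∀ v, (i v + f v) * f v = f v := fun v => by rw [add_mul, (fp v).2, o1 v, zero_add]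
  have Tp : ∀ v, Pj (i v + f v) := fun v => (ip v).add (fp v) (o1 v)
  have TT : ∀ v w, v ≠ w → (i v + f v) * (i w + f w) = 0 := fun v w hvw => (s2 v.2 w.2 (fun h => hvw (Subtype.ext h))).1
  have hi : Orth i := ⟨ip, fun v w hvw => ol (Tp v) (ip v) (TT v w hvw) (T1 v) (T1 w)⟩
  have hf : Orth f := ⟨fp, fun v w hvw => ol (Tp v) (fp v) (TT v w hvw) (T2 v) (T2 w)⟩
  have hif : ∀ v w, i v * f w = 0 := fun v w => by
    by_cases hvw : v = w
    · rw [hvw, o1]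
    · exact ol (Tp v) (ip v) (TT v w hvw) (T1 v) (T2 w)
  have E := OEv hi hf hif (fun v => ⟨v.1, rfl, rfl⟩)
  have ab := fsup_orth ip fp hif
  have aM : fsup i ∈ M := h.fsp (fun v => (s1 _ v.2).1.1)
  have bM : fsup f ∈ M := h.fsp (fun v => (s1 _ v.2).1.2.1)
  have ra : r * fsup i = fsup i := fsup_le (fun v => (s1 _ v.2).1.2.2.2)
  have rb : r * fsup f = fsup f := fsup_le (fun v => (s1 _ v.2).2.1)
  have ha := fsup_pj i
  have hb := fsup_pj f
  have hc := ha.add hb ab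
  have ca : (fsup i + fsup f) * fsup i = fsup i := by rw [add_mul, ha.2, ha.fl0 hb ab, add_zero]
  have cb : (fsup i + fsup f) * fsup f = fsup f := by rw [add_mul, hb.2, ab, zero_add]
  have rc : r * (fsup i + fsup f) = fsup i + fsup f := by rw [mul_add, ra, rb]
  have hρ := hc.sub hr rc
  have ρM := h.sub rM (h.add aM bM)
  by_cases hF : ∃ y, Cn y ∧ y * r ≠ 0 ∧ Fn (y * (r - (fsup i + fsup f)))
  · obtain ⟨y, hy, y0, F⟩ := hF
    refine ⟨y, hy, y0, H1 (h.zmul hy aM) hr pi ha hb hρ ab ?_ ?_ E (by abel) hy F⟩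
    · exact ol hc ha (hc.d0 hr rc) ca hρ.2
    · exact ol hc hb (hc.d0 hr rc) cb hρ.2
  · exfalso
    push Not at hF
    have hF' : ∀ y, Cn y → Fn (y * (r - (fsup i + fsup f))) → y * r = 0 := fun y hy hf => by
      by_contra h0; exact hF y hy h0 hf
    have cT : ∀ w, (r - (fsup i + fsup f)) * (i w + f w) = 0 := fun w => by
      have : (fsup i + fsup f) * (i w + f w) = i w + f w := by
        rw [mul_add, lt ca (fsup_mul i w), lt cb (fsup_mul f w)]
      rw [← this, ← ma, hc.d0' rc, zero_mul]
    have ρ0 := h.N hρ ρM (fun z hz hf => by rw [← hr.dl rc, ← ma, hF' z hz hf, zero_mul]) (by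
      rintro p pM q qM hp hq ρp ρq pq ⟨v, rfl, rfl⟩
      have hT := hp.add hq pq
      have vT : (r - (fsup i + fsup f)) * (star v * v + v * star v) = (star v * v + v * star v) := by rw [mul_add, ρp, ρq]
      have o : ∀ w, (star v * v + v * star v) * (i w + f w) = 0 := fun w => by
        rw [← hT.fl hρ vT, ma, cT, mul_zero]
      have vS : v ∈ S := s3 v ⟨⟨pM, qM, hp, lt (hr.dl rc) ρp⟩, lt (hr.dl rc) ρq, pq⟩
        (fun w hw => ⟨o ⟨w, hw⟩, hT.fl0 (Tp ⟨w, hw⟩) (o ⟨w, hw⟩)⟩)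
      have h1 := cT ⟨v, vS⟩
      have h2 := T1 ⟨v, vS⟩
      simp only [i, f] at h1 h2
      have h3 := h1.symm.trans vT
      rw [← h3, zero_mul] at h2
      exact h2.symm)
    refine r0 ?_
    rw [← one_mul r]
    refine hF' 1 cn_one ?_
    rw [ρ0, mul_zero]; exact fn_zero
theorem Ms.H (h : Ms M) {r : R} (hr : Pj r) (rM : r ∈ M) (pi : PI r) : Hv M r := by
  obtain ⟨S, s1, s2, s3⟩ := exh (fun y => Hv M (y * r)) cn_one (fun y hy _ y0 => by
    by_cases yr : y * r = 0
    · refine ⟨y, hy, hy.pj.2, y0, ?_⟩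
      show Hv M (y * r)
      rw [yr]; exact ⟨0, h.cn cn_zero, pj_zero, by simp, Ev.refl pj_zero, by rw [sub_zero]; exact Ev.refl pj_zero⟩
    · obtain ⟨w, hw, w0, hv⟩ := h.H0 (hy.pmul hr) (h.zmul hy rM) (pi.zmul hy) yr
      rw [← ma] at hv w0
      exact ⟨w * y, hw.mul hy, zle hw hy.pj.2, fun h0 => w0 (by rw [h0, zero_mul]), hv⟩)
  choose p pM hp rp pe pe' using fun s : S => (s1 s.1 s.2).2.2.2
  have hz : ∀ s : S, Cn s.1 := fun s => (s1 s.1 s.2).1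
  have zp : ∀ s : S, s.1 * p s = p s := fun s => lt ((hz s).le_mul2) (rp s)
  have fp := fsup_pj p
  have zf : ∀ s : S, s.1 * fsup p = p s := fun s => by
    rw [← mul_fsup hp s]
    refine fsup_eq (fun t => ?_)
    by_cases hst : s = t
    · rw [hst, zp, (hp t).2]
    · rw [ol (hz s).pj (hp s) (s2 s t hst) (zp s) (zp t), ← zp t, ← ma, s2 s t hst, zero_mul]
  have rf : r * fsup p = fsup p := fsup_le (fun s => lt ((hz s).le_mul hr) (rp s))
  have e1 := glueEv hz s2 fp (f := r) (fun s => by rw [zf]; exact pe s)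
  have e2 := glueEv hz s2 (fp.sub hr rf) (f := r) (fun s => by rw [mul_sub, zf]; exact pe' s)
  rw [s3, one_mul, one_mul] at e1 e2
  exact ⟨_, h.fsp pM, fp, rf, e1, e2⟩
theorem Ms.pieces (h : Ms M) (n : ℕ) : ∀ {r : R}, Pj r → r ∈ M → PI r → ∃ p : Fin (n+1) → R, (∀ i, p i ∈ M) ∧ Orth p ∧ ∑ i, p i = r ∧ ∀ i, Ev (p i) r := by
  induction n with
  | zero => intro r hr rM pi; exact ⟨fun _ => r, fun _ => rM, ⟨fun _ => hr, fun i j hij => absurd (Subsingleton.elim (α := Fin 1) i j) hij⟩, by simp, fun _ => Ev.refl hr⟩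
  | succ n ih =>
    intro r hr rM pi
    obtain ⟨p, pM, hp, rp, pe, pe'⟩ := h.H hr rM pi
    have hd := hp.sub hr rp
    obtain ⟨q, qM, hq, qs, qe⟩ := ih hd (h.sub rM pM) (pi.ev hr pe'.symm)
    refine ⟨Fin.cons p q, Fin.forall_fin_succ.2 ⟨pM, qM⟩, hq.cons hp (fun i => ?_), by rw [Fin.sum_univ_succ]; simp [qs], Fin.forall_fin_succ.2 ⟨pe, fun i => (qe i).trans (hq.pj i) pe'⟩⟩
    rw [← (hq.pj i).fl hd (by rw [← qs]; exact hq.sum_mul _ i (Finset.mem_univ i)), ma, hp.d0' rp, mul_zero]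
theorem fnSum {ι : Type*} {e : ι → R} (he : Orth e) (hF : ∀ i, Fn (e i)) (I : Finset ι) : Fn (∑ i ∈ I, e i) := by
  classical
  induction I using Finset.induction_on with
  | empty => simpa using fn_zero
  | insert i I hi ih =>
    rw [Finset.sum_insert hi]
    refine FnS (he.pj i) (he.sum I) ?_ (hF i) ih
    rw [Finset.mul_sum]
    exact Finset.sum_eq_zero (fun j hj => he.or i j (fun e => hi (e ▸ hj)))
theorem Orth.zm {ι : Type*} {e : ι → R} (he : Orth e) {z : R} (hz : Cn z) : Orth (fun i => z * e i) :=
  ⟨fun i => hz.pmul (he.pj i), fun i j hij => hz.ort (he.or i j hij)⟩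
theorem Ms.asm (h : Ms M) (n : ℕ) (e : Fin n → R) (he : Orth e) (s : ∑ i, e i = 1) (hev : ∀ i j, Ev (e i) (e j)) :
    ∃ p : Fin n → R, (∀ i, p i ∈ M) ∧ Orth p ∧ ∑ i, p i = 1 ∧ ∀ i, Ev (p i) (e i) := by
  cases n with
  | zero => exact ⟨e, fun i => i.elim0, he, s, fun i => i.elim0⟩
  | succ n =>
  obtain ⟨z, hz, zF, zP⟩ := fpi (R := R) pj_one
  rw [mul_one] at zF zP
  have ht := hz.compl
  have sm : ∀ w : R, ∑ i, w * e i = w := fun w => by rw [← Finset.mul_sum, s, mul_one]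
  obtain ⟨p, pM, hp, ps, pe⟩ := h.fin (n+1) (fun i => z * e i) hz.pj (h.cn hz) zF (he.zm hz) (sm z)
  obtain ⟨q, qM, hq, qs, qe⟩ := h.pieces n ht.pj (h.cn ht) zP
  have te : ∀ i, Ev ((1 - z) * e i) (1 - z) := fun i => by
    have hi := ht.pmul (he.pj i)
    have pi : PI ((1 - z) * e i) := fun w hw hf => by
      have := fnSum ((he.zm ht).zm hw) (fun j => hf.ev (hw.pmul hi) (Ev.zmul hw (Ev.zmul ht (hev i j)))) Finset.univ
      rw [← Finset.mul_sum, sm] at this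
      rw [← ma, zP w hw this, zero_mul]
    refine SB hi ht.pj (Sb.of_le hi ht.le_mul2) ?_
    have := (pi.dbl hi).sbs hi (he.zm ht) (fun j => (Ev.zmul ht (hev j i)).sb (ht.pmul (he.pj j))) Finset.univ
    rwa [sm] at this
  have zp : ∀ i, z * p i = p i := fun i => by
    have := hp.sum_mul _ i (Finset.mem_univ i)
    rwa [ps] at this
  have tq : ∀ i, (1 - z) * q i = q i := fun i => by
    have := hq.sum_mul _ i (Finset.mem_univ i)
    rwa [qs] at this
  have zt : z * (1 - z) = 0 := by rw [mul_sub, mul_one, hz.pj.2, sub_self]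
  have zq : ∀ i, z * q i = 0 := fun i => by rw [← tq, ← ma, zt, zero_mul]
  have pq : ∀ i j, p i * q j = 0 := fun i j => ol hz.pj (hp.pj i) zt (zp i) (tq j)
  refine ⟨fun i => p i + q i, fun i => h.add (pM i) (qM i), ⟨fun i => (hp.pj i).add (hq.pj i) (pq i i), fun i j hij => ?_⟩, ?_, fun i => ?_⟩
  · rw [mul_add, add_mul, add_mul, hp.or i j hij, hq.or i j hij, pq, (hp.pj j).fl0 (hq.pj i) (pq j i)]; simp
  · rw [Finset.sum_add_distrib, ps, qs]; simp
  · refine Ev.join hz ((hp.pj i).add (hq.pj i) (pq i i)) ?_ ?_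
    · rw [mul_add, zp, zq, add_zero]; exact pe i
    · rw [mul_add, tq, sub_mul, one_mul, zp, sub_self, zero_add]
      exact (qe i).trans (hq.pj i) (te i).symm
theorem sumd {n : ℕ} {x y : Fin n → R} (h : ∀ i j, i ≠ j → x i * y j = 0) : (∑ i, x i) * (∑ i, y i) = ∑ i, x i * y i := by
  rw [Finset.sum_mul_sum]
  exact Finset.sum_congr rfl (fun i _ => Finset.sum_eq_single i (fun j _ hj => h i j hj.symm) (fun h => absurd (Finset.mem_univ i) h))
theorem Ms.uni (h : Ms M) (n : ℕ) (e : Fin n → R) (he : Orth e) (s : ∑ i, e i = 1) (hev : ∀ i j, Ev (e i) (e j)) :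
    ∃ u : R, star u * u = 1 ∧ u * star u = 1 ∧ ∀ a ∈ M, ∀ i j, i ≠ j → e i * (u * a * star u) * e j = 0 := by
  obtain ⟨p, pM, hp, ps, pe⟩ := h.asm n e he s hev
  choose v v1 v2 using pe
  have vp := fun i => pi_mul (hp.pj i) (v1 i)
  have ev := fun i => pi_mul' (he.pj i) (v2 i)
  have pv : ∀ i, p i * star (v i) = star (v i) := fun i => by
    have := congrArg star (vp i); rwa [star_mul, (hp.pj i).1] at this
  have ve : ∀ i, star (v i) * e i = star (v i) := fun i => by
    have := congrArg star (ev i); rwa [star_mul, (he.pj i).1] at this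
  have eu : ∀ i, e i * ∑ j, v j = v i := fun i => by
    rw [Finset.mul_sum, Finset.sum_eq_single i (fun j _ hj => by rw [← ev j, ← ma, he.or i j hj.symm, zero_mul]) (fun h => absurd (Finset.mem_univ i) h), ev]
  have su : star (∑ i, v i) = ∑ i, star (v i) := star_sum _ _
  refine ⟨∑ i, v i, ?_, ?_, fun a aM i j hij => ?_⟩
  · rw [su, sumd (fun i j hij => by rw [← ve i, ← ev j, ma, ← ma (e i), he.or i j hij, zero_mul, mul_zero]), ← ps]
    exact Finset.sum_congr rfl (fun i _ => v1 i)
  · rw [su, sumd (fun i j hij => by rw [← vp i, ← pv j, ma, ← ma (p i), hp.or i j hij, zero_mul, mul_zero]), ← s]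
    exact Finset.sum_congr rfl (fun i _ => v2 i)
  · have e2 : star (∑ i, v i) * e j = star (v j) := by
      have := congrArg star (eu j); rwa [star_mul, (he.pj j).1] at this
    calc _ = (e i * ∑ i, v i) * a * (star (∑ i, v i) * e j) := by simp only [ma]
      _ = v i * ((p i * a) * p j) * star (v j) := by rw [eu, e2, ← vp i, ← pv j]; simp only [ma]; rw [← ma (p i) (p i), (hp.pj i).2, ← ma (p j) (p j), (hp.pj j).2]
      _ = 0 := by rw [h.com (pM i) aM, ma a, hp.or i j hij]; simp
end AW

theorem simultaneous_diagonalization {A : Type u} [NormedRing A] [StarRing A]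
    [CStarRing A] [NormedAlgebra ℂ A] [StarModule ℂ A] [CompleteSpace A]
    (hAW : IsAWStarRing A) (n : ℕ)
    (X : Set (Matrix (Fin n) (Fin n) A))
    (hnormal : ∀ a ∈ X, star a * a = a * star a)
    (hcomm : ∀ a ∈ X, ∀ b ∈ X, a * b = b * a) :
    ∃ u : Matrix (Fin n) (Fin n) A, star u * u = 1 ∧ u * star u = 1 ∧
      ∀ a ∈ X, ∀ i j, i ≠ j → (u * a * star u) i j = 0 := by
  letI : CStarAlgebra A := {}
  letI := CStarAlgebra.spectralOrder A
  letI := CStarAlgebra.spectralOrderedRing A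
  haveI : AW.AWStar A := ⟨hAW⟩
  haveI : AW.AWStar (CStarMatrix (Fin n) (Fin n) A) := AW.cstar_aw (AW.cpm_fin n)
  obtain ⟨M, hM, XM⟩ := AW.masa (R := CStarMatrix (Fin n) (Fin n) A) (X := X) hnormal hcomm
  have ss : ∀ i j : Fin n, star (Matrix.single i j (1:A)) = Matrix.single j i (1:A) := fun i j => by
    rw [Matrix.star_eq_conjTranspose, Matrix.conjTranspose_single, star_one]
  obtain ⟨w, w1, w2, w3⟩ := hM.uni n (fun i => (Matrix.single i i (1:A) : Matrix (Fin n) (Fin n) A))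
    ⟨fun i => ⟨ss i i, by
      show (Matrix.single i i (1:A) : Matrix (Fin n) (Fin n) A) * Matrix.single i i (1:A) = Matrix.single i i (1:A)
      simp⟩, fun i j hij => by
      show (Matrix.single i i (1:A) : Matrix (Fin n) (Fin n) A) * Matrix.single j j (1:A) = 0
      simp [hij]⟩
    (by
      show ∑ i, (Matrix.single i i (1:A) : Matrix (Fin n) (Fin n) A) = 1
      exact Matrix.sum_single_one)
    (fun i j => by
      refine ⟨(Matrix.single j i (1:A) : Matrix (Fin n) (Fin n) A), ?_, ?_⟩
      · show star (Matrix.single j i (1:A) : Matrix (Fin n) (Fin n) A) * Matrix.single j i (1:A) = Matrix.single i i (1:A)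
        rw [ss]; simp
      · show (Matrix.single j i (1:A) : Matrix (Fin n) (Fin n) A) * star (Matrix.single j i (1:A)) = Matrix.single j j (1:A)
        rw [ss]; simp)
  refine ⟨w, w1, w2, fun a ha i j hij => ?_⟩
  let W : Matrix (Fin n) (Fin n) A := w
  have h3 : (Matrix.single i i (1:A) : Matrix (Fin n) (Fin n) A) * (W * a * star W) * Matrix.single j j (1:A) = 0 := w3 a (XM ha) i j hij
  have := congrFun (congrFun h3 i) j
  simpa using this
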